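/- Isotropic eigenvector delocalization (uniform model). There exist absolute constants c0, C > 0 with the following property. Let N, d be positive integers with Nd even and d ≥ 3, and let ξ > 0 satisfy ξ·log ξ ≥ c0·(log N)² and D ≥ c0·ξ². Then for any deterministic unit vector a ∈ ℝ^N orthogonal to e := N^{−1/2}(1,…,1)^T and any ζ ≥ c0, with probability at least 1 − e^{−ξ log ξ} − e^{−ζ·√(log ζ)} under the uniform model of random d-regular graphs on N vertices, every ℓ²-normalized eigenvector v of A satisfies |⟨a, v⟩| ≤ C·ξ·ζ²/√N. -/

import Mathlib

noncomputable section

/-- The number of elements of a finite type satisfying a predicate. -/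
def cardOf {α : Type*} [Fintype α] (p : α → Prop) : ℕ :=
  (@Finset.filter α p (Classical.decPred p) Finset.univ).card

/-- `G` encodes a simple `d`-regular graph on `N` vertices: it is symmetric, has zero
diagonal, and every row has exactly `d` ones. -/
def IsRegGraph (N d : ℕ) (G : Fin N → Fin N → Bool) : Prop :=
  (∀ i j, G i j = G j i) ∧ (∀ i, G i i = false) ∧
    ∀ i, (Finset.univ.filter fun j => G i j = true).card = d

/-- The `{0,1}`-valued adjacency matrix associated to `G`. -/
def adjOf {N : ℕ} (G : Fin N → Fin N → Bool) : Matrix (Fin N) (Fin N) ℝ :=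
  Matrix.of fun i j => if G i j then 1 else 0

/-- The probability of the event `P` under the uniform model of random `d`-regular
graphs on `N` vertices. -/
def unifProb (N d : ℕ) (P : Matrix (Fin N) (Fin N) ℝ → Prop) : ℝ :=
  (cardOf (fun G : Fin N → Fin N → Bool => IsRegGraph N d G ∧ P (adjOf G)) : ℝ) /
  (cardOf (fun G : Fin N → Fin N → Bool => IsRegGraph N d G) : ℝ)

/-- `D := min(d, N²/d³)` for the uniform model. -/
def Dunif (N d : ℕ) : ℝ := min (d : ℝ) ((N : ℝ) ^ 2 / (d : ℝ) ^ 3)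

section

open Matrix Finset

/-- The orthogonal projection onto the complement of the constant vectors. -/
noncomputable def projPerp (N : ℕ) : Matrix (Fin N) (Fin N) ℂ :=
  1 - Matrix.of fun _ _ => (N : ℂ)⁻¹

/-- `G` is the resolvent of `H` at `z` on the complement of the constant vectors. -/
structure IsRes {N : ℕ} (H : Matrix (Fin N) (Fin N) ℂ) (z : ℂ)
    (G : Matrix (Fin N) (Fin N) ℂ) : Prop where
  left : (H - z • 1) * G = projPerp N
  right : G * (H - z • 1) = projPerp N
  sum_row : ∀ i, ∑ j, G i j = 0
  sum_col : ∀ j, ∑ i, G i j = 0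

namespace IsRes

variable {N : ℕ} {H H' G G' : Matrix (Fin N) (Fin N) ℂ} {z z' : ℂ}

lemma mul_proj (h : IsRes H z G) : G * projPerp N = G := by
  unfold projPerp
  rw [mul_sub, mul_one, sub_eq_self]
  ext i j
  simp [Matrix.mul_apply, ← Finset.sum_mul, h.sum_row i]

lemma proj_mul (h : IsRes H z G) : projPerp N * G = G := by
  unfold projPerp
  rw [sub_mul, one_mul, sub_eq_self]
  ext i j
  simp [Matrix.mul_apply, ← Finset.mul_sum, h.sum_col j]

lemma sub_eq (h : IsRes H z G) (h' : IsRes H' z' G') :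
    G - G' = G * ((H' - z' • 1) - (H - z • 1)) * G' := by
  rw [mul_sub, sub_mul, mul_assoc, h'.left, h.right, h.mul_proj, h'.proj_mul]

lemma unique (h : IsRes H z G) (h' : IsRes H z G') : G = G' := by
  have := h.sub_eq h'
  simpa [sub_eq_zero] using this

lemma sub_eq_mul (h : IsRes H z G) (h' : IsRes H' z G') :
    G - G' = G * (H' - H) * G' := by
  rw [h.sub_eq h']; congr 2; abel

lemma sub_eq_smul (h : IsRes H z G) (h' : IsRes H z' G') :
    G - G' = (z - z') • (G * G') := by
  rw [h.sub_eq h']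
  have : (H - z' • 1) - (H - z • 1) = (z - z') • (1 : Matrix (Fin N) (Fin N) ℂ) := by
    rw [sub_smul]; abel
  rw [this]; simp

lemma transpose (h : IsRes H z G) (hH : Hᵀ = H) : IsRes H z Gᵀ where
  left := by
    have := congrArg Matrix.transpose h.right
    rw [transpose_mul, transpose_sub, hH] at this
    simp only [transpose_smul, transpose_one] at this
    rw [this]; ext i j; simp [projPerp, Matrix.one_apply, eq_comm]
  right := by
    have := congrArg Matrix.transpose h.left
    rw [transpose_mul, transpose_sub, hH] at this
    simp only [transpose_smul, transpose_one] at this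
    rw [this]; ext i j; simp [projPerp, Matrix.one_apply, eq_comm]
  sum_row i := h.sum_col i
  sum_col i := h.sum_row i

lemma symm (h : IsRes H z G) (hH : Hᵀ = H) (i j : Fin N) : G i j = G j i :=
  congrFun (congrFun (h.unique (h.transpose hH)) i) j

lemma conjTranspose (h : IsRes H z G) (hH : Hᴴ = H) : IsRes H (star z) Gᴴ where
  left := by
    have := congrArg Matrix.conjTranspose h.right
    rw [conjTranspose_mul, conjTranspose_sub, hH] at this
    simp only [conjTranspose_smul, conjTranspose_one] at this
    rw [this]; ext i j; simp [projPerp, Matrix.one_apply, eq_comm]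
  right := by
    have := congrArg Matrix.conjTranspose h.left
    rw [conjTranspose_mul, conjTranspose_sub, hH] at this
    simp only [conjTranspose_smul, conjTranspose_one] at this
    rw [this]; ext i j; simp [projPerp, Matrix.one_apply, eq_comm]
  sum_row i := by
    have := congrArg star (h.sum_col i)
    simpa using this
  sum_col i := by
    have := congrArg star (h.sum_row i)
    simpa using this

/-- The Ward identity. -/
lemma ward (h : IsRes H z G) (hH : Hᴴ = H) (a : Fin N) :
    z.im * ∑ b, ‖G a b‖ ^ 2 = (G a a).im := by
  have h1 := h.sub_eq_smul (h.conjTranspose hH)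
  have h2 := congrFun (congrFun h1 a) a
  have h3 := congrArg Complex.im h2
  obtain ⟨S, hS⟩ : ∃ S : ℝ, S = ∑ b, ‖G a b‖ ^ 2 := ⟨_, rfl⟩
  have h4 : (G * Gᴴ) a a = (S : ℂ) := by
    rw [Matrix.mul_apply, hS]; push_cast
    refine Finset.sum_congr rfl fun b _ => ?_
    rw [conjTranspose_apply, ← Complex.mul_conj']
    rfl
  simp only [Matrix.sub_apply, Matrix.smul_apply, h4, smul_eq_mul] at h3
  have h5 : (z - star z) = ((2 * z.im : ℝ) : ℂ) * Complex.I := by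
    apply Complex.ext <;> simp <;> ring
  rw [h5] at h3
  simp at h3
  rw [← hS]
  linarith

lemma sum_sq_le (h : IsRes H z G) (hH : Hᴴ = H) (hz : 0 < z.im) (a : Fin N) {B : ℝ}
    (hB : ‖G a a‖ ≤ B) : ∑ b, ‖G a b‖ ^ 2 ≤ B / z.im := by
  rw [le_div_iff₀ hz, mul_comm, h.ward hH]
  exact (Complex.abs_im_le_norm _).trans' (le_abs_self _) |>.trans hB

lemma norm_le (h : IsRes H z G) (hH : Hᴴ = H) (hz : 0 < z.im) (a b : Fin N) :
    ‖G a b‖ ≤ 1 / z.im := by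
  have h1 : ∀ c, ‖G a c‖ ^ 2 ≤ ‖G a a‖ / z.im := fun c =>
    (Finset.single_le_sum (f := fun c => ‖G a c‖ ^ 2) (fun _ _ => by positivity)
      (mem_univ c)).trans (h.sum_sq_le hH hz a le_rfl)
  have h2 : ‖G a a‖ ≤ 1 / z.im := by
    rcases (norm_nonneg (G a a)).eq_or_lt with h0 | h0
    · rw [← h0]; positivity
    · have := h1 a
      rw [sq, le_div_iff₀ hz] at this
      rw [le_div_iff₀ hz]
      nlinarith
  have h3 : ‖G a b‖ ^ 2 ≤ (1 / z.im) ^ 2 := by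
    refine (h1 b).trans ?_
    rw [sq, div_eq_mul_one_div]
    gcongr
  exact (sq_le_sq₀ (norm_nonneg _) (by positivity)).1 h3

/-- Halving the imaginary part at most doubles the entries of the resolvent. -/
lemma halving (h : IsRes H z G) (h' : IsRes H z' G') (hH : Hᴴ = H) (hHt : Hᵀ = H)
    (hz : 0 < z.im) (hz' : 2 * z'.im = z.im) (hre : z'.re = z.re) {B : ℝ} 
    (hB : ∀ a b, ‖G a b‖ ≤ B) (a b : Fin N) : ‖G' a b‖ ≤ 2 * B := by
  have hz'0 : 0 < z'.im := by linarith
  obtain ⟨⟨a0, b0⟩, -, hmax⟩ := Finset.exists_max_image univ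
    (fun p : Fin N × Fin N => ‖G' p.1 p.2‖) ⟨(a, b), mem_univ _⟩
  have hm : ∀ a b, ‖G' a b‖ ≤ ‖G' a0 b0‖ := fun a b => hmax (a, b) (mem_univ _)
  set m := ‖G' a0 b0‖ with hmdef
  have hB0 : 0 ≤ B := (norm_nonneg _).trans (hB a b)
  have hm0 : 0 ≤ m := norm_nonneg _
  refine (hm a b).trans ?_
  have e1 := congrFun (congrFun (h'.sub_eq_smul h) a0) b0
  have hzz : ‖z' - z‖ = z'.im := by
    have : z' - z = ((-z'.im : ℝ) : ℂ) * Complex.I := by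
      apply Complex.ext <;> simp [hre]; linarith
    rw [this]; simp [abs_of_pos hz'0]
  have hcs : ‖(G' * G) a0 b0‖ ^ 2 ≤ (m / z'.im) * (B / z.im) := by
    rw [Matrix.mul_apply]
    have s1 : ‖∑ j, G' a0 j * G j b0‖ ≤ ∑ j, ‖G' a0 j‖ * ‖G b0 j‖ := by
      refine (norm_sum_le _ _).trans (le_of_eq ?_)
      refine Finset.sum_congr rfl fun j _ => ?_
      rw [norm_mul, h.symm hHt j b0]
    calc _ ≤ (∑ j, ‖G' a0 j‖ * ‖G b0 j‖) ^ 2 := by gcongr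
      _ ≤ (∑ j, ‖G' a0 j‖ ^ 2) * ∑ j, ‖G b0 j‖ ^ 2 := Finset.sum_mul_sq_le_sq_mul_sq _ _ _
      _ ≤ _ := by
        gcongr
        · exact h'.sum_sq_le hH hz'0 _ (hm _ _)
        · exact h.sum_sq_le hH hz _ (hB _ _)
  have h2 : m ≤ B + z'.im * ‖(G' * G) a0 b0‖ := by
    have : G' a0 b0 = G a0 b0 + (z' - z) * (G' * G) a0 b0 := by
      simp only [Matrix.sub_apply, Matrix.smul_apply, smul_eq_mul] at e1
      rw [← e1]; ring
    calc m = ‖G a0 b0 + (z' - z) * (G' * G) a0 b0‖ := by rw [hmdef, this]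
      _ ≤ ‖G a0 b0‖ + ‖(z' - z) * (G' * G) a0 b0‖ := norm_add_le _ _
      _ ≤ _ := by rw [norm_mul, hzz]; gcongr; exact hB _ _
  by_contra hcon
  push Not at hcon
  set t := z'.im * ‖(G' * G) a0 b0‖ with ht
  have h3 : t ^ 2 ≤ m * B / 2 := by
    have : m / z'.im * (B / z.im) = m * B / (2 * z'.im ^ 2) := by
      rw [← hz']; field_simp
    rw [this, le_div_iff₀ (by positivity)] at hcs
    rw [ht]; nlinarith
  have h4 : m - B ≤ t := by linarith
  have h5 : (m - B) ^ 2 ≤ t ^ 2 := by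
    apply pow_le_pow_left₀ _ h4; linarith
  nlinarith

end IsRes

/-- The resolvent of `H` on the complement of the constant vectors. -/
noncomputable def resMat {N : ℕ} (H : Matrix (Fin N) (Fin N) ℂ) (z : ℂ) :
    Matrix (Fin N) (Fin N) ℂ := (H - z • 1)⁻¹ * projPerp N

lemma isUnit_sub_smul_one {N : ℕ} {H : Matrix (Fin N) (Fin N) ℂ} (hH : Hᴴ = H) {z : ℂ}
    (hz : 0 < z.im) : IsUnit (H - z • 1) := by
  rw [Matrix.isUnit_iff_isUnit_det, isUnit_iff_ne_zero]
  intro hdet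
  obtain ⟨v, hv, hv0⟩ := Matrix.exists_mulVec_eq_zero_iff.2 hdet
  rw [sub_mulVec, smul_mulVec, one_mulVec, sub_eq_zero] at hv0
  have h1 : star v ⬝ᵥ (H *ᵥ v) = z * (star v ⬝ᵥ v) := by
    rw [hv0, dotProduct_smul, smul_eq_mul]
  have h2 : (star v ⬝ᵥ (H *ᵥ v)).im = 0 := by
    have := (show H.IsHermitian from hH).im_star_dotProduct_mulVec_self v
    simpa using this
  have h3 : star v ⬝ᵥ v = ((∑ i, ‖v i‖ ^ 2 : ℝ) : ℂ) := by
    simp only [dotProduct, Pi.star_apply]; push_cast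
    refine Finset.sum_congr rfl fun i _ => ?_
    rw [← Complex.conj_mul']; rfl
  rw [h1, h3] at h2
  have h4 : (z * ((∑ i, ‖v i‖ ^ 2 : ℝ) : ℂ)).im = z.im * ∑ i, ‖v i‖ ^ 2 := by
    rw [Complex.mul_im, Complex.ofReal_im, Complex.ofReal_re]; ring
  rw [h4] at h2
  rcases mul_eq_zero.1 h2 with h5 | h5
  · exact hz.ne' h5
  · rw [Finset.sum_eq_zero_iff_of_nonneg (fun _ _ => by positivity)] at h5
    apply hv; ext i
    simpa using h5 i (mem_univ _)

lemma resMat_isRes {N : ℕ} {H : Matrix (Fin N) (Fin N) ℂ} (hH : Hᴴ = H) (hHt : Hᵀ = H)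
    {z r : ℂ} (hz : 0 < z.im) (hr : ∀ i, ∑ j, H i j = r) : IsRes H z (resMat H z) := by
  have hu := isUnit_sub_smul_one hH hz
  have hdet : IsUnit (H - z • 1).det := (Matrix.isUnit_iff_isUnit_det _).1 hu
  have hcol : ∀ j, ∑ i, H i j = r := fun j => by
    rw [← hr j]; refine Finset.sum_congr rfl fun i _ => ?_
    exact congrFun (congrFun hHt j) i
  have hc0 : projPerp N * H = H * projPerp N := by
    unfold projPerp
    rw [sub_mul, mul_sub, one_mul, mul_one]; congr 1
    ext i j
    simp [Matrix.mul_apply, ← Finset.sum_mul, hr, hcol, mul_comm]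
  have hc : projPerp N * (H - z • 1) = (H - z • 1) * projPerp N := by
    rw [mul_sub, sub_mul, hc0]; simp
  have hc' : projPerp N * (H - z • 1)⁻¹ = (H - z • 1)⁻¹ * projPerp N := by
    calc _ = (H - z • 1)⁻¹ * ((H - z • 1) * projPerp N) * (H - z • 1)⁻¹ := by
            rw [← mul_assoc, Matrix.nonsing_inv_mul _ hdet, one_mul]
      _ = _ := by
            rw [← hc, mul_assoc, mul_assoc, Matrix.mul_nonsing_inv _ hdet, mul_one]
  refine ⟨?_, ?_, ?_, ?_⟩
  · rw [resMat, ← mul_assoc, Matrix.mul_nonsing_inv _ hdet, one_mul]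
  · rw [resMat, ← hc', mul_assoc, Matrix.nonsing_inv_mul _ hdet, mul_one]
  · intro i
    have hN : (N : ℂ) ≠ 0 := by
      have : 0 < N := i.pos
      exact_mod_cast this.ne'
    simp only [resMat, Matrix.mul_apply]
    rw [Finset.sum_comm]
    refine Finset.sum_eq_zero fun k _ => ?_
    rw [← Finset.mul_sum]
    simp [projPerp, Matrix.one_apply, hN]
  · intro i
    have hN : (N : ℂ) ≠ 0 := by
      have : 0 < N := i.pos
      exact_mod_cast this.ne'
    rw [show resMat H z = projPerp N * (H - z • 1)⁻¹ from hc'.symm]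
    simp only [Matrix.mul_apply]
    rw [Finset.sum_comm]
    refine Finset.sum_eq_zero fun k _ => ?_
    rw [← Finset.sum_mul]
    simp [projPerp, Matrix.one_apply, hN]

/-- The finite set of all `d`-regular graphs. -/
noncomputable def regGraphs (N d : ℕ) : Finset (Fin N → Fin N → Bool) :=
  @Finset.filter _ (IsRegGraph N d) (Classical.decPred _) univ

lemma mem_regGraphs {N d : ℕ} {A : Fin N → Fin N → Bool} :
    A ∈ regGraphs N d ↔ IsRegGraph N d A := by simp [regGraphs]

/-- The complex adjacency matrix of a graph. -/
noncomputable def adjC {N : ℕ} (A : Fin N → Fin N → Bool) : Matrix (Fin N) (Fin N) ℂ :=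
  Matrix.of fun a b => if A a b then 1 else 0

lemma IsRegGraph.sum_row {N d : ℕ} {A : Fin N → Fin N → Bool} (h : IsRegGraph N d A)
    (a : Fin N) : ∑ b, adjC A a b = d := by
  simp [adjC, ← h.2.2 a]

lemma IsRegGraph.symm {N d : ℕ} {A : Fin N → Fin N → Bool} (h : IsRegGraph N d A)
    (a b : Fin N) : adjC A a b = adjC A b a := by
  simp [adjC, h.1 a b]

/-- The indicator of the unordered pair `{p, q}`. -/
def edgePair {N : ℕ} (p q a b : Fin N) : Bool := (a = p ∧ b = q) ∨ (a = q ∧ b = p)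

/-- Replace the edges `ik`, `xy` by the edges `ix`, `ky`. -/
def switchGraph {N : ℕ} (A : Fin N → Fin N → Bool) (i k x y : Fin N) :
    Fin N → Fin N → Bool := fun a b =>
  xor (A a b) (edgePair i k a b || edgePair x y a b || edgePair i x a b || edgePair k y a b)

/-- The switching data for which the switched graph is simple. -/
def IsSwitch {N : ℕ} (A : Fin N → Fin N → Bool) (i k x y : Fin N) : Prop :=
  A i k = true ∧ A x y = true ∧ x ≠ i ∧ k ≠ y ∧ A i x = false ∧ A k y = false

instance {N : ℕ} (A : Fin N → Fin N → Bool) (i k x y : Fin N) :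
    Decidable (IsSwitch A i k x y) := by unfold IsSwitch; infer_instance

/-- The matrix of the unordered pair `{p, q}`. -/
noncomputable def edgeMat {N : ℕ} (p q : Fin N) : Matrix (Fin N) (Fin N) ℂ :=
  Matrix.single p q 1 + Matrix.single q p 1

/-- The change of the adjacency matrix under a switching. -/
noncomputable def switchMat {N : ℕ} (i k x y : Fin N) : Matrix (Fin N) (Fin N) ℂ :=
  edgeMat i x + edgeMat k y - edgeMat i k - edgeMat x y

lemma switchGraph_comm {N : ℕ} (A : Fin N → Fin N → Bool) (i k x y : Fin N) :
    switchGraph (switchGraph A i k x y) i x k y = A := by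
  funext a b
  simp only [switchGraph]
  generalize edgePair i k a b = p
  generalize edgePair x y a b = q
  generalize edgePair i x a b = r
  generalize edgePair k y a b = s
  cases A a b <;> cases p <;> cases q <;> cases r <;> cases s <;> rfl

section
variable {N d : ℕ} {A : Fin N → Fin N → Bool} {i k x y : Fin N}

lemma IsSwitch.distinct (hA : IsRegGraph N d A) (h : IsSwitch A i k x y) :
    i ≠ k ∧ i ≠ x ∧ i ≠ y ∧ k ≠ x ∧ k ≠ y ∧ x ≠ y := by
  obtain ⟨h1, h2, h3, h4, h5, h6⟩ := h
  refine ⟨?_, h3.symm, ?_, ?_, h4, ?_⟩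
  · rintro rfl; simp [hA.2.1] at h1
  · rintro rfl; rw [hA.1, h5] at h2; simp at h2
  · rintro rfl; rw [h1] at h5; simp at h5
  · rintro rfl; simp [hA.2.1] at h2

lemma edgeMat_apply_of_ne {p q : Fin N} (h : p ≠ q) (a b : Fin N) :
    edgeMat p q a b = if edgePair p q a b then 1 else 0 := by
  simp only [edgeMat, edgePair, Matrix.add_apply, Matrix.single_apply, decide_eq_true_eq,
    eq_comm (a := a), eq_comm (a := b)]
  by_cases h1 : p = a ∧ q = b
  · obtain ⟨rfl, rfl⟩ := h1
    simp [h, Ne.symm h]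
  · simp [h1, and_comm]

lemma adjC_switchGraph (hA : IsRegGraph N d A) (h : IsSwitch A i k x y) :
    adjC (switchGraph A i k x y) = adjC A + switchMat i k x y := by
  obtain ⟨d1, d2, d3, d4, d5, d6⟩ := h.distinct hA
  obtain ⟨h1, h2, h3, h4, h5, h6⟩ := h
  have g1 := (hA.1 k i).trans h1
  have g2 := (hA.1 y x).trans h2
  have g5 := (hA.1 x i).trans h5
  have g6 := (hA.1 y k).trans h6
  ext a b
  simp only [adjC, switchGraph, switchMat, Matrix.add_apply, edgeMat_apply_of_ne d1,
    edgeMat_apply_of_ne d2, edgeMat_apply_of_ne d5, edgeMat_apply_of_ne d6,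
    Matrix.sub_apply, Matrix.of_apply]
  have e1 : edgePair i k a b = true → A a b = true := by grind [edgePair]
  have e2 : edgePair x y a b = true → A a b = true := by grind [edgePair]
  have e3 : edgePair i x a b = true → A a b = false := by grind [edgePair]
  have e4 : edgePair k y a b = true → A a b = false := by grind [edgePair]
  have e5 : ¬ (edgePair i k a b = true ∧ edgePair x y a b = true) := by grind [edgePair]
  have e6 : ¬ (edgePair i x a b = true ∧ edgePair k y a b = true) := by grind [edgePair]
  by_cases hp : edgePair i k a b = true <;> by_cases hq : edgePair x y a b = true <;>
    by_cases hr : edgePair i x a b = true <;> by_cases hs : edgePair k y a b = true <;>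
    by_cases ht : A a b = true <;> simp_all

lemma edgeMat_sum (p q a : Fin N) :
    ∑ b, edgeMat p q a b = (if a = p then 1 else 0) + (if a = q then 1 else 0) := by
  simp [edgeMat, Matrix.single_apply, Finset.sum_add_distrib, ite_and, eq_comm]

lemma switchMat_sum (i k x y a : Fin N) : ∑ b, switchMat i k x y a b = 0 := by
  simp only [switchMat, Matrix.add_apply, Matrix.sub_apply, Finset.sum_add_distrib,
    Finset.sum_sub_distrib, edgeMat_sum]
  ring

lemma IsSwitch.regular (hA : IsRegGraph N d A) (h : IsSwitch A i k x y) :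
    IsRegGraph N d (switchGraph A i k x y) := by
  obtain ⟨d1, d2, d3, d4, d5, d6⟩ := h.distinct hA
  refine ⟨fun a b => ?_, fun a => ?_, fun a => ?_⟩
  · have : ∀ p q : Fin N, edgePair p q a b = edgePair p q b a := fun p q => by
      simp only [edgePair, decide_eq_decide]; tauto
    simp [switchGraph, hA.1 a b, this]
  · simp only [switchGraph, edgePair, hA.2.1 a]
    by_cases ai : a = i
    · subst ai; simp [*]
    by_cases ak : a = k
    · subst ak; simp [*]
    by_cases ax : a = x
    · subst ax; simp [*]
    · simp [*]
  · have h1 : ∑ b, adjC (switchGraph A i k x y) a b = d := by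
      simp only [adjC_switchGraph hA h, Matrix.add_apply, Finset.sum_add_distrib,
        hA.sum_row, switchMat_sum, add_zero]
    simp only [adjC, Matrix.of_apply, Finset.sum_boole] at h1
    exact_mod_cast h1

lemma IsSwitch.reverse (hA : IsRegGraph N d A) (h : IsSwitch A i k x y) :
    IsSwitch (switchGraph A i k x y) i x k y := by
  obtain ⟨d1, d2, d3, d4, d5, d6⟩ := h.distinct hA
  obtain ⟨h1, h2, h3, h4, h5, h6⟩ := h
  refine ⟨?_, ?_, d1.symm, d6, ?_, ?_⟩ <;>
    simp [switchGraph, edgePair, *, d1.symm, d2.symm, d3.symm, d4.symm, d5.symm, d6.symm]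

end

/-- Invariance of the uniform measure under switchings at the vertex `i`. -/
lemma sum_switch {N d : ℕ} (i : Fin N) {E : Type*} [AddCommMonoid E]
    (Φ : (Fin N → Fin N → Bool) → Fin N → Fin N → Fin N → E) :
    ∑ A ∈ regGraphs N d, ∑ k, ∑ x, ∑ y, (if IsSwitch A i k x y then Φ A k x y else 0) =
    ∑ A ∈ regGraphs N d, ∑ k, ∑ x, ∑ y,
      (if IsSwitch A i k x y then Φ (switchGraph A i k x y) x k y else 0) := by
  have key : ∀ Ψ : (Fin N → Fin N → Bool) → Fin N → Fin N → Fin N → E,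
      ∑ A ∈ regGraphs N d, ∑ k, ∑ x, ∑ y, (if IsSwitch A i k x y then Ψ A k x y else 0) =
      ∑ t ∈ ((regGraphs N d) ×ˢ (univ : Finset (Fin N × Fin N × Fin N))).filter
        (fun t => IsSwitch t.1 i t.2.1 t.2.2.1 t.2.2.2), Ψ t.1 t.2.1 t.2.2.1 t.2.2.2 := by
    intro Ψ
    rw [Finset.sum_filter, Finset.sum_product]
    refine Finset.sum_congr rfl fun A _ => ?_
    simp only [Fintype.sum_prod_type]
  rw [key, key (fun A k x y => Φ (switchGraph A i k x y) x k y)]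
  refine Finset.sum_bij' (fun t _ => (switchGraph t.1 i t.2.1 t.2.2.1 t.2.2.2,
      t.2.2.1, t.2.1, t.2.2.2)) (fun t _ => (switchGraph t.1 i t.2.1 t.2.2.1 t.2.2.2,
      t.2.2.1, t.2.1, t.2.2.2)) ?_ ?_ ?_ ?_ ?_
  · rintro ⟨A, k, x, y⟩ h
    simp only [mem_filter, mem_product, mem_univ, and_true, mem_regGraphs] at h ⊢
    exact ⟨h.2.regular h.1, h.2.reverse h.1⟩
  · rintro ⟨A, k, x, y⟩ h
    simp only [mem_filter, mem_product, mem_univ, and_true, mem_regGraphs] at h ⊢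
    exact ⟨h.2.regular h.1, h.2.reverse h.1⟩
  · rintro ⟨A, k, x, y⟩ h
    simp [switchGraph_comm]
  · rintro ⟨A, k, x, y⟩ h
    simp [switchGraph_comm]
  · rintro ⟨A, k, x, y⟩ h
    simp [switchGraph_comm]

/-- The sum over all pairs consisting of an edge `ik` at `i` and an oriented edge `xy`. -/
def pairSum {N : ℕ} {E : Type*} [AddCommMonoid E] (A : Fin N → Fin N → Bool) (i : Fin N)
    (f : Fin N → Fin N → Fin N → E) : E :=
  ∑ k, ∑ x, ∑ y, if A i k = true ∧ A x y = true then f k x y else 0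

/-- The sum over all switchings at the vertex `i`. -/
def switchSum {N : ℕ} {E : Type*} [AddCommMonoid E] (A : Fin N → Fin N → Bool) (i : Fin N)
    (f : Fin N → Fin N → Fin N → E) : E :=
  ∑ k, ∑ x, ∑ y, if IsSwitch A i k x y then f k x y else 0

section pairSum
variable {N d : ℕ} {A : Fin N → Fin N → Bool} {i : Fin N}

section monoid
variable {E : Type*} [AddCommMonoid E]

lemma pairSum_add (f g : Fin N → Fin N → Fin N → E) :
    pairSum A i (fun k x y => f k x y + g k x y) = pairSum A i f + pairSum A i g := by
  simp only [pairSum, ← Finset.sum_add_distrib]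
  refine Finset.sum_congr rfl fun k _ => Finset.sum_congr rfl fun x _ =>
    Finset.sum_congr rfl fun y _ => ?_
  split_ifs <;> simp

lemma switchSum_add (f g : Fin N → Fin N → Fin N → E) :
    switchSum A i (fun k x y => f k x y + g k x y) = switchSum A i f + switchSum A i g := by
  simp only [switchSum, ← Finset.sum_add_distrib]
  refine Finset.sum_congr rfl fun k _ => Finset.sum_congr rfl fun x _ =>
    Finset.sum_congr rfl fun y _ => ?_
  split_ifs <;> simp

lemma switchSum_congr {f g : Fin N → Fin N → Fin N → E}
    (h : ∀ k x y, IsSwitch A i k x y → f k x y = g k x y) : switchSum A i f = switchSum A i g := by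
  refine Finset.sum_congr rfl fun k _ => Finset.sum_congr rfl fun x _ =>
    Finset.sum_congr rfl fun y _ => ?_
  split_ifs with hs
  · exact h _ _ _ hs
  · rfl

lemma IsRegGraph.sum_const (hA : IsRegGraph N d A) (a : Fin N) (c : E) :
    ∑ b, (if A a b = true then c else 0) = d • c := by
  rw [← Finset.sum_filter, Finset.sum_const, hA.2.2 a]

lemma IsRegGraph.sum_const_left (hA : IsRegGraph N d A) (b : Fin N) (c : E) :
    ∑ a, (if A a b = true then c else 0) = d • c := by
  simp only [hA.1 _ b, hA.sum_const]

lemma pairSum_first (hA : IsRegGraph N d A) (f : Fin N → E) :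
    pairSum A i (fun k _ _ => f k) = (N * d) • ∑ k, if A i k = true then f k else 0 := by
  simp only [pairSum, ite_and, Finset.smul_sum]
  refine Finset.sum_congr rfl fun k _ => ?_
  split_ifs
  · simp [hA.sum_const, mul_smul]
  · simp

lemma pairSum_edge (hA : IsRegGraph N d A) (f : Fin N → Fin N → E) :
    pairSum A i (fun _ x y => f x y) =
      d • ∑ x, ∑ y, if A x y = true then f x y else 0 := by
  simp only [pairSum, ite_and]
  rw [← hA.sum_const i]
  refine Finset.sum_congr rfl fun k _ => ?_
  split_ifs <;> simp

lemma pairSum_second (hA : IsRegGraph N d A) (f : Fin N → E) :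
    pairSum A i (fun _ x _ => f x) = (d * d) • ∑ x, f x := by
  rw [pairSum_edge hA, mul_smul, Finset.smul_sum (r := d) (f := f)]
  simp [hA.sum_const]

lemma pairSum_third (hA : IsRegGraph N d A) (f : Fin N → E) :
    pairSum A i (fun _ _ y => f y) = (d * d) • ∑ x, f x := by
  rw [pairSum_edge hA, Finset.sum_comm, mul_smul, Finset.smul_sum (r := d) (f := f)]
  simp [hA.sum_const_left]

lemma pairSum_first_third (hA : IsRegGraph N d A) (f : Fin N → Fin N → E) :
    pairSum A i (fun k _ y => f k y) =
      d • ∑ k, if A i k = true then ∑ y, f k y else 0 := by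
  simp only [pairSum, ite_and, Finset.smul_sum]
  refine Finset.sum_congr rfl fun k _ => ?_
  split_ifs
  · rw [Finset.sum_comm, Finset.smul_sum]
    simp [hA.sum_const_left]
  · simp

lemma pairSum_first_second (hA : IsRegGraph N d A) (f : Fin N → Fin N → E) :
    pairSum A i (fun k x _ => f k x) =
      d • ∑ k, if A i k = true then ∑ y, f k y else 0 := by
  simp only [pairSum, ite_and, Finset.smul_sum]
  refine Finset.sum_congr rfl fun k _ => ?_
  split_ifs
  · rw [Finset.smul_sum]
    simp [hA.sum_const]
  · simp

lemma sum_switchSum (i : Fin N) (Φ : (Fin N → Fin N → Bool) → Fin N → Fin N → Fin N → E) :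
    ∑ A ∈ regGraphs N d, switchSum A i (Φ A) =
    ∑ A ∈ regGraphs N d, switchSum A i fun k x y => Φ (switchGraph A i k x y) x k y :=
  sum_switch i Φ

end monoid

lemma pairSum_mono {f g : Fin N → Fin N → Fin N → ℝ} (h : ∀ k x y, f k x y ≤ g k x y) :
    pairSum A i f ≤ pairSum A i g := by
  refine Finset.sum_le_sum fun k _ => Finset.sum_le_sum fun x _ => Finset.sum_le_sum fun y _ => ?_
  split_ifs
  · exact h _ _ _
  · rfl

lemma switchSum_mono {f g : Fin N → Fin N → Fin N → ℝ}
    (h : ∀ k x y, IsSwitch A i k x y → f k x y ≤ g k x y) : switchSum A i f ≤ switchSum A i g := by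
  refine Finset.sum_le_sum fun k _ => Finset.sum_le_sum fun x _ => Finset.sum_le_sum fun y _ => ?_
  split_ifs with hs
  · exact h _ _ _ hs
  · rfl

lemma switchSum_le_pairSum {f : Fin N → Fin N → Fin N → ℝ} (h : ∀ k x y, 0 ≤ f k x y) :
    switchSum A i f ≤ pairSum A i f := by
  refine Finset.sum_le_sum fun k _ => Finset.sum_le_sum fun x _ => Finset.sum_le_sum fun y _ => ?_
  split_ifs with h1 h2 h2
  · rfl
  · exact absurd ⟨h1.1, h1.2.1⟩ h2
  · exact h _ _ _
  · rfl

lemma norm_pairSum_le (f : Fin N → Fin N → Fin N → ℂ) :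
    ‖pairSum A i f‖ ≤ pairSum A i fun k x y => ‖f k x y‖ := by
  refine (norm_sum_le _ _).trans <| Finset.sum_le_sum fun k _ =>
    (norm_sum_le _ _).trans <| Finset.sum_le_sum fun x _ =>
    (norm_sum_le _ _).trans <| Finset.sum_le_sum fun y _ => ?_
  split_ifs <;> simp

lemma norm_switchSum_le (f : Fin N → Fin N → Fin N → ℂ) :
    ‖switchSum A i f‖ ≤ switchSum A i fun k x y => ‖f k x y‖ := by
  refine (norm_sum_le _ _).trans <| Finset.sum_le_sum fun k _ =>
    (norm_sum_le _ _).trans <| Finset.sum_le_sum fun x _ =>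
    (norm_sum_le _ _).trans <| Finset.sum_le_sum fun y _ => ?_
  split_ifs <;> simp

lemma pairSum_const (hA : IsRegGraph N d A) (c : ℝ) :
    pairSum A i (fun _ _ _ => c) = N * d ^ 2 * c := by
  rw [pairSum_first hA, hA.sum_const]; simp; ring

lemma switchSum_const_le (hA : IsRegGraph N d A) {c : ℝ} (hc : 0 ≤ c) :
    switchSum A i (fun _ _ _ => c) ≤ N * d ^ 2 * c :=
  (switchSum_le_pairSum fun _ _ _ => hc).trans (pairSum_const hA c).le

/-- There are few pairs of edges that cannot be switched. -/
lemma norm_pairSum_sub_switchSum_le (hA : IsRegGraph N d A) {f : Fin N → Fin N → Fin N → ℂ}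
    {c : ℝ} (hc : 0 ≤ c) (hf : ∀ k x y, ‖f k x y‖ ≤ c) :
    ‖pairSum A i f - switchSum A i f‖ ≤ 4 * d ^ 3 * c := by
  have h1 : ‖pairSum A i f - switchSum A i f‖ ≤ pairSum A i (fun k x y =>
      ((if x = i then c else 0) + (if k = y then c else 0)) +
        ((if A i x = true then c else 0) + (if A k y = true then c else 0))) := by
    simp only [pairSum, switchSum, ← Finset.sum_sub_distrib]
    refine (norm_sum_le _ _).trans <| Finset.sum_le_sum fun k _ =>
      (norm_sum_le _ _).trans <| Finset.sum_le_sum fun x _ =>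
      (norm_sum_le _ _).trans <| Finset.sum_le_sum fun y _ => ?_
    by_cases hp : A i k = true ∧ A x y = true
    · by_cases hs : IsSwitch A i k x y
      · simp only [hp, hs]; simp; positivity
      · simp only [hp, hs]
        simp only [and_self, if_true, if_false, sub_zero]
        refine (hf _ _ _).trans ?_
        have h0 : ∀ p : Prop, [Decidable p] → (0 : ℝ) ≤ if p then c else 0 := fun p _ => by
          split_ifs <;> simp [hc]
        have a1 := h0 (x = i)
        have a2 := h0 (k = y)
        have a3 := h0 (A i x = true)
        have a4 := h0 (A k y = true)
        have : x = i ∨ k = y ∨ A i x = true ∨ A k y = true := by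
          by_contra hcon
          push Not at hcon
          exact hs ⟨hp.1, hp.2, hcon.1, hcon.2.1, by simpa using hcon.2.2.1,
            by simpa using hcon.2.2.2⟩
        rcases this with h | h | h | h <;> simp only [h, if_true] at * <;> linarith
    · have hs : ¬ IsSwitch A i k x y := fun h => hp ⟨h.1, h.2.1⟩
      simp [hp, hs]
  refine h1.trans ?_
  rw [pairSum_add, pairSum_add, pairSum_add, pairSum_second hA, pairSum_second hA,
    pairSum_first_third hA, pairSum_first_third hA]
  simp only [hA.sum_const, Finset.sum_ite_eq', Finset.sum_ite_eq, mem_univ, if_true]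
  simp only [nsmul_eq_mul, Nat.cast_mul]
  rcases Nat.eq_zero_or_pos d with rfl | hd
  · simp
  · have : (1 : ℝ) ≤ d := by exact_mod_cast hd
    have h2 : (d : ℝ) ^ 2 * c ≤ d ^ 3 * c := by
      exact mul_le_mul_of_nonneg_right (pow_le_pow_right₀ this (by norm_num)) hc
    nlinarith

end pairSum

lemma mul_edgeMat_mul {N : ℕ} (G G' : Matrix (Fin N) (Fin N) ℂ) (p q a b : Fin N) :
    (G * edgeMat p q * G') a b = G a p * G' q b + G a q * G' p b := by
  rw [edgeMat, mul_add, add_mul, Matrix.add_apply]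
  congr 1 <;>
  · rw [Matrix.mul_apply]
    rw [Finset.sum_eq_single _ (fun c _ hc => by
      rw [Matrix.mul_single_apply_of_ne _ _ _ _ _ hc, zero_mul]) (by simp)]
    simp

lemma mul_switchMat_mul {N : ℕ} (G G' : Matrix (Fin N) (Fin N) ℂ) (i k x y a b : Fin N) :
    (G * switchMat i k x y * G') a b =
      G a i * G' x b + G a x * G' i b + (G a k * G' y b + G a y * G' k b)
      - (G a i * G' k b + G a k * G' i b) - (G a x * G' y b + G a y * G' x b) := by
  simp only [switchMat, mul_sub, mul_add, sub_mul, add_mul, Matrix.sub_apply, Matrix.add_apply,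
    mul_edgeMat_mul]

lemma norm_eight_le (u1 u2 u3 u4 u5 u6 u7 u8 : ℂ) :
    ‖u1 + u2 + (u3 + u4) - (u5 + u6) - (u7 + u8)‖ ≤
      ‖u1‖ + ‖u2‖ + ‖u3‖ + ‖u4‖ + ‖u5‖ + ‖u6‖ + ‖u7‖ + ‖u8‖ := by
  have e1 := norm_sub_le (u1 + u2 + (u3 + u4) - (u5 + u6)) (u7 + u8)
  have e2 := norm_sub_le (u1 + u2 + (u3 + u4)) (u5 + u6)
  have e3 := norm_add_le (u1 + u2) (u3 + u4)
  have e4 := norm_add_le u1 u2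
  have e5 := norm_add_le u3 u4
  have e6 := norm_add_le u5 u6
  have e7 := norm_add_le u7 u8
  linarith

lemma norm_mul_switchMat_mul_le {N : ℕ} {G G' : Matrix (Fin N) (Fin N) ℂ} {B B' : ℝ}
    (hG : ∀ a b, ‖G a b‖ ≤ B) (hG' : ∀ a b, ‖G' a b‖ ≤ B') (i k x y a b : Fin N) :
    ‖(G * switchMat i k x y * G') a b‖ ≤ 8 * (B * B') := by
  have hB : 0 ≤ B := (norm_nonneg _).trans (hG i i)
  have key : ∀ p q : Fin N, ‖G a p * G' q b‖ ≤ B * B' := fun p q => by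
    rw [norm_mul]; exact mul_le_mul (hG _ _) (hG' _ _) (norm_nonneg _) hB
  rw [mul_switchMat_mul]
  refine (norm_eight_le _ _ _ _ _ _ _ _).trans ?_
  linarith [key i x, key x i, key k y, key y k, key i k, key k i, key x y, key y x]

/-- The resolvent of the normalized adjacency matrix. -/
noncomputable def green {N : ℕ} (d : ℕ) (z : ℂ) (A : Fin N → Fin N → Bool) :
    Matrix (Fin N) (Fin N) ℂ :=
  resMat (((Real.sqrt d)⁻¹ : ℝ) • adjC A) z

section green
variable {N d : ℕ} {A : Fin N → Fin N → Bool} {z : ℂ}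

lemma IsRegGraph.transpose (hA : IsRegGraph N d A) : (adjC A)ᵀ = adjC A := by
  ext a b; exact hA.symm b a

lemma IsRegGraph.conjTranspose (hA : IsRegGraph N d A) : (adjC A)ᴴ = adjC A := by
  ext a b
  rw [Matrix.conjTranspose_apply, hA.symm b a]
  simp only [adjC, Matrix.of_apply]; split_ifs <;> simp

lemma IsRegGraph.smul_transpose (hA : IsRegGraph N d A) (c : ℝ) :
    (c • adjC A)ᵀ = c • adjC A := by rw [Matrix.transpose_smul, hA.transpose]

lemma IsRegGraph.smul_conjTranspose (hA : IsRegGraph N d A) (c : ℝ) :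
    (c • adjC A)ᴴ = c • adjC A := by
  rw [Matrix.conjTranspose_smul, hA.conjTranspose]; simp

lemma green_isRes (hA : IsRegGraph N d A) (hz : 0 < z.im) :
    IsRes (((Real.sqrt d)⁻¹ : ℝ) • adjC A) z (green d z A) := by
  refine resMat_isRes (r := ((Real.sqrt d)⁻¹ : ℝ) • (d : ℂ)) (hA.smul_conjTranspose _)
    (hA.smul_transpose _) hz fun a => ?_
  simp only [Matrix.smul_apply, ← Finset.smul_sum, hA.sum_row]

lemma green_symm (hA : IsRegGraph N d A) (hz : 0 < z.im) (a b : Fin N) :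
    green d z A a b = green d z A b a :=
  (green_isRes hA hz).symm (hA.smul_transpose _) a b

lemma green_sum_col (hA : IsRegGraph N d A) (hz : 0 < z.im) (b : Fin N) :
    ∑ a, green d z A a b = 0 := (green_isRes hA hz).sum_col b

lemma green_norm_le (hA : IsRegGraph N d A) (hz : 0 < z.im) (a b : Fin N) :
    ‖green d z A a b‖ ≤ 1 / z.im :=
  (green_isRes hA hz).norm_le (hA.smul_conjTranspose _) hz a b

lemma green_sum_sq_le (hA : IsRegGraph N d A) (hz : 0 < z.im) {B : ℝ} {a : Fin N}
    (hB : ‖green d z A a a‖ ≤ B) : ∑ b, ‖green d z A a b‖ ^ 2 ≤ B / z.im :=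
  (green_isRes hA hz).sum_sq_le (hA.smul_conjTranspose _) hz a hB

/-- The resolvent equation, entrywise. -/
lemma green_neighbor_sum (hA : IsRegGraph N d A) (hd : 0 < d) (hz : 0 < z.im) (a b : Fin N) :
    (∑ k, if A a k = true then green d z A k b else 0) =
      Real.sqrt d * ((if a = b then 1 else 0) - 1 / N + z * green d z A a b) := by
  have h := congrFun (congrFun (green_isRes hA hz).left a) b
  have hs : (Real.sqrt d : ℂ) ≠ 0 := by
    exact_mod_cast (Real.sqrt_pos.2 (by exact_mod_cast hd : (0 : ℝ) < d)).ne'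
  rw [Matrix.sub_mul, Matrix.smul_mul, Matrix.smul_mul, Matrix.one_mul, Matrix.sub_apply,
    Matrix.smul_apply, Matrix.smul_apply, Matrix.mul_apply] at h
  have h2 : ∑ k, adjC A a k * green d z A k b =
      ∑ k, if A a k = true then green d z A k b else 0 := by
    refine Finset.sum_congr rfl fun k _ => ?_
    simp [adjC]
  rw [h2, sub_eq_iff_eq_add, Complex.real_smul, Complex.ofReal_inv, inv_mul_eq_iff_eq_mul₀ hs] at h
  rw [h]
  simp [projPerp, Matrix.one_apply]

lemma green_sub (hA : IsRegGraph N d A) (hz : 0 < z.im) {i k x y : Fin N}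
    (h : IsSwitch A i k x y) :
    green d z A - green d z (switchGraph A i k x y) = ((Real.sqrt d)⁻¹ : ℝ) •
      (green d z A * switchMat i k x y * green d z (switchGraph A i k x y)) := by
  rw [(green_isRes hA hz).sub_eq_mul (green_isRes (h.regular hA) hz), adjC_switchGraph hA h,
    ← smul_sub, add_sub_cancel_left, Matrix.mul_smul, Matrix.smul_mul]

end green

/-- The normalized trace of the resolvent. -/
noncomputable def stieltjes {N : ℕ} (d : ℕ) (z : ℂ) (A : Fin N → Fin N → Bool) : ℂ :=
  (N : ℂ)⁻¹ * ∑ x, green d z A x x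

/-- The error in the approximate self-consistent equation. -/
noncomputable def selfErr {N : ℕ} (d : ℕ) (z : ℂ) (A : Fin N → Fin N → Bool) (i j : Fin N) : ℂ :=
  (if i = j then 1 else 0) - 1 / N + (z + stieltjes d z A) * green d z A i j

section drift
variable {N d : ℕ} {A : Fin N → Fin N → Bool} {i j : Fin N} {z : ℂ} {B : ℝ}

lemma norm_trace_edges_le (hA : IsRegGraph N d A) (hd : 0 < d) (hz : 0 < z.im)
    (hB : ∀ a b, ‖green d z A a b‖ ≤ B) :
    ‖∑ x, ∑ y, if A x y = true then green d z A x y else 0‖ ≤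
      N * (Real.sqrt d * (1 + ‖z‖ * B)) := by
  have h1 : ∀ x, (∑ y, if A x y = true then green d z A x y else 0) =
      Real.sqrt d * (1 - 1 / N + z * green d z A x x) := fun x => by
    rw [← (by simpa using green_neighbor_sum hA hd hz x x :
      (∑ k, if A x k = true then green d z A k x else 0) =
      Real.sqrt d * (1 - 1 / N + z * green d z A x x))]
    exact Finset.sum_congr rfl fun k _ => by rw [green_symm hA hz]
  have h2 : ∀ x ∈ (univ : Finset (Fin N)),
      ‖∑ y, if A x y = true then green d z A x y else 0‖ ≤ Real.sqrt d * (1 + ‖z‖ * B) := by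
    intro x _
    rw [h1, norm_mul, Complex.norm_real, Real.norm_of_nonneg (Real.sqrt_nonneg _)]
    refine mul_le_mul_of_nonneg_left ?_ (Real.sqrt_nonneg _)
    have hN : (1 : ℝ) ≤ N := by exact_mod_cast (x.pos)
    have e1 : ‖(1 : ℂ) - 1 / N‖ ≤ 1 := by
      have : (1 : ℂ) - 1 / N = ((1 - 1 / N : ℝ) : ℂ) := by push_cast; rfl
      rw [this, Complex.norm_real, Real.norm_eq_abs, abs_le]
      have : 0 < 1 / (N : ℝ) := by positivity
      have : 1 / (N : ℝ) ≤ 1 := by rw [div_le_one (by linarith)]; exact hN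
      constructor <;> linarith
    refine (norm_add_le _ _).trans (add_le_add e1 ?_)
    rw [norm_mul]
    exact mul_le_mul_of_nonneg_left (hB _ _) (norm_nonneg _)
  refine (norm_sum_le _ _).trans ((Finset.sum_le_sum h2).trans ?_)
  simp

lemma pairSum_first_order (hA : IsRegGraph N d A) (hd : 0 < d) (hz : 0 < z.im)
    (hB : ∀ a b, ‖green d z A a b‖ ≤ B) (i j : Fin N) :
    ‖pairSum A i (fun k x y => (green d z A * switchMat i k x y * green d z A) x j)
      - N * d ^ 2 * (stieltjes d z A * green d z A i j)‖ ≤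
      4 * d ^ 2 * B * ∑ x, ‖green d z A x j‖ + d * B * (N * (Real.sqrt d * (1 + ‖z‖ * B))) := by
  set G := green d z A with hG
  have hB0 : 0 ≤ B := (norm_nonneg _).trans (hB i i)
  have hN : (N : ℂ) ≠ 0 := by exact_mod_cast (i.pos).ne'
  have e1 : pairSum A i (fun k x y => (G * switchMat i k x y * G) x j) =
      pairSum A i (fun k x y => G x i * G x j + G x k * G y j - G x x * G y j - G x y * G x j)
      + pairSum A i (fun _ x _ => G x x * G i j) + pairSum A i (fun k x y => G x y * G k j)
      + pairSum A i (fun k x _ => - (G x i * G k j))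
      + pairSum A i (fun k x _ => - (G x k * G i j)) := by
    simp only [← pairSum_add]
    congr 1
    funext k x y
    rw [mul_switchMat_mul]
    ring
  have e2 : pairSum A i (fun _ x _ => G x x * G i j) = N * d ^ 2 * (stieltjes d z A * G i j) := by
    rw [pairSum_second hA, stieltjes, ← hG, ← Finset.sum_mul, nsmul_eq_mul]
    push_cast
    field_simp
  have e3 : pairSum A i (fun k x _ => - (G x i * G k j)) = 0 := by
    rw [pairSum_first_second hA]
    simp only [Finset.sum_neg_distrib, ← Finset.sum_mul, hG, green_sum_col hA hz]
    simp
  have e4 : pairSum A i (fun k x _ => - (G x k * G i j)) = 0 := by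
    rw [pairSum_first_second hA]
    simp only [Finset.sum_neg_distrib, ← Finset.sum_mul, hG, green_sum_col hA hz]
    simp
  have e5 : pairSum A i (fun k x y => G x y * G k j) =
      (∑ k, if A i k = true then G k j else 0) * ∑ x, ∑ y, if A x y = true then G x y else 0 := by
    simp only [pairSum, ite_and]
    rw [Finset.sum_mul]
    refine Finset.sum_congr rfl fun k _ => ?_
    split_ifs
    · rw [Finset.mul_sum]
      refine Finset.sum_congr rfl fun x _ => ?_
      rw [Finset.mul_sum]
      refine Finset.sum_congr rfl fun y _ => ?_
      split_ifs <;> ring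
    · simp
  have b5 : ‖∑ k, if A i k = true then G k j else 0‖ ≤ d * B := by
    refine (norm_sum_le _ _).trans ?_
    rw [← nsmul_eq_mul, ← hA.sum_const i B]
    refine Finset.sum_le_sum fun k _ => ?_
    split_ifs
    · exact hB _ _
    · simp
  have b1 : ‖pairSum A i
      (fun k x y => G x i * G x j + G x k * G y j - G x x * G y j - G x y * G x j)‖ ≤
      4 * d ^ 2 * B * ∑ x, ‖G x j‖ := by
    refine (norm_pairSum_le _).trans ((pairSum_mono (g := fun k x y =>
      2 * B * ‖G x j‖ + 2 * B * ‖G y j‖) fun k x y => ?_).trans ?_)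
    · have key : ∀ u v, ‖G u v‖ ≤ B := hB
      have e1 := norm_sub_le (G x i * G x j + G x k * G y j - G x x * G y j) (G x y * G x j)
      have e2 := norm_sub_le (G x i * G x j + G x k * G y j) (G x x * G y j)
      have e3 := norm_add_le (G x i * G x j) (G x k * G y j)
      simp only [norm_mul] at e1 e2 e3
      have f1 := mul_le_mul_of_nonneg_right (key x i) (norm_nonneg (G x j))
      have f2 := mul_le_mul_of_nonneg_right (key x k) (norm_nonneg (G y j))
      have f3 := mul_le_mul_of_nonneg_right (key x x) (norm_nonneg (G y j))
      have f4 := mul_le_mul_of_nonneg_right (key x y) (norm_nonneg (G x j))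
      linarith
    · rw [pairSum_add, pairSum_second hA, pairSum_third hA, ← Finset.mul_sum, nsmul_eq_mul]
      push_cast
      apply le_of_eq; ring
  rw [e1, e2, e3, e4, e5]
  have : ∀ u v w : ℂ, u + v + w + 0 + 0 - v = u + w := fun u v w => by ring
  rw [this]
  refine (norm_add_le _ _).trans (add_le_add b1 ?_)
  rw [norm_mul]
  exact mul_le_mul b5 (norm_trace_edges_le hA hd hz hB) (norm_nonneg _) (by positivity)

/-- The expected drift of the resolvent under a random switching at `i`. -/
lemma drift (hA : IsRegGraph N d A) (hd : 0 < d) (hz : 0 < z.im)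
    (hB : ∀ a b, ‖green d z A a b‖ ≤ B) {B' : ℝ} (hB0' : 0 ≤ B')
    (hB' : ∀ k x y, IsSwitch A i k x y → ∀ a b, ‖green d z (switchGraph A i k x y) a b‖ ≤ B') :
    ‖switchSum A i (fun k x y => green d z A k j - green d z (switchGraph A i k x y) x j)
      - N * d * Real.sqrt d * selfErr d z A i j‖ ≤
      (Real.sqrt d)⁻¹ * (4 * d ^ 2 * B * ∑ x, ‖green d z A x j‖
        + d * B * (N * (Real.sqrt d * (1 + ‖z‖ * B))))
      + 4 * d ^ 3 * (2 * B + (Real.sqrt d)⁻¹ * (8 * (B * B)))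
      + N * d ^ 2 * ((Real.sqrt d)⁻¹ * ((Real.sqrt d)⁻¹ * (64 * (B * B * B')))) := by
  set G := green d z A with hG
  set σ : ℝ := (Real.sqrt d)⁻¹ with hσ
  have hσ0 : 0 ≤ σ := by positivity
  have hB0 : 0 ≤ B := (norm_nonneg _).trans (hB i i)
  set f : Fin N → Fin N → Fin N → ℂ := fun k x y =>
    (G k j - G x j) + σ * (G * switchMat i k x y * G) x j with hf
  have hd' : (0 : ℝ) < d := by exact_mod_cast hd
  have hsq : Real.sqrt d * Real.sqrt d = d := Real.mul_self_sqrt hd'.le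
  have hs0 : Real.sqrt d ≠ 0 := (Real.sqrt_pos.2 hd').ne'
  have h1 : switchSum A i (fun k x y => G k j - green d z (switchGraph A i k x y) x j) =
      switchSum A i f + switchSum A i (fun k x y => - (σ * (σ * (G * switchMat i k x y *
        (G * switchMat i k x y * green d z (switchGraph A i k x y))) x j))) := by
    rw [← switchSum_add]
    refine switchSum_congr fun k x y h => ?_
    have e := green_sub hA hz h
    rw [← hG, ← hσ] at e
    have e' : green d z (switchGraph A i k x y) = G - σ • (G * switchMat i k x y *
        green d z (switchGraph A i k x y)) := by rw [← e]; abel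
    have e2 : G - green d z (switchGraph A i k x y) = σ • (G * switchMat i k x y * G) -
        σ • σ • (G * switchMat i k x y * (G * switchMat i k x y *
        green d z (switchGraph A i k x y))) := by
      rw [e]
      conv_lhs => rw [e']
      rw [Matrix.mul_sub, Matrix.mul_smul, smul_sub]
    have e3 := congrFun (congrFun e2 x) j
    simp only [Matrix.sub_apply, Matrix.smul_apply, Complex.real_smul] at e3
    simp only [hf]
    linear_combination e3
  have h2 : ‖switchSum A i (fun k x y => - (σ * (σ * (G * switchMat i k x y *
        (G * switchMat i k x y * green d z (switchGraph A i k x y))) x j)))‖ ≤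
      N * d ^ 2 * (σ * (σ * (64 * (B * B * B')))) := by
    refine (norm_switchSum_le _).trans (le_trans (switchSum_mono
      (g := fun _ _ _ => σ * (σ * (64 * (B * B * B')))) fun k x y h => ?_)
      (switchSum_const_le hA (by positivity)))
    rw [norm_neg, norm_mul, norm_mul, Complex.norm_real, Real.norm_of_nonneg hσ0]
    gcongr
    refine (norm_mul_switchMat_mul_le hB (norm_mul_switchMat_mul_le hB (hB' k x y h) i k x y)
      i k x y x j).trans_eq ?_
    ring
  have h3 := norm_pairSum_sub_switchSum_le (i := i) (f := f) hA
    (c := 2 * B + σ * (8 * (B * B))) (by positivity) (fun k x y => by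
      simp only [hf]
      refine (norm_add_le _ _).trans (add_le_add ((norm_sub_le _ _).trans ?_) ?_)
      · linarith [hB k j, hB x j]
      · rw [norm_mul, Complex.norm_real, Real.norm_of_nonneg hσ0]
        exact mul_le_mul_of_nonneg_left (norm_mul_switchMat_mul_le hB hB _ _ _ _ _ _) hσ0)
  have h4 : pairSum A i f - N * d * Real.sqrt d * selfErr d z A i j =
      σ * (pairSum A i (fun k x y => (G * switchMat i k x y * G) x j)
      - N * d ^ 2 * (stieltjes d z A * G i j)) := by
    have t1 : pairSum A i f = pairSum A i (fun k _ _ => G k j) +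
        pairSum A i (fun _ x _ => - G x j) +
        pairSum A i (fun k x y => σ * (G * switchMat i k x y * G) x j) := by
      simp only [← pairSum_add, hf, sub_eq_add_neg]
    have t2 : pairSum A i (fun k x y => σ * (G * switchMat i k x y * G) x j) =
        σ * pairSum A i (fun k x y => (G * switchMat i k x y * G) x j) := by
      simp only [pairSum, Finset.mul_sum, mul_ite, mul_zero]
    have t3 : (σ : ℂ) * Real.sqrt d = 1 := by
      rw [hσ]; push_cast; exact inv_mul_cancel₀ (by exact_mod_cast hs0)
    have t4 : (Real.sqrt d : ℂ) * Real.sqrt d = d := by exact_mod_cast hsq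
    rw [t1, t2, pairSum_first hA, pairSum_second hA, green_neighbor_sum hA hd hz]
    simp only [Finset.sum_neg_distrib]
    rw [hG, green_sum_col hA hz, selfErr]
    simp only [nsmul_eq_mul]
    push_cast
    linear_combination (N * d * Real.sqrt d * stieltjes d z A * green d z A i j) * t3
      - (N * d * stieltjes d z A * green d z A i j * σ) * t4
  have h5 := pairSum_first_order hA hd hz hB i j
  have h6 : ‖pairSum A i f - N * d * Real.sqrt d * selfErr d z A i j‖ ≤
      σ * (4 * d ^ 2 * B * ∑ x, ‖G x j‖ + d * B * (N * (Real.sqrt d * (1 + ‖z‖ * B)))) := by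
    rw [h4, norm_mul, Complex.norm_real, Real.norm_of_nonneg hσ0]
    exact mul_le_mul_of_nonneg_left h5 hσ0
  rw [h1]
  have : ∀ p s t m : ℂ, s + t - m = (p - m) - (p - s) + t := fun p s t m => by ring
  rw [this (pairSum A i f)]
  refine (norm_add_le _ _).trans (add_le_add ((norm_sub_le _ _).trans (add_le_add h6 h3)) h2)

end drift

/-- All weighted resolvent entries are at most `B`. -/
def GreenBound {N : ℕ} (B : ℝ) (d : ℕ) (z : ℂ) (A : Fin N → Fin N → Bool) : Prop :=
  ∀ a b, (1 + ‖z‖) * ‖green d z A a b‖ ≤ B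

section stability
variable {N d : ℕ} {A : Fin N → Fin N → Bool} {i k x y : Fin N} {z : ℂ} {B : ℝ}

lemma one_le_weight (z : ℂ) : 1 ≤ 1 + ‖z‖ := by linarith [norm_nonneg z]

lemma GreenBound.mono {B' : ℝ} (h : GreenBound B d z A) (hB : B ≤ B') : GreenBound B' d z A :=
  fun a b => (h a b).trans hB

lemma GreenBound.norm_le (h : GreenBound B d z A) (a b : Fin N) : ‖green d z A a b‖ ≤ B :=
  (le_mul_of_one_le_left (norm_nonneg _) (one_le_weight z)).trans (h a b)

lemma norm_green_sub_le (hA : IsRegGraph N d A) (hz : 0 < z.im) (h : IsSwitch A i k x y)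
    {M M' : ℝ} (hM : ∀ a b, ‖green d z A a b‖ ≤ M)
    (hM' : ∀ a b, ‖green d z (switchGraph A i k x y) a b‖ ≤ M') (a b : Fin N) :
    ‖green d z A a b - green d z (switchGraph A i k x y) a b‖ ≤
      (Real.sqrt d)⁻¹ * (8 * (M * M')) := by
  have e := congrFun (congrFun (green_sub hA hz h) a) b
  rw [Matrix.sub_apply, Matrix.smul_apply] at e
  rw [e, norm_smul, Real.norm_of_nonneg (by positivity)]
  exact mul_le_mul_of_nonneg_left (norm_mul_switchMat_mul_le hM hM' _ _ _ _ _ _) (by positivity)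

/-- A single switching changes the resolvent only slightly. -/
lemma GreenBound.switch_sub_le (hA : IsRegGraph N d A) (hz : 0 < z.im)
    (h : IsSwitch A i k x y) (hB : GreenBound B d z A) (hB1 : 1 ≤ B)
    (hd : 16 * B ^ 2 ≤ Real.sqrt d) (a b : Fin N) :
    (1 + ‖z‖) * ‖green d z A a b - green d z (switchGraph A i k x y) a b‖ ≤
      16 * B ^ 2 / Real.sqrt d := by
  have hw := one_le_weight z
  have hw0 : 0 < 1 + ‖z‖ := by linarith
  have hs : 0 < Real.sqrt d := by nlinarith
  set G := green d z A
  set G' := green d z (switchGraph A i k x y)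
  obtain ⟨p, -, hp⟩ := Finset.exists_max_image (univ : Finset (Fin N × Fin N))
    (fun p => ‖G' p.1 p.2‖) ⟨(i, i), mem_univ _⟩
  set m := ‖G' p.1 p.2‖ with hm
  have hm0 : 0 ≤ m := norm_nonneg _
  have hM : ∀ a b, ‖G a b‖ ≤ B / (1 + ‖z‖) := fun a b => by
    rw [le_div_iff₀ hw0, mul_comm]; exact hB a b
  have hM1 : B / (1 + ‖z‖) ≤ B := div_le_self (by linarith) hw
  have hM' : ∀ a b, ‖G' a b‖ ≤ m := fun a b => hp (a, b) (mem_univ _)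
  have hinv : (Real.sqrt d)⁻¹ * (16 * B ^ 2) ≤ 1 := by
    rw [inv_mul_le_iff₀ hs, mul_one]; exact hd
  have hi0 : 0 < (Real.sqrt d)⁻¹ := inv_pos.2 hs
  have h1 := norm_green_sub_le hA hz h hM hM' p.1 p.2
  have h2 : m ≤ 2 * (B / (1 + ‖z‖)) := by
    have h3 : ‖G' p.1 p.2‖ ≤ ‖G p.1 p.2‖ + ‖G p.1 p.2 - G' p.1 p.2‖ := by
      have := norm_sub_le (G p.1 p.2) (G p.1 p.2 - G' p.1 p.2)
      rwa [sub_sub_cancel] at this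
    have h4 : (Real.sqrt d)⁻¹ * (8 * (B / (1 + ‖z‖) * m)) ≤ m / 2 := by
      have : (Real.sqrt d)⁻¹ * (8 * (B / (1 + ‖z‖))) ≤ 1 / 2 := by
        have : (Real.sqrt d)⁻¹ * (16 * (B / (1 + ‖z‖))) ≤ (Real.sqrt d)⁻¹ * (16 * B ^ 2) := by
          refine mul_le_mul_of_nonneg_left ?_ hi0.le
          nlinarith
        linarith
      nlinarith
    linarith [hM p.1 p.2]
  have h5 := norm_green_sub_le hA hz h hM (fun a b => (hM' a b).trans h2) a b
  have h6 : (1 + ‖z‖) * ((Real.sqrt d)⁻¹ * (8 * (B / (1 + ‖z‖) * (2 * (B / (1 + ‖z‖)))))) =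
      (Real.sqrt d)⁻¹ * (16 * (B * (B / (1 + ‖z‖)))) := by
    field_simp; ring
  refine (mul_le_mul_of_nonneg_left h5 hw0.le).trans ?_
  rw [h6, div_eq_inv_mul (16 * B ^ 2)]
  refine mul_le_mul_of_nonneg_left ?_ hi0.le
  nlinarith

lemma GreenBound.switch (hA : IsRegGraph N d A) (hz : 0 < z.im)
    (h : IsSwitch A i k x y) (hB : GreenBound B d z A) (hB1 : 1 ≤ B)
    (hd : 16 * B ^ 2 ≤ Real.sqrt d) : GreenBound (B + 1) d z (switchGraph A i k x y) := by
  intro a b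
  have h1 := GreenBound.switch_sub_le hA hz h hB hB1 hd a b
  have hs : 0 < Real.sqrt d := by nlinarith
  have h2 : 16 * B ^ 2 / Real.sqrt d ≤ 1 := by rw [div_le_one hs]; exact hd
  have h3 : ‖green d z (switchGraph A i k x y) a b‖ ≤ ‖green d z A a b‖ +
      ‖green d z A a b - green d z (switchGraph A i k x y) a b‖ := by
    have := norm_sub_le (green d z A a b)
      (green d z A a b - green d z (switchGraph A i k x y) a b)
    rwa [sub_sub_cancel] at this
  have hw := one_le_weight z
  have := hB a b
  nlinarith

/-- The size of the resolvent entries joining `a` to the switched edges. -/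
noncomputable def legSize (d : ℕ) (z : ℂ) (A : Fin N → Fin N → Bool) (i k x y : Fin N)
    (c : ℝ) (a : Fin N) : ℝ :=
  ‖green d z A x a‖ + ‖green d z A y a‖ + ‖green d z (switchGraph A i k x y) k a‖ + c

lemma legSize_nonneg {c : ℝ} (hc : 0 ≤ c) (a : Fin N) : 0 ≤ legSize d z A i k x y c a := by
  unfold legSize; positivity

lemma legSize_sq_le (c : ℝ) (a : Fin N) : legSize d z A i k x y c a ^ 2 ≤
    4 * (‖green d z A x a‖ ^ 2 + ‖green d z A y a‖ ^ 2 +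
      ‖green d z (switchGraph A i k x y) k a‖ ^ 2 + c ^ 2) := by
  unfold legSize
  generalize ‖green d z A x a‖ = p
  generalize ‖green d z A y a‖ = q
  generalize ‖green d z (switchGraph A i k x y) k a‖ = r
  nlinarith [sq_nonneg (p - q), sq_nonneg (p - r), sq_nonneg (p - c), sq_nonneg (q - r),
    sq_nonneg (q - c), sq_nonneg (r - c)]

lemma norm_green_sub_le_legSize (hA : IsRegGraph N d A) (hz : 0 < z.im)
    (h : IsSwitch A i k x y) {c : ℝ}
    (hc : ∀ a b, ‖green d z A a b - green d z (switchGraph A i k x y) a b‖ ≤ c)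
    (hB : GreenBound B d z A) (hB' : GreenBound B d z (switchGraph A i k x y)) (a b : Fin N) :
    (1 + ‖z‖) * ‖green d z A a b - green d z (switchGraph A i k x y) a b‖ ≤
      (Real.sqrt d)⁻¹ * (8 * B * (legSize d z A i k x y c a + legSize d z A i k x y c b)) := by
  have hc0 : 0 ≤ c := (norm_nonneg _).trans (hc i i)
  have e := congrFun (congrFun (green_sub hA hz h) a) b
  rw [Matrix.sub_apply, Matrix.smul_apply, mul_switchMat_mul] at e
  have hw := one_le_weight z
  have la0 := legSize_nonneg (d := d) (z := z) (A := A) (i := i) (k := k) (x := x) (y := y) hc0 a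
  have lb0 := legSize_nonneg (d := d) (z := z) (A := A) (i := i) (k := k) (x := x) (y := y) hc0 b
  set la := legSize d z A i k x y c a with hla
  set lb := legSize d z A i k x y c b with hlb
  have sG := green_symm hA hz
  have sG' := green_symm (h.regular hA) hz
  set G := green d z A
  set G' := green d z (switchGraph A i k x y)
  have hB0 : 0 ≤ B := (by positivity : (0 : ℝ) ≤ (1 + ‖z‖) * ‖G i i‖).trans (hB i i)
  have up : ∀ u v, ‖G u v‖ ≤ ‖G' u v‖ + c := fun u v => by
    have := norm_add_le (G' u v) (G u v - G' u v)
    rw [add_sub_cancel] at this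
    exact this.trans (add_le_add le_rfl (hc u v))
  have dn : ∀ u v, ‖G' u v‖ ≤ ‖G u v‖ + c := fun u v => by
    have := norm_sub_le (G u v) (G u v - G' u v)
    rw [sub_sub_cancel] at this
    exact this.trans (add_le_add le_rfl (hc u v))
  have n := fun u v => norm_nonneg (G u v)
  have n' := fun u v => norm_nonneg (G' u v)
  have xa : ‖G a x‖ ≤ la := by rw [sG]; simp only [hla, legSize]; linarith [n y a, n' k a]
  have ya : ‖G a y‖ ≤ la := by rw [sG]; simp only [hla, legSize]; linarith [n x a, n' k a]
  have ka : ‖G a k‖ ≤ la := by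
    rw [sG]; simp only [hla, legSize]; linarith [n x a, n y a, up k a]
  have xb : ‖G' x b‖ ≤ lb := by simp only [hlb, legSize]; linarith [n y b, n' k b, dn x b]
  have yb : ‖G' y b‖ ≤ lb := by simp only [hlb, legSize]; linarith [n x b, n' k b, dn y b]
  have kb : ‖G' k b‖ ≤ lb := by simp only [hlb, legSize]; linarith [n x b, n y b]
  have right : ∀ u v, ‖G' v b‖ ≤ lb → (1 + ‖z‖) * ‖G a u * G' v b‖ ≤ B * (la + lb) :=
    fun u v hv => by
      rw [norm_mul, ← mul_assoc]
      exact mul_le_mul (hB a u) (by linarith) (n' _ _) hB0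
  have left : ∀ u v, ‖G a u‖ ≤ la → (1 + ‖z‖) * ‖G a u * G' v b‖ ≤ B * (la + lb) :=
    fun u v hv => by
      rw [norm_mul, mul_comm ‖G a u‖, ← mul_assoc]
      exact mul_le_mul (hB' v b) (by linarith) (n _ _) hB0
  rw [e, norm_smul, Real.norm_of_nonneg (by positivity), mul_left_comm]
  refine mul_le_mul_of_nonneg_left ?_ (by positivity)
  refine (mul_le_mul_of_nonneg_left (norm_eight_le _ _ _ _ _ _ _ _) (by linarith)).trans ?_
  simp only [mul_add (1 + ‖z‖)]
  linarith [right i x xb, left x i xa, right k y yb, left y k ya, right i k kb, left k i ka,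
    left x y xa, left y x ya]

lemma norm_drift_term_le {c : ℝ}
    (hc : ∀ a b, ‖green d z A a b - green d z (switchGraph A i k x y) a b‖ ≤ c) (j : Fin N) :
    ‖green d z A k j - green d z (switchGraph A i k x y) x j‖ ≤
      2 * legSize d z A i k x y c j := by
  set G := green d z A with hG
  set G' := green d z (switchGraph A i k x y) with hG'
  have h1 : ‖G k j - G' x j‖ ≤ ‖G' k j‖ + ‖G k j - G' k j‖ + (‖G x j‖ + ‖G x j - G' x j‖) := by
    have e : G k j - G' x j = G' k j + (G k j - G' k j) - (G x j - (G x j - G' x j)) := by ring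
    rw [e]
    refine (norm_sub_le _ _).trans (add_le_add (norm_add_le _ _) (norm_sub_le _ _))
  have := hc k j
  have := hc x j
  simp only [legSize, ← hG, ← hG']
  have n1 := norm_nonneg (G x j)
  have n2 := norm_nonneg (G y j)
  have n3 := norm_nonneg (G' k j)
  linarith

end stability

/-- A smooth approximation of the maximum of a finite family. -/
noncomputable def softMax {ι : Type*} [Fintype ι] (β : ℝ) (t : ι → ℝ) : ℝ :=
  β⁻¹ * Real.log (∑ p, Real.exp (β * t p))

/-- The gradient of `softMax`. -/
noncomputable def softWeight {ι : Type*} [Fintype ι] (β : ℝ) (t : ι → ℝ) (p : ι) : ℝ :=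
  Real.exp (β * t p) / ∑ q, Real.exp (β * t q)

section softMax
variable {ι : Type*} [Fintype ι] [Nonempty ι] {β : ℝ} (t t' : ι → ℝ)

lemma sum_exp_pos : 0 < ∑ p, Real.exp (β * t p) :=
  Finset.sum_pos (fun _ _ => Real.exp_pos _) univ_nonempty

lemma softWeight_nonneg (p : ι) : 0 ≤ softWeight β t p :=
  div_nonneg (Real.exp_pos _).le (sum_exp_pos t).le

lemma sum_softWeight : ∑ p, softWeight β t p = 1 := by
  simp only [softWeight, ← Finset.sum_div]
  exact div_self (sum_exp_pos t).ne'

lemma le_softMax (hβ : 0 < β) (p : ι) : t p ≤ softMax β t := by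
  rw [softMax, ← div_eq_inv_mul, le_div_iff₀ hβ, Real.le_log_iff_exp_le (sum_exp_pos t), mul_comm]
  exact Finset.single_le_sum (f := fun p => Real.exp (β * t p))
    (fun p _ => (Real.exp_pos _).le) (mem_univ p)

lemma softMax_le (hβ : 0 < β) {M : ℝ} (h : ∀ p, t p ≤ M) :
    softMax β t ≤ M + β⁻¹ * Real.log (Fintype.card ι) := by
  have h1 : ∑ p, Real.exp (β * t p) ≤ Fintype.card ι * Real.exp (β * M) := by
    refine (Finset.sum_le_sum (g := fun _ => Real.exp (β * M)) fun p _ => ?_).trans ?_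
    · exact Real.exp_le_exp.2 (mul_le_mul_of_nonneg_left (h p) hβ.le)
    · simp
  have hc : (0 : ℝ) < Fintype.card ι := by exact_mod_cast Fintype.card_pos
  have h2 := Real.log_le_log (sum_exp_pos t) h1
  rw [Real.log_mul hc.ne' (Real.exp_pos _).ne', Real.log_exp] at h2
  calc softMax β t ≤ β⁻¹ * (Real.log (Fintype.card ι) + β * M) :=
        mul_le_mul_of_nonneg_left h2 (by positivity)
    _ = _ := by field_simp; ring

lemma softMax_sub_ge (hβ : 0 < β) :
    ∑ p, softWeight β t' p * (t p - t' p) ≤ softMax β t - softMax β t' := by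
  have h1 : Real.exp (∑ p, softWeight β t' p • (β * (t p - t' p))) ≤
      ∑ p, softWeight β t' p • Real.exp (β * (t p - t' p)) :=
    convexOn_exp.map_sum_le (fun p _ => softWeight_nonneg t' p) (sum_softWeight t') (by simp)
  have h2 : ∑ p, softWeight β t' p • Real.exp (β * (t p - t' p)) =
      (∑ p, Real.exp (β * t p)) / ∑ p, Real.exp (β * t' p) := by
    rw [Finset.sum_div]
    refine Finset.sum_congr rfl fun p _ => ?_
    rw [softWeight, smul_eq_mul, div_mul_eq_mul_div, ← Real.exp_add]
    congr 2; ring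
  rw [h2] at h1
  have h3 := (Real.le_log_iff_exp_le (div_pos (sum_exp_pos t) (sum_exp_pos t'))).2 h1
  rw [Real.log_div (sum_exp_pos t).ne' (sum_exp_pos t').ne'] at h3
  rw [softMax, softMax, ← mul_sub, ← div_eq_inv_mul, le_div_iff₀ hβ, Finset.sum_mul]
  refine le_trans (le_of_eq ?_) h3
  refine Finset.sum_congr rfl fun p _ => ?_
  rw [smul_eq_mul]; ring

lemma abs_softMax_sub_le (hβ : 0 < β) : |softMax β t - softMax β t'| ≤
    ∑ p, (softWeight β t p + softWeight β t' p) * |t p - t' p| := by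
  have key : ∀ s s' : ι → ℝ, softMax β s' - softMax β s ≤ ∑ p, softWeight β s' p * |s p - s' p| :=
    fun s s' => by
      have := softMax_sub_ge s s' hβ
      have h2 : ∑ p, softWeight β s' p * (s p - s' p) ≥
          - ∑ p, softWeight β s' p * |s p - s' p| := by
        rw [← Finset.sum_neg_distrib]
        refine Finset.sum_le_sum fun p _ => ?_
        rw [← mul_neg]
        exact mul_le_mul_of_nonneg_left (neg_abs_le _) (softWeight_nonneg s' p)
      linarith
  have h1 := key t t'
  have h2 := key t' t
  simp only [add_mul, Finset.sum_add_distrib]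
  have e : ∀ p, |t' p - t p| = |t p - t' p| := fun p => abs_sub_comm _ _
  simp only [e] at h2
  have n1 : 0 ≤ ∑ p, softWeight β t p * |t p - t' p| :=
    Finset.sum_nonneg fun p _ => mul_nonneg (softWeight_nonneg t p) (abs_nonneg _)
  have n2 : 0 ≤ ∑ p, softWeight β t' p * |t p - t' p| :=
    Finset.sum_nonneg fun p _ => mul_nonneg (softWeight_nonneg t' p) (abs_nonneg _)
  rw [abs_le]; constructor <;> linarith

lemma softWeight_le (h : ∀ p, |β * t p - β * t' p| ≤ 1) (p : ι) :
    softWeight β t p ≤ 8 * softWeight β t' p := by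
  have h1 : Real.exp (β * t p) ≤ Real.exp 1 * Real.exp (β * t' p) := by
    rw [← Real.exp_add]
    exact Real.exp_le_exp.2 (by linarith [(abs_le.1 (h p)).2])
  have h2 : ∑ q, Real.exp (β * t' q) ≤ Real.exp 1 * ∑ q, Real.exp (β * t q) := by
    rw [Finset.mul_sum]
    refine Finset.sum_le_sum fun q _ => ?_
    rw [← Real.exp_add]
    exact Real.exp_le_exp.2 (by linarith [(abs_le.1 (h q)).1])
  have he : Real.exp 1 * Real.exp 1 ≤ 8 := by
    have := Real.exp_one_lt_d9
    have := Real.exp_pos 1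
    nlinarith
  have p1 := sum_exp_pos (β := β) t
  have p2 := sum_exp_pos (β := β) t'
  rw [softWeight, softWeight, ← mul_div_assoc, div_le_div_iff₀ p1 p2]
  have e1 := Real.exp_pos (β * t p)
  have e2 := Real.exp_pos (β * t' p)
  have e3 := Real.exp_pos 1
  calc _ ≤ (Real.exp 1 * Real.exp (β * t' p)) * (Real.exp 1 * ∑ q, Real.exp (β * t q)) :=
        mul_le_mul h1 h2 p2.le (by positivity)
    _ = (Real.exp 1 * Real.exp 1) * (Real.exp (β * t' p) * ∑ q, Real.exp (β * t q)) := by ring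
    _ ≤ 8 * (Real.exp (β * t' p) * ∑ q, Real.exp (β * t q)) :=
        mul_le_mul_of_nonneg_right he (by positivity)
    _ = _ := by ring

end softMax

/-- The weighted resolvent entries. -/
noncomputable def greenSize {N : ℕ} (d : ℕ) (z : ℂ) (A : Fin N → Fin N → Bool)
    (p : Fin N × Fin N) : ℝ := (1 + ‖z‖) * ‖green d z A p.1 p.2‖

/-- The potential which is positive when the self-consistent equation fails at `(i, j)` while
the resolvent is bounded. -/
noncomputable def potential {N : ℕ} (d : ℕ) (z u : ℂ) (β γ ε : ℝ) (i j : Fin N)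
    (A : Fin N → Fin N → Bool) : ℝ :=
  min ((u * selfErr d z A i j).re - ε) (γ - softMax β (greenSize d z A))

/-- Weights dominating the gradient of the potential. -/
noncomputable def gradWeight {N : ℕ} (d : ℕ) (z : ℂ) (β B : ℝ) (i j : Fin N)
    (A : Fin N → Fin N → Bool) (p : Fin N × Fin N) : ℝ :=
  9 * softWeight β (greenSize d z A) p + B * (if p = (i, j) then 1 else 0) +
    B / N * (if p.1 = p.2 then 1 else 0)

section potential
variable {N d : ℕ} {A : Fin N → Fin N → Bool} {i j k x y : Fin N} {z u : ℂ} {B β γ ε : ℝ}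

lemma gradWeight_nonneg (hB : 0 ≤ B) (p : Fin N × Fin N) : 0 ≤ gradWeight d z β B i j A p := by
  have : Nonempty (Fin N × Fin N) := ⟨p⟩
  have := softWeight_nonneg (β := β) (greenSize d z A) p
  unfold gradWeight
  positivity

lemma sum_gradWeight (d : ℕ) (z : ℂ) (β B : ℝ) (i j : Fin N) (A : Fin N → Fin N → Bool) :
    ∑ p, gradWeight d z β B i j A p = 9 + 2 * B := by
  have : Nonempty (Fin N × Fin N) := ⟨(i, j)⟩
  have hN : (N : ℝ) ≠ 0 := by exact_mod_cast i.pos.ne'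
  simp only [gradWeight, Finset.sum_add_distrib, ← Finset.mul_sum, sum_softWeight,
    Finset.sum_ite_eq', mem_univ, if_true]
  rw [Fintype.sum_prod_type]
  simp
  field_simp
  ring

lemma GreenBound.stieltjes_le (hN : 0 < N) (h : GreenBound B d z A) : ‖stieltjes d z A‖ ≤ B := by
  have hN' : (0 : ℝ) < N := by exact_mod_cast hN
  rw [stieltjes, norm_mul, norm_inv, Complex.norm_natCast, inv_mul_le_iff₀ hN']
  refine (norm_sum_le _ _).trans ((Finset.sum_le_sum fun x _ => h.norm_le x x).trans ?_)
  simp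

lemma norm_stieltjes_sub_le (A A' : Fin N → Fin N → Bool) :
    ‖stieltjes d z A - stieltjes d z A'‖ ≤
      (N : ℝ)⁻¹ * ∑ x, ‖green d z A x x - green d z A' x x‖ := by
  rw [stieltjes, stieltjes, ← mul_sub, norm_mul, norm_inv, Complex.norm_natCast,
    ← Finset.sum_sub_distrib]
  exact mul_le_mul_of_nonneg_left (norm_sum_le _ _) (by positivity)

lemma norm_selfErr_sub_le {A' : Fin N → Fin N → Bool} (h : GreenBound B d z A)
    (h' : GreenBound B d z A') (hB : 1 ≤ B) (i j : Fin N) :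
    ‖selfErr d z A i j - selfErr d z A' i j‖ ≤
      ∑ p : Fin N × Fin N, (B * (if p = (i, j) then 1 else 0) +
        B / N * (if p.1 = p.2 then 1 else 0)) *
        ((1 + ‖z‖) * ‖green d z A p.1 p.2 - green d z A' p.1 p.2‖) := by
  have e : selfErr d z A i j - selfErr d z A' i j =
      (z + stieltjes d z A) * (green d z A i j - green d z A' i j) +
      (stieltjes d z A - stieltjes d z A') * green d z A' i j := by
    unfold selfErr; ring
  have hw := one_le_weight z
  have h1 : ‖z + stieltjes d z A‖ ≤ B * (1 + ‖z‖) := by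
    have := norm_add_le z (stieltjes d z A)
    have := h.stieltjes_le i.pos
    nlinarith [norm_nonneg z]
  have h2 := norm_stieltjes_sub_le (d := d) (z := z) A A'
  have h3 : ∑ x, ‖green d z A x x - green d z A' x x‖ ≤
      ∑ x, (1 + ‖z‖) * ‖green d z A x x - green d z A' x x‖ :=
    Finset.sum_le_sum fun x _ => le_mul_of_one_le_left (norm_nonneg _) hw
  have e2 : ∑ p : Fin N × Fin N, (B * (if p = (i, j) then 1 else 0) +
        B / N * (if p.1 = p.2 then 1 else 0)) *
        ((1 + ‖z‖) * ‖green d z A p.1 p.2 - green d z A' p.1 p.2‖) =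
      B * ((1 + ‖z‖) * ‖green d z A i j - green d z A' i j‖) +
      B / N * ∑ x, (1 + ‖z‖) * ‖green d z A x x - green d z A' x x‖ := by
    simp only [add_mul, Finset.sum_add_distrib]
    congr 1
    · simp
    · simp only [mul_assoc, ← Finset.mul_sum]
      rw [Fintype.sum_prod_type]
      simp [Finset.mul_sum, mul_add, Finset.sum_add_distrib]
  rw [e, e2]
  refine (norm_add_le _ _).trans (add_le_add ?_ ?_)
  · rw [norm_mul, ← mul_assoc]
    exact mul_le_mul_of_nonneg_right h1 (norm_nonneg _)
  · rw [norm_mul, mul_comm, div_eq_mul_inv, mul_assoc]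
    refine mul_le_mul (h'.norm_le i j) (h2.trans ?_) (norm_nonneg _) (by linarith)
    exact mul_le_mul_of_nonneg_left h3 (by positivity)

/-- The increment of the potential, bounded by a common minorant of the weights at both
endpoints. -/
lemma exists_potential_sub_le {A' : Fin N → Fin N → Bool} (h : GreenBound B d z A)
    (h' : GreenBound B d z A') (hB : 1 ≤ B) (hβ : 0 < β) (hu : ‖u‖ = 1)
    (hc : ∀ a b, β * ((1 + ‖z‖) * ‖green d z A a b - green d z A' a b‖) ≤ 1) (i j : Fin N) :
    ∃ r : Fin N × Fin N → ℝ, (∀ p, 0 ≤ r p) ∧ (∀ p, r p ≤ gradWeight d z β B i j A p) ∧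
      (∀ p, r p ≤ gradWeight d z β B i j A' p) ∧
      |potential d z u β γ ε i j A - potential d z u β γ ε i j A'| ≤
        ∑ p, r p * ((1 + ‖z‖) * ‖green d z A p.1 p.2 - green d z A' p.1 p.2‖) := by
  have : Nonempty (Fin N × Fin N) := ⟨(i, j)⟩
  have hw := one_le_weight z
  set t := greenSize d z A with ht
  set t' := greenSize d z A' with ht'
  have hd : ∀ p, |t p - t' p| ≤ (1 + ‖z‖) * ‖green d z A p.1 p.2 - green d z A' p.1 p.2‖ :=
    fun p => by
      rw [ht, ht', greenSize, greenSize, ← mul_sub, abs_mul, abs_of_pos (by linarith)]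
      exact mul_le_mul_of_nonneg_left (abs_norm_sub_norm_le _ _) (by linarith)
  have hd1 : ∀ p, |β * t p - β * t' p| ≤ 1 := fun p => by
    rw [← mul_sub, abs_mul, abs_of_pos hβ]
    exact (mul_le_mul_of_nonneg_left (hd p) hβ.le).trans (hc _ _)
  have hd2 : ∀ p, |β * t' p - β * t p| ≤ 1 := fun p => by rw [abs_sub_comm]; exact hd1 p
  have w1 := softWeight_le t t' hd1
  have w2 := softWeight_le t' t hd2
  have n1 := softWeight_nonneg (β := β) t
  have n2 := softWeight_nonneg (β := β) t'
  refine ⟨fun p => softWeight β t p + softWeight β t' p + (B * (if p = (i, j) then 1 else 0) +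
        B / N * (if p.1 = p.2 then 1 else 0)), fun p => ?_, fun p => ?_, fun p => ?_, ?_⟩
  · have := n1 p
    have := n2 p
    positivity
  · unfold gradWeight; linarith [w2 p]
  · unfold gradWeight; linarith [w1 p]
  · have h1 := norm_selfErr_sub_le h h' hB i j
    have h2 := abs_softMax_sub_le t t' hβ
    have h3 : |((u * selfErr d z A i j).re - ε) - ((u * selfErr d z A' i j).re - ε)| ≤
        ‖selfErr d z A i j - selfErr d z A' i j‖ := by
      have : ((u * selfErr d z A i j).re - ε) - ((u * selfErr d z A' i j).re - ε) =
          (u * (selfErr d z A i j - selfErr d z A' i j)).re := by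
        rw [mul_sub, Complex.sub_re]; ring
      rw [this]
      refine (Complex.abs_re_le_norm _).trans ?_
      rw [norm_mul, hu, one_mul]
    have h4 : ∑ p, (softWeight β t p + softWeight β t' p) * |t p - t' p| ≤
        ∑ p, (softWeight β t p + softWeight β t' p) *
          ((1 + ‖z‖) * ‖green d z A p.1 p.2 - green d z A' p.1 p.2‖) :=
      Finset.sum_le_sum fun p _ => mul_le_mul_of_nonneg_left (hd p) (add_nonneg (n1 p) (n2 p))
    have h5 : |γ - softMax β t - (γ - softMax β t')| = |softMax β t - softMax β t'| := by
      rw [abs_sub_comm]; congr 1; ring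
    simp only [add_mul _ _ ((1 + ‖z‖) * _), Finset.sum_add_distrib] at h1 h4 ⊢
    refine (abs_min_sub_min_le_max _ _ _ _).trans (max_le ?_ ?_)
    · refine h3.trans (h1.trans ?_)
      have : ∀ s : Fin N × Fin N → ℝ, (∀ p, 0 ≤ s p) → 0 ≤ ∑ p, s p *
          ((1 + ‖z‖) * ‖green d z A p.1 p.2 - green d z A' p.1 p.2‖) := fun s hs =>
        Finset.sum_nonneg fun p _ => mul_nonneg (hs p) (by positivity)
      linarith [this _ n1, this _ n2]
    · rw [h5]
      refine h2.trans (h4.trans ?_)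
      have : ∀ s : Fin N × Fin N → ℝ, (∀ p, 0 ≤ s p) → 0 ≤ ∑ p, s p *
          ((1 + ‖z‖) * ‖green d z A p.1 p.2 - green d z A' p.1 p.2‖) := fun s hs =>
        Finset.sum_nonneg fun p _ => mul_nonneg (hs p) (by positivity)
      have a1 := this (fun p => B * (if p = (i, j) then 1 else 0)) fun p => by positivity
      have a2 := this (fun p => B / N * (if p.1 = p.2 then 1 else 0)) fun p => by positivity
      linarith

end potential

/-- The weighted second moment of the resolvent entries in row `x`. -/
noncomputable def legEnergy {N : ℕ} (d : ℕ) (z : ℂ) (β B : ℝ) (i j : Fin N)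
    (A : Fin N → Fin N → Bool) (x : Fin N) : ℝ :=
  ∑ p, gradWeight d z β B i j A p * (2 * ‖green d z A x j‖ ^ 2 + ‖green d z A x p.1‖ ^ 2 +
    ‖green d z A x p.2‖ ^ 2)

/-- The number of graphs on which a function is at least `v`. -/
noncomputable def levelCount {N : ℕ} (d : ℕ) (Φ : (Fin N → Fin N → Bool) → ℝ) (v : ℝ) : ℝ :=
  ∑ A ∈ regGraphs N d, if v ≤ Φ A then 1 else 0

section level
variable {N d : ℕ} {A : Fin N → Fin N → Bool} {i j k x y : Fin N} {z u : ℂ} {B β γ ε c : ℝ}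

lemma legEnergy_nonneg (hB : 0 ≤ B) : 0 ≤ legEnergy d z β B i j A x :=
  Finset.sum_nonneg fun p _ => mul_nonneg (gradWeight_nonneg hB p) (by positivity)

lemma green_sum_sq_col_le (hA : IsRegGraph N d A) (hz : 0 < z.im) {b : Fin N}
    (hB : ‖green d z A b b‖ ≤ B) : ∑ a, ‖green d z A a b‖ ^ 2 ≤ B / z.im := by
  simp only [green_symm hA hz _ b]
  exact green_sum_sq_le hA hz hB

lemma sum_legEnergy_le (hA : IsRegGraph N d A) (hz : 0 < z.im) (hB : 0 ≤ B)
    (h : GreenBound B d z A) :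
    ∑ x, legEnergy d z β B i j A x ≤ (9 + 2 * B) * (4 * (B / z.im)) := by
  unfold legEnergy
  rw [Finset.sum_comm, ← sum_gradWeight d z β B i j A, Finset.sum_mul]
  refine Finset.sum_le_sum fun p _ => ?_
  rw [← Finset.mul_sum]
  refine mul_le_mul_of_nonneg_left ?_ (gradWeight_nonneg hB p)
  simp only [Finset.sum_add_distrib, ← Finset.mul_sum]
  linarith [green_sum_sq_col_le hA hz (h.norm_le j j),
    green_sum_sq_col_le hA hz (h.norm_le p.1 p.1), green_sum_sq_col_le hA hz (h.norm_le p.2 p.2)]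

lemma norm_mul_potential_sub_le (hA : IsRegGraph N d A) (hz : 0 < z.im)
    (hs : IsSwitch A i k x y) (h : GreenBound B d z A)
    (h' : GreenBound B d z (switchGraph A i k x y)) (hB : 1 ≤ B) (hβ : 0 < β) (hu : ‖u‖ = 1)
    (hc : ∀ a b, (1 + ‖z‖) * ‖green d z A a b - green d z (switchGraph A i k x y) a b‖ ≤ c)
    (hβc : β * c ≤ 1) :
    ‖green d z A k j - green d z (switchGraph A i k x y) x j‖ *
      |potential d z u β γ ε i j A - potential d z u β γ ε i j (switchGraph A i k x y)| ≤
    32 * B * (Real.sqrt d)⁻¹ * (legEnergy d z β B i j A x + legEnergy d z β B i j A y +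
      legEnergy d z β B i j (switchGraph A i k x y) k + 4 * ((9 + 2 * B) * c ^ 2)) := by
  have hw := one_le_weight z
  have hc' : ∀ a b, ‖green d z A a b - green d z (switchGraph A i k x y) a b‖ ≤ c := fun a b =>
    (le_mul_of_one_le_left (norm_nonneg _) hw).trans (hc a b)
  have hc0 : 0 ≤ c := (norm_nonneg _).trans (hc' i i)
  obtain ⟨r, r0, r1, r2, r3⟩ := exists_potential_sub_le (γ := γ) (ε := ε) h h' hB hβ hu
    (fun a b => (mul_le_mul_of_nonneg_left (hc a b) hβ.le).trans hβc) i j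
  have l0 := fun a => legSize_nonneg (d := d) (z := z) (A := A) (i := i) (k := k) (x := x) (y := y)
    hc0 a
  have l2 := fun a => legSize_sq_le (d := d) (z := z) (A := A) (i := i) (k := k) (x := x) (y := y)
    c a
  have lm := norm_green_sub_le_legSize hA hz hs hc' h h'
  have hF := norm_drift_term_le hc' j
  set l := legSize d z A i k x y c with hl
  set G := green d z A
  set G' := green d z (switchGraph A i k x y)
  set σ := (Real.sqrt d)⁻¹
  have hσ : 0 ≤ σ := by positivity
  have hB0 : 0 ≤ B := by linarith
  have e1 : ∑ p, r p * ((1 + ‖z‖) * ‖G p.1 p.2 - G' p.1 p.2‖) ≤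
      ∑ p, r p * (σ * (8 * B * (l p.1 + l p.2))) :=
    Finset.sum_le_sum fun p _ => mul_le_mul_of_nonneg_left (lm _ _) (r0 p)
  have e2 : ‖G k j - G' x j‖ * |potential d z u β γ ε i j A -
      potential d z u β γ ε i j (switchGraph A i k x y)| ≤
      2 * l j * ∑ p, r p * (σ * (8 * B * (l p.1 + l p.2))) :=
    mul_le_mul hF (r3.trans e1) (abs_nonneg _) (by linarith [l0 j])
  refine e2.trans ?_
  rw [Finset.mul_sum]
  have e3 : ∀ p, 2 * l j * (r p * (σ * (8 * B * (l p.1 + l p.2)))) ≤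
      32 * B * σ * (gradWeight d z β B i j A p *
        (2 * ‖G x j‖ ^ 2 + ‖G x p.1‖ ^ 2 + ‖G x p.2‖ ^ 2) +
       gradWeight d z β B i j A p *
        (2 * ‖G y j‖ ^ 2 + ‖G y p.1‖ ^ 2 + ‖G y p.2‖ ^ 2) +
       gradWeight d z β B i j (switchGraph A i k x y) p *
        (2 * ‖G' k j‖ ^ 2 + ‖G' k p.1‖ ^ 2 + ‖G' k p.2‖ ^ 2) +
       gradWeight d z β B i j A p * (4 * c ^ 2)) := by
    intro p
    have q1 : 2 * l j * (l p.1 + l p.2) ≤ 2 * l j ^ 2 + l p.1 ^ 2 + l p.2 ^ 2 := by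
      nlinarith [sq_nonneg (l j - l p.1), sq_nonneg (l j - l p.2)]
    have q2 : 2 * l j * (l p.1 + l p.2) ≤
        4 * ((2 * ‖G x j‖ ^ 2 + ‖G x p.1‖ ^ 2 + ‖G x p.2‖ ^ 2) +
        (2 * ‖G y j‖ ^ 2 + ‖G y p.1‖ ^ 2 + ‖G y p.2‖ ^ 2) +
        (2 * ‖G' k j‖ ^ 2 + ‖G' k p.1‖ ^ 2 + ‖G' k p.2‖ ^ 2) + 4 * c ^ 2) := by
      linarith [l2 j, l2 p.1, l2 p.2]
    have q3 := mul_le_mul_of_nonneg_left q2 (r0 p)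
    have m1 := mul_le_mul_of_nonneg_right (r1 p)
      (by positivity : 0 ≤ 2 * ‖G x j‖ ^ 2 + ‖G x p.1‖ ^ 2 + ‖G x p.2‖ ^ 2)
    have m2 := mul_le_mul_of_nonneg_right (r1 p)
      (by positivity : 0 ≤ 2 * ‖G y j‖ ^ 2 + ‖G y p.1‖ ^ 2 + ‖G y p.2‖ ^ 2)
    have m3 := mul_le_mul_of_nonneg_right (r2 p)
      (by positivity : 0 ≤ 2 * ‖G' k j‖ ^ 2 + ‖G' k p.1‖ ^ 2 + ‖G' k p.2‖ ^ 2)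
    have m4 := mul_le_mul_of_nonneg_right (r1 p) (by positivity : 0 ≤ 4 * c ^ 2)
    have q4 : r p * (2 * l j * (l p.1 + l p.2)) ≤ 4 * (gradWeight d z β B i j A p *
        (2 * ‖G x j‖ ^ 2 + ‖G x p.1‖ ^ 2 + ‖G x p.2‖ ^ 2) +
       gradWeight d z β B i j A p *
        (2 * ‖G y j‖ ^ 2 + ‖G y p.1‖ ^ 2 + ‖G y p.2‖ ^ 2) +
       gradWeight d z β B i j (switchGraph A i k x y) p *
        (2 * ‖G' k j‖ ^ 2 + ‖G' k p.1‖ ^ 2 + ‖G' k p.2‖ ^ 2) +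
       gradWeight d z β B i j A p * (4 * c ^ 2)) := by linarith
    have q5 := mul_le_mul_of_nonneg_left q4 (by positivity : 0 ≤ 8 * B * σ)
    linarith
  refine (Finset.sum_le_sum fun p _ => e3 p).trans (le_of_eq ?_)
  rw [← Finset.mul_sum, Finset.sum_add_distrib, Finset.sum_add_distrib, Finset.sum_add_distrib,
    ← Finset.sum_mul, sum_gradWeight]
  simp only [legEnergy]
  ring

/-- The quadratic variation of the potential is controlled on superlevel sets. -/
lemma sum_switchSum_level_le (hz : 0 < z.im) (hB : 1 ≤ B) (hβ : 0 < β) (hu : ‖u‖ = 1)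
    (hβc : β * c ≤ 1) {v : ℝ}
    (hbd : ∀ A ∈ regGraphs N d, v ≤ potential d z u β γ ε i j A → GreenBound B d z A)
    (hcd : ∀ A ∈ regGraphs N d, v ≤ potential d z u β γ ε i j A → ∀ k x y, IsSwitch A i k x y →
      ∀ a b, (1 + ‖z‖) * ‖green d z A a b - green d z (switchGraph A i k x y) a b‖ ≤ c) :
    ∑ A ∈ regGraphs N d, switchSum A i (fun k x y =>
      if v ≤ potential d z u β γ ε i j A ∧ v ≤ potential d z u β γ ε i j (switchGraph A i k x y)
      then ‖green d z A k j - green d z (switchGraph A i k x y) x j‖ *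
        |potential d z u β γ ε i j A - potential d z u β γ ε i j (switchGraph A i k x y)| else 0) ≤
    32 * B * (Real.sqrt d)⁻¹ * (d ^ 2 * (9 + 2 * B)) * (12 * (B / z.im) + 4 * N * c ^ 2) *
      levelCount d (potential d z u β γ ε i j) v := by
  generalize hΦ : potential d z u β γ ε i j = Φ at *
  have hB0 : 0 ≤ B := by linarith
  obtain ⟨I, hI⟩ : ∃ I : (Fin N → Fin N → Bool) → ℝ, ∀ A, I A = if v ≤ Φ A then 1 else 0 :=
    ⟨_, fun _ => rfl⟩
  have hI0 : ∀ A, 0 ≤ I A := fun A => by simp only [hI]; split_ifs <;> norm_num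
  obtain ⟨E, hE⟩ : ∃ E : (Fin N → Fin N → Bool) → Fin N → ℝ,
    ∀ A x, E A x = I A * legEnergy d z β B i j A x := ⟨_, fun _ _ => rfl⟩
  have hE0 : ∀ A x, 0 ≤ E A x := fun A x => by
    rw [hE]; exact mul_nonneg (hI0 A) (legEnergy_nonneg hB0)
  obtain ⟨σ, hσ', hσ⟩ : ∃ σ : ℝ, σ = (Real.sqrt d)⁻¹ ∧ 0 ≤ σ := ⟨_, rfl, by positivity⟩
  rw [← hσ']
  have h1 : ∀ A ∈ regGraphs N d, switchSum A i (fun k x y =>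
      if v ≤ Φ A ∧ v ≤ Φ (switchGraph A i k x y)
      then ‖green d z A k j - green d z (switchGraph A i k x y) x j‖ *
        |Φ A - Φ (switchGraph A i k x y)| else 0) ≤
      switchSum A i (fun k x y => (32 * B * σ * (E A x + E A y) +
        32 * B * σ * (I A * (4 * ((9 + 2 * B) * c ^ 2)))) +
        32 * B * σ * E (switchGraph A i k x y) k) := by
    intro A hA
    have hA' := mem_regGraphs.1 hA
    refine switchSum_mono fun k x y hs => ?_
    split_ifs with hv
    · have hs' := hs.regular hA'
      have := norm_mul_potential_sub_le (γ := γ) (ε := ε) hA' hz hs (hbd A hA hv.1)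
        (hbd _ (mem_regGraphs.2 hs') hv.2) hB hβ hu (hcd A hA hv.1 k x y hs) hβc (j := j)
      rw [hΦ, ← hσ'] at this
      simp only [hE, hI, hv.1, hv.2, if_true, one_mul]
      refine this.trans (le_of_eq ?_)
      ring
    · have := hE0 A x
      have := hE0 A y
      have := hE0 (switchGraph A i k x y) k
      have := hI0 A
      positivity
  refine (Finset.sum_le_sum h1).trans ?_
  simp only [switchSum_add, Finset.sum_add_distrib]
  rw [← sum_switchSum i (fun A k x y => 32 * B * σ * E A x), ← Finset.sum_add_distrib,
    ← Finset.sum_add_distrib, levelCount, Finset.mul_sum]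
  refine Finset.sum_le_sum fun A hA => ?_
  have hA' := mem_regGraphs.1 hA
  have s1 : ∑ x, E A x ≤ I A * ((9 + 2 * B) * (4 * (B / z.im))) := by
    simp only [hE, ← Finset.mul_sum]
    by_cases hv : v ≤ Φ A
    · exact mul_le_mul_of_nonneg_left (sum_legEnergy_le hA' hz hB0 (hbd A hA hv)) (hI0 A)
    · simp [hI, hv]
  have t1 : switchSum A i (fun k x y => 32 * B * σ * (E A x + E A y)) ≤
      32 * B * σ * (2 * (d ^ 2 * ∑ x, E A x)) := by
    refine (switchSum_le_pairSum fun k x y => ?_).trans (le_of_eq ?_)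
    · have := hE0 A x
      have := hE0 A y
      positivity
    · simp only [mul_add]
      rw [pairSum_add, pairSum_second hA', pairSum_third hA', ← Finset.mul_sum, nsmul_eq_mul]
      push_cast; ring
  have t2 : switchSum A i (fun k x y => 32 * B * σ * E A x) ≤
      32 * B * σ * (d ^ 2 * ∑ x, E A x) := by
    refine (switchSum_le_pairSum fun k x y => ?_).trans (le_of_eq ?_)
    · have := hE0 A x
      positivity
    · rw [pairSum_second hA', ← Finset.mul_sum, nsmul_eq_mul]
      push_cast; ring
  have t3 : switchSum A i (fun k x y => 32 * B * σ * (I A * (4 * ((9 + 2 * B) * c ^ 2)))) ≤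
      N * d ^ 2 * (32 * B * σ * (I A * (4 * ((9 + 2 * B) * c ^ 2)))) := by
    refine switchSum_const_le hA' ?_
    have := hI0 A
    positivity
  have t4 : 32 * B * σ * (3 * (d ^ 2 * ∑ x, E A x)) ≤
      32 * B * σ * (3 * (d ^ 2 * (I A * ((9 + 2 * B) * (4 * (B / z.im)))))) := by
    gcongr
  rw [← hI]
  linarith

end level

/-- The piecewise linear cutoff from `0` at `τ` to `1` at `τ + δ`. -/
noncomputable def ramp (τ δ s : ℝ) : ℝ := max 0 (min 1 ((s - τ) / δ))

section ramp
variable {τ δ : ℝ}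

lemma ramp_nonneg (s : ℝ) : 0 ≤ ramp τ δ s := le_max_left _ _

lemma ramp_of_le (hδ : 0 < δ) {s : ℝ} (h : s ≤ τ) : ramp τ δ s = 0 :=
  max_eq_left ((min_le_right _ _).trans (div_nonpos_of_nonpos_of_nonneg (by linarith) hδ.le))

lemma ramp_of_ge (hδ : 0 < δ) {s : ℝ} (h : τ + δ ≤ s) : ramp τ δ s = 1 := by
  have : 1 ≤ (s - τ) / δ := by rw [le_div_iff₀ hδ]; linarith
  rw [ramp, min_eq_left this]; norm_num

lemma abs_ramp_sub_le (hδ : 0 < δ) (s t : ℝ) : |ramp τ δ s - ramp τ δ t| ≤ δ⁻¹ * |s - t| := by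
  have h1 : |ramp τ δ s - ramp τ δ t| ≤ |min 1 ((s - τ) / δ) - min 1 ((t - τ) / δ)| := by
    simpa [ramp] using abs_max_sub_max_le_max 0 (min 1 ((s - τ) / δ)) 0 (min 1 ((t - τ) / δ))
  have h2 := abs_min_sub_min_le_max 1 ((s - τ) / δ) 1 ((t - τ) / δ)
  have h3 : (s - τ) / δ - (t - τ) / δ = δ⁻¹ * (s - t) := by field_simp; ring
  rw [h3, sub_self, abs_zero, max_eq_right (abs_nonneg _), abs_mul,
    abs_of_pos (inv_pos.2 hδ)] at h2
  exact h1.trans h2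

end ramp

section level
variable {N d : ℕ} {i j : Fin N} {z u : ℂ} {B β γ ε c τ δ : ℝ}

/-- Symmetrization of a sum over switchings of an antisymmetric function. -/
lemma sum_ramp_switchSum_le (Φ : (Fin N → Fin N → Bool) → ℝ)
    (g : (Fin N → Fin N → Bool) → Fin N → Fin N → Fin N → ℝ) (hδ : 0 < δ)
    (hg : ∀ A ∈ regGraphs N d, ∀ k x y, IsSwitch A i k x y →
      g (switchGraph A i k x y) x k y = - g A k x y)
    (hΦ : ∀ A ∈ regGraphs N d, τ ≤ Φ A → ∀ k x y, IsSwitch A i k x y →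
      |Φ A - Φ (switchGraph A i k x y)| ≤ δ) :
    2 * ∑ A ∈ regGraphs N d, ramp τ δ (Φ A) * switchSum A i (g A) ≤
      δ⁻¹ * ∑ A ∈ regGraphs N d, switchSum A i (fun k x y =>
        if τ - δ ≤ Φ A ∧ τ - δ ≤ Φ (switchGraph A i k x y)
        then |g A k x y| * |Φ A - Φ (switchGraph A i k x y)| else 0) := by
  have e1 : ∀ (A : Fin N → Fin N → Bool) (r : ℝ) (f : Fin N → Fin N → Fin N → ℝ),
      r * switchSum A i f = switchSum A i fun k x y => r * f k x y := fun A r f => by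
    simp only [switchSum, Finset.mul_sum, mul_ite, mul_zero]
  have e2 := sum_switchSum (N := N) (d := d) i fun A k x y => ramp τ δ (Φ A) * g A k x y
  simp only [e1, Finset.mul_sum] at e2 ⊢
  have e3 : ∑ A ∈ regGraphs N d, switchSum A i (fun k x y => 2 * (ramp τ δ (Φ A) * g A k x y)) =
      ∑ A ∈ regGraphs N d, switchSum A i (fun k x y => ramp τ δ (Φ A) * g A k x y +
        ramp τ δ (Φ (switchGraph A i k x y)) * g (switchGraph A i k x y) x k y) := by
    simp only [switchSum_add, Finset.sum_add_distrib, ← e2, ← e1]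
    simp only [← Finset.mul_sum]
    ring
  rw [e3]
  refine Finset.sum_le_sum fun A hA => switchSum_mono fun k x y hs => ?_
  have hA' := mem_regGraphs.1 hA
  rw [hg A hA k x y hs]
  have hr := hΦ _ (mem_regGraphs.2 (hs.regular hA')) 
  have hr' := hΦ A hA
  have e4 : ramp τ δ (Φ A) * g A k x y + ramp τ δ (Φ (switchGraph A i k x y)) * -g A k x y =
      (ramp τ δ (Φ A) - ramp τ δ (Φ (switchGraph A i k x y))) * g A k x y := by ring
  rw [e4]
  split_ifs with hv
  · refine (le_abs_self _).trans ?_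
    rw [abs_mul]
    have := mul_le_mul_of_nonneg_right
      (abs_ramp_sub_le (τ := τ) hδ (Φ A) (Φ (switchGraph A i k x y))) (abs_nonneg (g A k x y))
    linarith
  · have h1 : Φ A ≤ τ := by
      by_contra! h
      have := abs_le.1 (hr' h.le k x y hs)
      exact hv ⟨by linarith, by linarith⟩
    have h2 : Φ (switchGraph A i k x y) ≤ τ := by
      by_contra! h
      have := hr h.le x k y (hs.reverse hA')
      rw [switchGraph_comm] at this
      have := abs_le.1 this
      exact hv ⟨by linarith, by linarith⟩
    rw [ramp_of_le hδ h1, ramp_of_le hδ h2]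
    simp

/-- One step of the recursion for the sizes of the superlevel sets of the potential. -/
lemma levelCount_step (hd : 0 < d) (hz : 0 < z.im) (hB : 1 ≤ B) (hβ : 0 < β) (hu : ‖u‖ = 1)
    (hβc : β * c ≤ 1) (hδ : 0 < δ) (hcδ : (9 + 2 * B) * c ≤ δ) (hτ : -(ε / 2) ≤ τ)
    (hbd : ∀ A ∈ regGraphs N d, τ - δ ≤ potential d z u β γ ε i j A → GreenBound B d z A)
    (hbd' : ∀ A ∈ regGraphs N d, τ - δ ≤ potential d z u β γ ε i j A →
      ∀ k x y, IsSwitch A i k x y → GreenBound B d z (switchGraph A i k x y))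
    (hcd : ∀ A ∈ regGraphs N d, τ - δ ≤ potential d z u β γ ε i j A →
      ∀ k x y, IsSwitch A i k x y →
      ∀ a b, (1 + ‖z‖) * ‖green d z A a b - green d z (switchGraph A i k x y) a b‖ ≤ c)
    (hdrift : ∀ A ∈ regGraphs N d, τ ≤ potential d z u β γ ε i j A →
      ‖switchSum A i (fun k x y => green d z A k j - green d z (switchGraph A i k x y) x j)
        - N * d * Real.sqrt d * selfErr d z A i j‖ ≤ N * d * Real.sqrt d * (ε / 4)) :
    ε / 2 * levelCount d (potential d z u β γ ε i j) (τ + δ) ≤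
      δ⁻¹ * (32 * B * (9 + 2 * B) * (12 * (B / (N * z.im)) + 4 * c ^ 2)) *
        levelCount d (potential d z u β γ ε i j) (τ - δ) := by
  have hN : (0 : ℝ) < N := by exact_mod_cast i.pos
  have hs : 0 < Real.sqrt d := Real.sqrt_pos.2 (by exact_mod_cast hd)
  have hdr : (0 : ℝ) < d := by exact_mod_cast hd
  obtain ⟨F, hF⟩ : ∃ F : (Fin N → Fin N → Bool) → Fin N → Fin N → Fin N → ℂ, ∀ A k x y,
    F A k x y = green d z A k j - green d z (switchGraph A i k x y) x j := ⟨_, fun _ _ _ _ => rfl⟩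
  have hquad := sum_switchSum_level_le (γ := γ) (ε := ε) (j := j) hz hB hβ hu hβc hbd hcd
  have hosc : ∀ A ∈ regGraphs N d, τ ≤ potential d z u β γ ε i j A → ∀ k x y,
      IsSwitch A i k x y → |potential d z u β γ ε i j A -
        potential d z u β γ ε i j (switchGraph A i k x y)| ≤ δ := by
    intro A hA hv k x y hs
    have hv' : τ - δ ≤ potential d z u β γ ε i j A := by linarith
    have hc := hcd A hA hv' k x y hs
    obtain ⟨r, r0, r1, r2, r3⟩ := exists_potential_sub_le (γ := γ) (ε := ε) (hbd A hA hv')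
      (hbd' A hA hv' k x y hs) hB hβ hu
      (fun a b => (mul_le_mul_of_nonneg_left (hc a b) hβ.le).trans hβc) i j
    refine r3.trans (le_trans ?_ hcδ)
    rw [← sum_gradWeight d z β B i j A, Finset.sum_mul]
    exact Finset.sum_le_sum fun p _ => mul_le_mul (r1 p) (hc _ _)
      (mul_nonneg (by positivity) (norm_nonneg _)) (gradWeight_nonneg (by linarith) p)
  generalize hΦ : potential d z u β γ ε i j = Φ at *
  have hanti : ∀ A ∈ regGraphs N d, ∀ k x y, IsSwitch A i k x y →
      (u * F (switchGraph A i k x y) x k y).re = - (u * F A k x y).re := by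
    intro A _ k x y _
    rw [hF, hF, switchGraph_comm, ← Complex.neg_re]
    congr 1
    ring
  have key := sum_ramp_switchSum_le Φ (fun A k x y => (u * F A k x y).re) hδ hanti hosc
  have up : ∑ A ∈ regGraphs N d, switchSum A i (fun k x y =>
        if τ - δ ≤ Φ A ∧ τ - δ ≤ Φ (switchGraph A i k x y)
        then |(u * F A k x y).re| * |Φ A - Φ (switchGraph A i k x y)| else 0) ≤ 
      ∑ A ∈ regGraphs N d, switchSum A i (fun k x y =>
        if τ - δ ≤ Φ A ∧ τ - δ ≤ Φ (switchGraph A i k x y)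
        then ‖green d z A k j - green d z (switchGraph A i k x y) x j‖ *
          |Φ A - Φ (switchGraph A i k x y)| else 0) := by
    refine Finset.sum_le_sum fun A _ => switchSum_mono fun k x y _ => ?_
    split_ifs
    · rw [← hF]
      refine mul_le_mul_of_nonneg_right ((Complex.abs_re_le_norm _).trans ?_) (abs_nonneg _)
      rw [norm_mul, hu, one_mul]
    · exact le_rfl
  have low : N * d * Real.sqrt d * (ε / 4) * levelCount d Φ (τ + δ) ≤
      ∑ A ∈ regGraphs N d, ramp τ δ (Φ A) * switchSum A i (fun k x y => (u * F A k x y).re) := by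
    rw [levelCount, Finset.mul_sum]
    refine Finset.sum_le_sum fun A hA => ?_
    by_cases hv : τ ≤ Φ A
    · have h1 := hdrift A hA hv
      simp only [← hF] at h1
      have h2 : switchSum A i (fun k x y => (u * F A k x y).re) =
          (u * switchSum A i (F A)).re := by
        simp only [switchSum, Finset.mul_sum, mul_ite, mul_zero, Complex.re_sum]
        refine Finset.sum_congr rfl fun k _ => Finset.sum_congr rfl fun x _ =>
          Finset.sum_congr rfl fun y _ => ?_
        split_ifs <;> simp
      have h3 : ε + τ ≤ (u * selfErr d z A i j).re := by
        have : Φ A ≤ (u * selfErr d z A i j).re - ε := by rw [← hΦ]; exact min_le_left _ _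
        linarith
      have h4 : N * d * Real.sqrt d * (u * selfErr d z A i j).re - (u * switchSum A i (F A)).re ≤
          N * d * Real.sqrt d * (ε / 4) := by
        refine le_trans ?_ h1
        rw [← one_mul ‖_‖, ← hu, ← norm_mul, ← norm_neg]
        refine le_trans (le_of_eq ?_) (Complex.re_le_norm _)
        have : -(u * (switchSum A i (F A) - N * d * Real.sqrt d * selfErr d z A i j)) =
            ((N * d * Real.sqrt d : ℝ) : ℂ) * (u * selfErr d z A i j) -
              u * switchSum A i (F A) := by push_cast; ring
        erw [this]
        rw [Complex.sub_re, Complex.re_ofReal_mul]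
      have h5 : N * d * Real.sqrt d * (ε / 2) ≤ N * d * Real.sqrt d * (u * selfErr d z A i j).re :=
        mul_le_mul_of_nonneg_left (by linarith) (by positivity)
      have hε : 0 ≤ ε := by
        have := (norm_nonneg _).trans h1
        have := nonneg_of_mul_nonneg_right this (by positivity)
        linarith
      have h6 : N * d * Real.sqrt d * (ε / 4) ≤ (u * switchSum A i (F A)).re := by linarith
      rw [h2]
      have h7 : (if τ + δ ≤ Φ A then (1 : ℝ) else 0) ≤ ramp τ δ (Φ A) := by
        split_ifs with h
        · rw [ramp_of_ge hδ h]
        · exact ramp_nonneg _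
      have h8 := mul_le_mul_of_nonneg_left h6 (ramp_nonneg (τ := τ) (δ := δ) (Φ A))
      have h9 := mul_le_mul_of_nonneg_left h7
        (by positivity : 0 ≤ N * d * Real.sqrt d * (ε / 4))
      linarith
    · push Not at hv
      rw [if_neg (by linarith), ramp_of_le hδ hv.le]
      simp
  have hδ' : 0 ≤ δ⁻¹ := by positivity
  have fin := (mul_le_mul_of_nonneg_left low (by norm_num : (0 : ℝ) ≤ 2)).trans
    (key.trans (mul_le_mul_of_nonneg_left (up.trans hquad) hδ'))
  refine le_of_mul_le_mul_left ?_ (by positivity : 0 < N * d * Real.sqrt d)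
  refine le_trans (le_of_eq ?_) (fin.trans (le_of_eq ?_))
  · ring
  · have hsq : (d : ℝ) = Real.sqrt d * Real.sqrt d := (Real.mul_self_sqrt hdr.le).symm
    field_simp
    rw [Real.sq_sqrt hdr.le]

end level

section drift
variable {N d : ℕ} {A : Fin N → Fin N → Bool} {i j : Fin N} {z u : ℂ} {ξ : ℝ}

lemma GreenBound.sum_norm_le (hA : IsRegGraph N d A) (hz : 0 < z.im) (hξ : 0 < ξ)
    (hη : ξ ^ 2 ≤ N * z.im) (h : GreenBound 82 d z A) (j : Fin N) :
    ∑ x, ‖green d z A x j‖ ≤ 10 * N / ξ := by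
  have hN : (0 : ℝ) < N := by exact_mod_cast j.pos
  have h1 := green_sum_sq_col_le hA hz (h.norm_le j j)
  have h2 := sq_sum_le_card_mul_sum_sq (s := univ) (f := fun x => ‖green d z A x j‖)
  rw [Finset.card_univ, Fintype.card_fin] at h2
  refine abs_le_of_sq_le_sq' (a := ∑ x, ‖green d z A x j‖) ?_ (by positivity) |>.2
  refine h2.trans ((mul_le_mul_of_nonneg_left h1 hN.le).trans ?_)
  rw [div_pow, ← mul_div_assoc, div_le_div_iff₀ hz (by positivity)]
  nlinarith [mul_le_mul_of_nonneg_left hη hN.le]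

/-- The drift of the resolvent along random switchings is close to the error in the
self-consistent equation. -/
lemma drift_le (hA : IsRegGraph N d A) (hz : 0 < z.im) (hξ : 10 ^ 30 ≤ ξ)
    (hη : ξ ^ 2 ≤ N * z.im) (hd : 10 ^ 15 * ξ ≤ Real.sqrt d)
    (hNd : 10 ^ 15 * ξ * Real.sqrt d ^ 3 ≤ N) (h : GreenBound 82 d z A) :
    ‖switchSum A i (fun k x y => green d z A k j - green d z (switchGraph A i k x y) x j)
        - N * d * Real.sqrt d * selfErr d z A i j‖ ≤ N * d * Real.sqrt d * ((1 / 20) / 4) := by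
  have hw := one_le_weight z
  have hp : 0 < Real.sqrt d := by linarith
  have hd0 : 0 < d := by
    rcases Nat.eq_zero_or_pos d with h | h
    · simp [h] at hp
    · exact h
  have hS := h.sum_norm_le hA hz (by linarith) hη j
  have hB : ∀ a b, ‖green d z A a b‖ ≤ 82 / (1 + ‖z‖) := fun a b => by
    rw [le_div_iff₀ (by linarith), mul_comm]; exact h a b
  have hB' : ∀ k x y, IsSwitch A i k x y → ∀ a b, ‖green d z (switchGraph A i k x y) a b‖ ≤ 83 :=
    fun k x y hs a b => by
      have := (h.switch hA hz hs (by norm_num) (by linarith)).norm_le a b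
      linarith
  refine (drift hA hd0 hz hB (by norm_num) hB').trans ?_
  obtain ⟨b, hb⟩ : ∃ b, b = 82 / (1 + ‖z‖) := ⟨_, rfl⟩
  have hb0 : 0 ≤ b := by rw [hb]; positivity
  have hb1 : b ≤ 82 := by
    rw [hb]; exact div_le_self (by norm_num) hw
  have hzb : ‖z‖ * b ≤ 82 := by
    rw [hb, mul_div_assoc', div_le_iff₀ (by linarith)]; nlinarith [norm_nonneg z]
  rw [← hb]
  have hS0 : 0 ≤ ∑ x, ‖green d z A x j‖ := Finset.sum_nonneg fun _ _ => norm_nonneg _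
  generalize ∑ x, ‖green d z A x j‖ = S at *
  have hdp : (d : ℝ) = Real.sqrt d ^ 2 := (Real.sq_sqrt (Nat.cast_nonneg d)).symm
  generalize Real.sqrt d = p at *
  have hN : (0 : ℝ) < N := by exact_mod_cast i.pos
  have hp1 : 10 ^ 45 ≤ p := by linarith
  have hS' : S ≤ N / 10 ^ 29 := by
    refine hS.trans ?_
    rw [div_le_div_iff₀ (by linarith) (by norm_num)]
    nlinarith
  have hNd' : 10 ^ 45 * p ^ 3 ≤ N := by
    refine le_trans (mul_le_mul_of_nonneg_right ?_ (by positivity)) hNd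
    linarith
  rw [hdp]
  have t1 : p⁻¹ * (4 * (p ^ 2) ^ 2 * b * S) ≤ N * p ^ 3 / 1000 := by
    have : p⁻¹ * (4 * (p ^ 2) ^ 2 * b * S) = 4 * p ^ 3 * (b * S) := by field_simp
    rw [this]
    have : b * S ≤ 82 * (N / 10 ^ 29) := mul_le_mul hb1 hS' hS0 (by norm_num)
    nlinarith [mul_le_mul_of_nonneg_left this (by positivity : 0 ≤ 4 * p ^ 3),
      (by positivity : 0 ≤ N * p ^ 3)]
  have t2 : p⁻¹ * (p ^ 2 * b * (N * (p * (1 + ‖z‖ * b)))) ≤ N * p ^ 3 / 1000 := by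
    have : p⁻¹ * (p ^ 2 * b * (N * (p * (1 + ‖z‖ * b)))) = N * p ^ 2 * (b * (1 + ‖z‖ * b)) := by
      field_simp
    rw [this]
    have h1 : b * (1 + ‖z‖ * b) ≤ 82 * 83 :=
      mul_le_mul hb1 (by linarith) (by positivity) (by norm_num)
    have h2 : 82 * 83 ≤ p / 1000 := by linarith
    have := mul_le_mul_of_nonneg_left (h1.trans h2) (by positivity : 0 ≤ N * p ^ 2)
    linarith
  have hb2 : b * b ≤ 82 * 82 := mul_le_mul hb1 hb1 hb0 (by norm_num)
  have hpi : p⁻¹ ≤ 1 := inv_le_one_of_one_le₀ (by linarith)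
  have hpi0 : 0 ≤ p⁻¹ := by positivity
  have t3 : 4 * (p ^ 2) ^ 3 * (2 * b + p⁻¹ * (8 * (b * b))) ≤ N * p ^ 3 / 1000 := by
    have h1 : 2 * b + p⁻¹ * (8 * (b * b)) ≤ 10 ^ 6 := by
      have := mul_le_mul hpi hb2 (by positivity) (by norm_num)
      linarith
    have h2 := mul_le_mul_of_nonneg_left h1 (by positivity : 0 ≤ 4 * (p ^ 2) ^ 3)
    have h3 := mul_le_mul_of_nonneg_right hNd' (by positivity : 0 ≤ p ^ 3)
    nlinarith [(by positivity : 0 ≤ N * p ^ 3), (by positivity : 0 ≤ p ^ 6)]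
  have t4 : N * p ^ 2 * p ^ 2 * (p⁻¹ * (p⁻¹ * (64 * (b * b * 83)))) ≤ N * p ^ 3 / 1000 := by
    have : N * p ^ 2 * p ^ 2 * (p⁻¹ * (p⁻¹ * (64 * (b * b * 83)))) =
      N * p ^ 2 * (64 * (b * b * 83)) := by field_simp
    rw [this]
    have h2 : 64 * (b * b * 83) ≤ p / 1000 := by linarith
    have := mul_le_mul_of_nonneg_left h2 (by positivity : 0 ≤ N * p ^ 2)
    linarith
  rw [mul_add]
  have : N * (p ^ 2) ^ 2 * (p⁻¹ * (p⁻¹ * (64 * (b * b * 83)))) =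
    N * p ^ 2 * p ^ 2 * (p⁻¹ * (p⁻¹ * (64 * (b * b * 83)))) := by ring
  rw [this]
  have : 0 ≤ N * p ^ 3 := by positivity
  have e : N * p ^ 2 * p = N * p ^ 3 := by ring
  rw [e]
  linarith

end drift

section iterate
variable {N d : ℕ} {i j : Fin N} {z u : ℂ} {ξ : ℝ}

lemma levelCount_le_card (Φ : (Fin N → Fin N → Bool) → ℝ) (v : ℝ) :
    levelCount d Φ v ≤ (regGraphs N d).card := by
  rw [levelCount, Finset.cast_card]
  refine Finset.sum_le_sum fun A _ => ?_
  split_ifs <;> simp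

lemma levelCount_antitone (Φ : (Fin N → Fin N → Bool) → ℝ) {v w : ℝ} (h : v ≤ w) :
    levelCount d Φ w ≤ levelCount d Φ v := by
  refine Finset.sum_le_sum fun A _ => ?_
  split_ifs
  · exact le_rfl
  · linarith
  · norm_num
  · exact le_rfl

lemma GreenBound.of_potential {A : Fin N → Fin N → Bool} {β ε v : ℝ} (hβ : 0 < β)
    (hv : -1 ≤ v) (h : v ≤ potential d z u β 81 ε i j A) : GreenBound 82 d z A := by
  have : Nonempty (Fin N × Fin N) := ⟨(i, j)⟩
  intro a b
  have h1 := le_softMax (greenSize d z A) hβ (a, b)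
  have h2 : v ≤ 81 - softMax β (greenSize d z A) := h.trans (min_le_right _ _)
  have h3 : greenSize d z A (a, b) = (1 + ‖z‖) * ‖green d z A a b‖ := rfl
  linarith

/-- The number of graphs for which the resolvent is bounded, but the self-consistent equation
fails. -/
lemma levelCount_potential_le (hz : 0 < z.im) (hu : ‖u‖ = 1) (hξ : 10 ^ 30 ≤ ξ)
    (hNξ : Real.log N ≤ ξ) (hη : ξ ^ 2 ≤ N * z.im) (hd : 10 ^ 15 * ξ ≤ Real.sqrt d)
    (hNd : 10 ^ 15 * ξ * Real.sqrt d ^ 3 ≤ N) :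
    levelCount d (potential d z u (2 * Real.log N + 1) 81 (1 / 20) i j) 0 ≤
      Real.exp (-(10 * ξ * Real.log ξ)) * (regGraphs N d).card := by
  have hN1 : (1 : ℝ) ≤ N := by exact_mod_cast i.pos
  have hL : 0 ≤ Real.log N := Real.log_nonneg hN1
  have hp : 0 < Real.sqrt d := by linarith
  have hd0 : 0 < d := by
    rcases Nat.eq_zero_or_pos d with h | h
    · simp [h] at hp
    · exact h
  have hξ0 : 0 < ξ := by linarith
  set β := 2 * Real.log N + 1 with hβ
  have hβ0 : 0 < β := by linarith
  set Φ := potential d z u β 81 (1 / 20) i j with hΦ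
  have hc1 : 16 * 82 ^ 2 / Real.sqrt d ≤ 1 / (10 ^ 9 * ξ) := by
    rw [div_le_div_iff₀ hp (by positivity)]; linarith
  have hc0 : 0 ≤ 16 * 82 ^ 2 / Real.sqrt d := by positivity
  obtain ⟨c, hc⟩ : ∃ c, c = 16 * 82 ^ 2 / Real.sqrt d := ⟨_, rfl⟩
  obtain ⟨δ, hδ⟩ : ∃ δ, δ = 1 / (1680 * ξ) := ⟨_, rfl⟩
  have hδ0 : 0 < δ := by rw [hδ]; positivity
  have hcξ : c * ξ ≤ 1 / 10 ^ 9 := by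
    rw [← hc] at hc1
    have := mul_le_mul_of_nonneg_right hc1 hξ0.le
    refine this.trans (le_of_eq ?_)
    field_simp
  have hδξ : δ * ξ = 1 / 1680 := by rw [hδ]; field_simp
  rw [← hc] at hc0
  have hs := Real.sqrt_pos.2 hξ0
  have hs15 : 10 ^ 15 ≤ Real.sqrt ξ := Real.le_sqrt_of_sq_le (by linarith)
  have hss : Real.sqrt ξ * Real.sqrt ξ = ξ := Real.mul_self_sqrt hξ0.le
  have step : ∀ v, -(1 / 40) ≤ v → levelCount d Φ (v + 2 * δ) ≤
      (Real.sqrt ξ)⁻¹ * levelCount d Φ v := by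
    intro v hv
    have hbd : ∀ A ∈ regGraphs N d, v + δ - δ ≤ Φ A → GreenBound 82 d z A := fun A _ h =>
      GreenBound.of_potential hβ0 (by linarith : -1 ≤ v)
        (by rw [add_sub_cancel_right] at h; exact h)
    have := levelCount_step (N := N) (d := d) (i := i) (j := j) (z := z) (u := u) (B := 83)
      (β := β) (γ := 81) (ε := 1 / 20) (c := c) (τ := v + δ) (δ := δ) hd0 hz (by norm_num) hβ0 hu
      (by nlinarith) hδ0 (by
        rw [← mul_le_mul_iff_left₀ hξ0, hδξ, mul_assoc]
        linarith) (by linarith)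
      (fun A hA h => (hbd A hA h).mono (by norm_num))
      (fun A hA h k x y hs => ((hbd A hA h).switch (mem_regGraphs.1 hA) hz hs (by norm_num)
        (by linarith)).mono (by norm_num))
      (fun A hA h k x y hs a b => by
        rw [hc]
        exact (hbd A hA h).switch_sub_le (mem_regGraphs.1 hA) hz hs (by norm_num)
          (by linarith) a b)
      (fun A hA h => drift_le (mem_regGraphs.1 hA) hz hξ hη hd hNd
        (hbd A hA (by linarith)))
    rw [← hΦ, add_sub_cancel_right, add_assoc, ← two_mul] at this
    have l0 : 0 ≤ levelCount d Φ v := Finset.sum_nonneg fun A _ => by split_ifs <;> simp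
    have m1 : 83 / (N * z.im) ≤ 83 / ξ ^ 2 :=
      div_le_div_of_nonneg_left (by norm_num) (by positivity) hη
    have m2 : c ^ 2 ≤ 1 / ξ ^ 2 := by
      rw [le_div_iff₀ (by positivity), ← mul_pow]
      have := mul_nonneg hc0 hξ0.le
      nlinarith
    have m3 : δ⁻¹ * (32 * 83 * (9 + 2 * 83) * (12 * (83 / (N * z.im)) + 4 * c ^ 2)) ≤
        (Real.sqrt ξ)⁻¹ * (1 / 20 / 2) := by
      have n1 : 12 * (83 / (N * z.im)) + 4 * c ^ 2 ≤ 1000 / ξ ^ 2 := by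
        have : 1000 / ξ ^ 2 = 12 * (83 / ξ ^ 2) + 4 * (1 / ξ ^ 2) := by ring
        rw [this]; linarith
      have n2 : δ⁻¹ * (32 * 83 * (9 + 2 * 83) * (1000 / ξ ^ 2)) =
          1680 * 32 * 83 * (9 + 2 * 83) * 1000 / ξ := by
        rw [hδ]; field_simp
      calc _ ≤ δ⁻¹ * (32 * 83 * (9 + 2 * 83) * (1000 / ξ ^ 2)) := by gcongr
        _ = 1680 * 32 * 83 * (9 + 2 * 83) * 1000 / ξ := n2
        _ ≤ _ := by
          rw [inv_mul_eq_div, div_le_div_iff₀ hξ0 hs]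
          nlinarith
    have := this.trans (mul_le_mul_of_nonneg_right m3 l0)
    linarith
  have hlow : ∀ m : ℕ, levelCount d Φ (-(1 / 40) + 2 * δ * m) ≤
      ((Real.sqrt ξ)⁻¹) ^ m * (regGraphs N d).card := by
    intro m
    induction m with
    | zero => simpa using levelCount_le_card Φ _
    | succ m ih =>
      have := step (-(1 / 40) + 2 * δ * m) (by
        have : 0 ≤ 2 * δ * m := by positivity
        linarith)
      push_cast
      rw [show -(1 / 40) + 2 * δ * ((m : ℝ) + 1) = -(1 / 40) + 2 * δ * m + 2 * δ by ring]
      refine this.trans ((mul_le_mul_of_nonneg_left ih (by positivity)).trans (le_of_eq ?_))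
      ring
  have hn1 : (⌊21 * ξ⌋₊ : ℝ) ≤ 21 * ξ := Nat.floor_le (by positivity)
  have hn2 : 21 * ξ < ⌊21 * ξ⌋₊ + 1 := Nat.lt_floor_add_one _
  have hlogξ : 0 ≤ Real.log ξ := Real.log_nonneg (by linarith)
  refine (levelCount_antitone Φ ?_).trans ((hlow ⌊21 * ξ⌋₊).trans
    (mul_le_mul_of_nonneg_right ?_ (Nat.cast_nonneg _)))
  · have := mul_le_mul_of_nonneg_left hn1 hδ0.le
    linarith
  · have : (Real.sqrt ξ)⁻¹ = Real.exp (-(Real.log ξ / 2)) := by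
      rw [Real.exp_neg, ← Real.log_sqrt hξ0.le, Real.exp_log hs]
    rw [this, ← Real.exp_nat_mul]
    refine Real.exp_le_exp.2 ?_
    nlinarith

end iterate

/-- The a priori bounds propagated from one scale to the next. -/
def BootstrapBound {N : ℕ} (d : ℕ) (z : ℂ) (A : Fin N → Fin N → Bool) : Prop :=
  GreenBound 40 d z A ∧ (4 ≤ ‖z‖ → GreenBound 2 d z A)

section bootstrap
variable {N d : ℕ} {A : Fin N → Fin N → Bool} {z z' : ℂ}

lemma bootstrapBound_of_le (hA : IsRegGraph N d A) (hz : |z.re| + 1 ≤ z.im) :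
    BootstrapBound d z A := by
  have h0 : 0 < z.im := by linarith [abs_nonneg z.re]
  have h : GreenBound 2 d z A := fun a b => by
    have h1 := green_norm_le hA h0 a b
    have h2 := Complex.norm_le_abs_re_add_abs_im z
    rw [abs_of_pos h0] at h2
    refine (mul_le_mul_of_nonneg_left h1 (by positivity)).trans ?_
    rw [mul_one_div, div_le_iff₀ h0]
    linarith
  exact ⟨h.mono (by norm_num), fun _ => h⟩

lemma GreenBound.halving {B : ℝ} (hA : IsRegGraph N d A) (hz : 0 < z.im) (hz' : 2 * z'.im = z.im)
    (hre : z'.re = z.re) (h : GreenBound B d z A) : GreenBound (2 * B) d z' A := by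
  have hz0 : 0 < z'.im := by linarith
  have hn : ‖z'‖ ≤ ‖z‖ := by
    rw [Complex.norm_def, Complex.norm_def]
    refine Real.sqrt_le_sqrt ?_
    rw [Complex.normSq_apply, Complex.normSq_apply, hre, ← hz']
    nlinarith
  have hw := one_le_weight z
  intro a b
  have h1 := IsRes.halving (B := B / (1 + ‖z‖)) (green_isRes hA hz) (green_isRes hA hz0)
    (hA.smul_conjTranspose _) (hA.smul_transpose _) hz hz' hre
    (fun a b => by rw [le_div_iff₀ (by linarith), mul_comm]; exact h a b) a b
  calc (1 + ‖z'‖) * ‖green d z' A a b‖ ≤ (1 + ‖z‖) * (2 * (B / (1 + ‖z‖))) := by gcongr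
    _ = 2 * B := by field_simp

lemma norm_selfErr_le_of_potential (h : GreenBound 80 d z A) 
    (hp : ∀ u ∈ ({1, -1, Complex.I, -Complex.I} : Finset ℂ), ∀ i j,
      potential d z u (2 * Real.log N + 1) 81 (1 / 20) i j A < 0) (i j : Fin N) :
    ‖selfErr d z A i j‖ ≤ 1 / 10 := by
  have hN1 : (1 : ℝ) ≤ N := by exact_mod_cast i.pos
  have hL : 0 ≤ Real.log N := Real.log_nonneg hN1
  have : Nonempty (Fin N × Fin N) := ⟨(i, j)⟩
  have hβ : 0 < 2 * Real.log N + 1 := by linarith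
  have hs : softMax (2 * Real.log N + 1) (greenSize d z A) ≤ 81 := by
    have hN0 : (N : ℝ) ≠ 0 := by positivity
    have hM : ∀ p, greenSize d z A p ≤ 80 := fun p => h p.1 p.2
    refine (softMax_le _ hβ hM).trans ?_
    rw [Fintype.card_prod, Fintype.card_fin, Nat.cast_mul, Real.log_mul hN0 hN0, inv_mul_eq_div]
    have : (Real.log N + Real.log N) / (2 * Real.log N + 1) ≤ 1 := by
      rw [div_le_one hβ]; linarith
    linarith
  have hu : ∀ u ∈ ({1, -1, Complex.I, -Complex.I} : Finset ℂ),
      (u * selfErr d z A i j).re ≤ 1 / 20 := fun u hu => by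
    by_contra! hc
    have := hp u hu i j
    rw [potential, min_lt_iff] at this
    rcases this with h | h <;> linarith
  have h1 := hu 1 (by simp)
  have h2 := hu (-1) (by simp)
  have h3 := hu Complex.I (by simp)
  have h4 := hu (-Complex.I) (by simp)
  simp only [one_mul, neg_mul, Complex.neg_re, Complex.I_mul_re, neg_neg] at h1 h2 h3 h4
  refine (Complex.norm_le_abs_re_add_abs_im _).trans ?_
  have := abs_le.2 ⟨by linarith, h1⟩
  have := abs_le.2 ⟨by linarith, h4⟩
  linarith

lemma bootstrapBound_of_potential (hN : 10 ≤ N) (h : GreenBound 80 d z A)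
    (h4 : 4 ≤ ‖z‖ → GreenBound 4 d z A)
    (hp : ∀ u ∈ ({1, -1, Complex.I, -Complex.I} : Finset ℂ), ∀ i j,
      potential d z u (2 * Real.log N + 1) 81 (1 / 20) i j A < 0) : BootstrapBound d z A := by
  have hY := norm_selfErr_le_of_potential h hp
  obtain ⟨s, hs⟩ : ∃ s, s = stieltjes d z A := ⟨_, rfl⟩
  have hN0 : (10 : ℝ) ≤ N := by exact_mod_cast hN
  have hNc : (N : ℂ) ≠ 0 := by
    have : N ≠ 0 := by omega
    exact_mod_cast this
  have hNi : ‖(1 / N : ℂ)‖ ≤ 1 / 10 := by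
    rw [norm_div, norm_one, Complex.norm_natCast]
    exact div_le_div_of_nonneg_left (by norm_num) (by norm_num) hN0
  have hss : ‖1 + (z + s) * s‖ ≤ 1 / 5 := by
    have e : (N : ℂ)⁻¹ * ∑ i, selfErr d z A i i = 1 - 1 / N + (z + s) * s := by
      simp only [selfErr, if_true, ← hs, Finset.sum_add_distrib, Finset.sum_const, card_univ,
        Fintype.card_fin, nsmul_eq_mul, ← Finset.mul_sum, mul_add]
      have : ∑ i, green d z A i i = N * s := by rw [hs, stieltjes]; field_simp
      rw [this]; field_simp
    have h1 : ‖(N : ℂ)⁻¹ * ∑ i, selfErr d z A i i‖ ≤ 1 / 10 := by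
      rw [norm_mul, norm_inv, Complex.norm_natCast, inv_mul_le_iff₀ (by linarith)]
      refine (norm_sum_le _ _).trans ((Finset.sum_le_sum fun x _ => hY x x).trans ?_)
      simp
    rw [e] at h1
    have := norm_add_le (1 - 1 / N + (z + s) * s) (1 / N : ℂ)
    rw [show 1 - 1 / N + (z + s) * s + 1 / N = 1 + (z + s) * s by ring] at this
    linarith
  have hG : ∀ a b, ‖z + s‖ * ‖green d z A a b‖ ≤ 11 / 10 := fun a b => by
    have h1 := hY a b
    rw [selfErr, ← hs] at h1
    rw [← norm_mul]
    have h2 : ‖(if a = b then 1 else 0) - (1 / N : ℂ)‖ ≤ 1 := by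
      split_ifs
      · have : (1 : ℂ) - 1 / N = ((1 - 1 / N : ℝ) : ℂ) := by push_cast; rfl
        rw [this, Complex.norm_real, Real.norm_eq_abs, abs_le]
        have h3 : (0 : ℝ) ≤ 1 / N := by positivity
        have h4 : (1 : ℝ) / N ≤ 1 := by rw [div_le_one (by linarith)]; linarith
        exact ⟨by linarith, by linarith⟩
      · rw [zero_sub, norm_neg]; linarith
    have h3 := norm_sub_le ((if a = b then 1 else 0) - (1 / N : ℂ) + (z + s) * green d z A a b)
      ((if a = b then 1 else 0) - (1 / N : ℂ))
    rw [add_sub_cancel_left] at h3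
    linarith
  have hlarge : 4 ≤ ‖z‖ → GreenBound 2 d z A := fun hz a b => by
    have h5 := h4 hz
    have hs1 : ‖s‖ ≤ 4 / 5 := by
      rw [hs, stieltjes, norm_mul, norm_inv, Complex.norm_natCast,
        inv_mul_le_iff₀ (by linarith)]
      refine (norm_sum_le _ _).trans ((Finset.sum_le_sum (g := fun _ => 4 / 5) fun x _ => ?_).trans
        ?_)
      · have := h5 x x
        nlinarith [norm_nonneg (green d z A x x)]
      · simp
    have h6 := norm_sub_le (z + s) s
    rw [add_sub_cancel_right] at h6
    have h7 : 4 / 5 * ‖z‖ ≤ ‖z + s‖ := by linarith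
    have := mul_le_mul_of_nonneg_right h7 (norm_nonneg (green d z A a b))
    nlinarith [hG a b, norm_nonneg (green d z A a b)]
  refine ⟨?_, hlarge⟩
  by_cases hz : 4 ≤ ‖z‖
  · exact (hlarge hz).mono (by norm_num)
  · push Not at hz
    have h1 := norm_sub_le (1 + (z + s) * s) 1
    have h2 := norm_sub_le (1 + (z + s) * s) ((z + s) * s)
    rw [add_sub_cancel_left, norm_mul, norm_one] at h1
    rw [add_sub_cancel_right, norm_mul, norm_one] at h2
    have h3 : ‖s‖ ≤ 5 := by
      by_contra! hc
      have h4 := norm_sub_le (z + s) z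
      rw [add_sub_cancel_left] at h4
      have : 1 ≤ ‖z + s‖ := by linarith
      nlinarith
    have h4 : 4 / 25 ≤ ‖z + s‖ := by nlinarith [norm_nonneg (z + s)]
    intro a b
    have := mul_le_mul_of_nonneg_right h4 (norm_nonneg (green d z A a b))
    have := hG a b
    nlinarith [norm_nonneg (green d z A a b)]

lemma BootstrapBound.step (hN : 10 ≤ N) (hA : IsRegGraph N d A) (hz : 0 < z.im)
    (hz' : 2 * z'.im = z.im) (hre : z'.re = z.re) (h : BootstrapBound d z A)
    (hp : ∀ u ∈ ({1, -1, Complex.I, -Complex.I} : Finset ℂ), ∀ i j,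
      potential d z' u (2 * Real.log N + 1) 81 (1 / 20) i j A < 0) : BootstrapBound d z' A := by
  refine bootstrapBound_of_potential hN ((h.1.halving hA hz hz' hre).mono (by norm_num))
    (fun h4 => ?_) hp
  have hn : ‖z'‖ ≤ ‖z‖ := by
    rw [Complex.norm_def, Complex.norm_def]
    refine Real.sqrt_le_sqrt ?_
    rw [Complex.normSq_apply, Complex.normSq_apply, hre, ← hz']
    nlinarith
  exact ((h.2 (h4.trans hn)).halving hA hz hz' hre).mono (by norm_num)

end bootstrap

/-- The spectral parameters `(m + 2 ^ k i) η`. -/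
noncomputable def gridPoint (η : ℝ) (m : ℤ) (k : ℕ) : ℂ := ⟨m * η, 2 ^ k * η⟩

section union
variable {N d : ℕ} {ξ η : ℝ}

lemma bootstrapBound_gridPoint {A : Fin N → Fin N → Bool} {m : ℤ} {K : ℕ} (hN : 10 ≤ N)
    (hA : IsRegGraph N d A) (hη : 0 < η) (hK : |m * η| + 1 ≤ 2 ^ K * η)
    (hp : ∀ k ≤ K, ∀ u ∈ ({1, -1, Complex.I, -Complex.I} : Finset ℂ), ∀ i j,
      potential d (gridPoint η m k) u (2 * Real.log N + 1) 81 (1 / 20) i j A < 0) :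
    BootstrapBound d (gridPoint η m 0) A := by
  have key : ∀ l ≤ K, BootstrapBound d (gridPoint η m (K - l)) A := by
    intro l
    induction l with
    | zero => exact fun _ => bootstrapBound_of_le hA (by simpa [gridPoint] using hK)
    | succ l ih =>
      intro hl
      have e : K - l = (K - (l + 1)) + 1 := by omega
      refine BootstrapBound.step (z := gridPoint η m (K - l)) hN hA
        (by simp only [gridPoint]; positivity) ?_ rfl (ih (by omega)) (hp _ (by omega))
      simp only [gridPoint]
      rw [e, pow_succ]; ring
  simpa using key K le_rfl

open Classical in
/-- With high probability the resolvent is bounded at all points of the grid. -/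
lemma card_not_greenBound_le (hN : 0 < N) (hξ : 10 ^ 30 ≤ ξ) (hNξ : Real.log N ≤ ξ)
    (hd : 10 ^ 15 * ξ ≤ Real.sqrt d) (hNd : 10 ^ 15 * ξ * Real.sqrt d ^ 3 ≤ N) :
    (((regGraphs N d).filter fun A => ¬ ∀ m : ℤ, |m| ≤ N ^ 2 →
      GreenBound 40 d (gridPoint (ξ ^ 2 / N) m 0) A).card : ℝ) ≤
      Real.exp (-(2 * ξ * Real.log ξ)) * (regGraphs N d).card := by
  have hN0 : (0 : ℝ) < N := by exact_mod_cast hN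
  have hN24 : (10 ^ 30 : ℝ) ≤ N := by
    have : 10 ^ 45 ≤ Real.sqrt d := by linarith
    have h3 : 1 ≤ Real.sqrt d ^ 3 := one_le_pow₀ (by linarith)
    nlinarith
  have hN24' : 10 ^ 30 ≤ N := by exact_mod_cast hN24
  set η := ξ ^ 2 / N with hη
  have hη0 : 0 < η := by positivity
  have hNη : N * η = ξ ^ 2 := by rw [hη]; field_simp
  set U : Finset ℂ := {1, -1, Complex.I, -Complex.I} with hU
  set Idx := ((Finset.Icc (-(N ^ 2 : ℤ)) (N ^ 2)) ×ˢ Finset.range (N + 1)) ×ˢ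
    (U ×ˢ (univ : Finset (Fin N × Fin N))) with hIdx
  set bad : ((ℤ × ℕ) × (ℂ × (Fin N × Fin N))) → Finset (Fin N → Fin N → Bool) := fun q =>
    (regGraphs N d).filter fun A => 0 ≤ potential d (gridPoint η q.1.1 q.1.2) q.2.1
      (2 * Real.log N + 1) 81 (1 / 20) q.2.2.1 q.2.2.2 A with hbad
  have hsub : ((regGraphs N d).filter fun A => ¬ ∀ m : ℤ, |m| ≤ N ^ 2 →
      GreenBound 40 d (gridPoint η m 0) A) ⊆ Idx.biUnion bad := by
    intro A hA
    rw [Finset.mem_filter] at hA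
    obtain ⟨hA1, hA2⟩ := hA
    by_contra hcon
    refine hA2 fun m hm => ?_
    refine (bootstrapBound_gridPoint (K := N) (le_trans (by norm_num) hN24') (mem_regGraphs.1 hA1)
      hη0 ?_ fun k hk u hu i j => ?_).1
    · rw [abs_mul, abs_of_pos hη0]
      have h1 : (|(m : ℝ)|) ≤ N ^ 2 := by exact_mod_cast hm
      have h2 : (N ^ 2 + N : ℝ) ≤ 2 ^ N := by
        have : ∀ n : ℕ, 5 ≤ n → n ^ 2 + n ≤ 2 ^ n := fun n hn => by
          induction n, hn using Nat.le_induction with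
          | base => norm_num
          | succ n hn ih => rw [pow_succ 2]; nlinarith
        exact_mod_cast this N (le_trans (by norm_num) hN24')
      have h3 := mul_le_mul_of_nonneg_right h1 hη0.le
      have h4 := mul_le_mul_of_nonneg_right h2 hη0.le
      have h5 : 1 ≤ N * η := by rw [hNη]; nlinarith
      linarith
    · by_contra! hc
      refine hcon (Finset.mem_biUnion.2 ⟨((m, k), (u, (i, j))), ?_, ?_⟩)
      · simp only [hIdx, Finset.mem_product, Finset.mem_Icc, Finset.mem_range, mem_univ, and_true]
        exact ⟨⟨abs_le.1 hm, by omega⟩, hu⟩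
      · exact Finset.mem_filter.2 ⟨hA1, hc⟩
  have hcard : (Idx.card : ℝ) ≤ N ^ 6 := by
    have hu4 : U.card ≤ 4 := Finset.card_le_four
    have h1 : Idx.card ≤ (2 * N ^ 2 + 1) * (N + 1) * (4 * (N * N)) := by
      rw [hIdx, Finset.card_product, Finset.card_product, Finset.card_product, Int.card_Icc,
        Finset.card_range, Finset.card_univ, Fintype.card_prod, Fintype.card_fin]
      have : ((N : ℤ) ^ 2 + 1 - -(N : ℤ) ^ 2).toNat = 2 * N ^ 2 + 1 := by
        have : ((N : ℤ) ^ 2 + 1 - -(N : ℤ) ^ 2) = ((2 * N ^ 2 + 1 : ℕ) : ℤ) := by push_cast; ring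
        rw [this, Int.toNat_natCast]
      rw [this]
      gcongr
    have h2 : (2 * N ^ 2 + 1) * (N + 1) * (4 * (N * N)) ≤ N ^ 6 := by
      have a1 : 2 * N ^ 2 + 1 ≤ 3 * N ^ 2 := by nlinarith
      have a2 : N + 1 ≤ 2 * N := by omega
      calc (2 * N ^ 2 + 1) * (N + 1) * (4 * (N * N)) ≤ (3 * N ^ 2) * (2 * N) * (4 * (N * N)) := by
            gcongr
        _ = 24 * N ^ 5 := by ring
        _ ≤ N * N ^ 5 := Nat.mul_le_mul_right _ (le_trans (by norm_num) hN24')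
        _ = N ^ 6 := by ring
    exact_mod_cast h1.trans h2
  have hone : ∀ q ∈ Idx, ((bad q).card : ℝ) ≤
      Real.exp (-(10 * ξ * Real.log ξ)) * (regGraphs N d).card := by
    rintro ⟨⟨m, k⟩, ⟨u, ⟨i, j⟩⟩⟩ hq
    have hu : ‖u‖ = 1 := by
      simp only [hIdx, hU, Finset.mem_product, Finset.mem_insert, Finset.mem_singleton] at hq
      rcases hq.2.1 with h | h | h | h <;> simp [h]
    have hz : 0 < (gridPoint η m k).im := by simp only [gridPoint]; positivity
    have := levelCount_potential_le (N := N) (d := d) (i := i) (j := j) (z := gridPoint η m k)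
      hz hu hξ hNξ (by
        simp only [gridPoint]
        have : (1 : ℝ) ≤ 2 ^ k := one_le_pow₀ (by norm_num)
        nlinarith) hd hNd
    refine le_trans (le_of_eq ?_) this
    rw [levelCount, hbad, Finset.card_filter]
    push_cast
    rfl
  have hlogξ : 1 ≤ Real.log ξ := by
    rw [Real.le_log_iff_exp_le (by linarith)]
    have := Real.exp_one_lt_d9
    linarith
  have h6 : (N : ℝ) ^ 6 ≤ Real.exp (6 * ξ) := by
    have : (N : ℝ) ^ 6 = Real.exp (6 * Real.log N) := by
      rw [show (6 : ℝ) = ((6 : ℕ) : ℝ) by norm_num, Real.exp_nat_mul, Real.exp_log hN0]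
    rw [this]
    exact Real.exp_le_exp.2 (by linarith)
  calc _ ≤ ((Idx.biUnion bad).card : ℝ) := by exact_mod_cast Finset.card_le_card hsub
    _ ≤ ∑ q ∈ Idx, ((bad q).card : ℝ) := by exact_mod_cast Finset.card_biUnion_le
    _ ≤ ∑ q ∈ Idx, Real.exp (-(10 * ξ * Real.log ξ)) * (regGraphs N d).card :=
      Finset.sum_le_sum hone
    _ = Idx.card * (Real.exp (-(10 * ξ * Real.log ξ)) * (regGraphs N d).card) := by
      rw [Finset.sum_const, nsmul_eq_mul]
    _ ≤ Real.exp (6 * ξ) * (Real.exp (-(10 * ξ * Real.log ξ)) * (regGraphs N d).card) :=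
      mul_le_mul_of_nonneg_right (hcard.trans h6) (by positivity)
    _ ≤ _ := by
      rw [← mul_assoc, ← Real.exp_add]
      refine mul_le_mul_of_nonneg_right (Real.exp_le_exp.2 ?_) (Nat.cast_nonneg _)
      nlinarith

end union

section moments
variable {E : Type*} [NormedAddCommGroup E] [InnerProductSpace ℝ E]

lemma norm_pow_smul_sub_le (m : ℕ) (x y : E) :
    ‖‖x‖ ^ m • x - ‖y‖ ^ m • y‖ ≤ (m + 1) * ‖x - y‖ * (‖x‖ ^ m + ‖y‖ ^ m) := by
  have hmax : (max ‖x‖ ‖y‖) ^ m ≤ ‖x‖ ^ m + ‖y‖ ^ m := by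
    rcases max_cases ‖x‖ ‖y‖ with ⟨h, -⟩ | ⟨h, -⟩ <;> rw [h]
    · exact le_add_of_nonneg_right (by positivity)
    · exact le_add_of_nonneg_left (by positivity)
  have e : ‖x‖ ^ m • x - ‖y‖ ^ m • y = ‖x‖ ^ m • (x - y) + (‖x‖ ^ m - ‖y‖ ^ m) • y := by
    rw [smul_sub, sub_smul]; abel
  have h1 : ‖x‖ ^ m ≤ (max ‖x‖ ‖y‖) ^ m := by gcongr; exact le_max_left _ _
  have h2 : |‖x‖ ^ m - ‖y‖ ^ m| * ‖y‖ ≤ m * ‖x - y‖ * (max ‖x‖ ‖y‖) ^ m := by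
    rcases Nat.eq_zero_or_pos m with rfl | hm
    · simp
    · have h3 := abs_pow_sub_pow_le ‖x‖ ‖y‖ m
      rw [abs_norm, abs_norm] at h3
      have h4 := abs_norm_sub_norm_le x y
      obtain ⟨l, rfl⟩ : ∃ l, m = l + 1 := ⟨m - 1, by omega⟩
      rw [Nat.add_sub_cancel] at h3
      calc _ ≤ (|‖x‖ - ‖y‖| * ((l + 1 : ℕ) : ℝ) * max ‖x‖ ‖y‖ ^ l) * max ‖x‖ ‖y‖ :=
            mul_le_mul h3 (le_max_right _ _) (norm_nonneg _) (by positivity)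
        _ ≤ (‖x - y‖ * ((l + 1 : ℕ) : ℝ) * max ‖x‖ ‖y‖ ^ l) * max ‖x‖ ‖y‖ := by gcongr
        _ = _ := by ring
  rw [e]
  refine (norm_add_le _ _).trans ?_
  rw [norm_smul, norm_smul, Real.norm_eq_abs, Real.norm_eq_abs, abs_of_nonneg (by positivity)]
  have h5 := mul_le_mul_of_nonneg_right h1 (norm_nonneg (x - y))
  have h6 := mul_le_mul_of_nonneg_left hmax
    (by positivity : 0 ≤ ((m : ℝ) + 1) * ‖x - y‖)
  linarith

variable {ι : Type*} [Fintype ι]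

lemma sum_sq_sub {a : ι → ℝ} (ha : ∑ i, a i = 0) (ha' : ∑ i, a i ^ 2 = 1) :
    ∑ i, ∑ l, (a i - a l) ^ 2 = 2 * Fintype.card ι := by
  have : ∀ i l, (a i - a l) ^ 2 = a i ^ 2 - 2 * (a i * a l) + a l ^ 2 := fun i l => by ring
  simp only [this, Finset.sum_add_distrib, Finset.sum_sub_distrib, ← Finset.mul_sum, ha, ha',
    Finset.sum_const, nsmul_eq_mul, card_univ, mul_zero]
  ring

variable [DecidableEq ι]

/-- A linear statistic of a randomly permuted family of vectors. -/
def permSum (a : ι → ℝ) (q : ι → E) (σ : Equiv.Perm ι) : E := ∑ i, a i • q (σ i)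

lemma permSum_sub_swap (a : ι → ℝ) (q : ι → E) (σ : Equiv.Perm ι) (i l : ι) :
    permSum a q σ - permSum a q (σ * Equiv.swap i l) = (a i - a l) • (q (σ i) - q (σ l)) := by
  by_cases hil : i = l
  · subst hil; simp [permSum]
  have h : permSum a q σ - permSum a q (σ * Equiv.swap i l) =
      ∑ j, a j • (q (σ j) - q (σ (Equiv.swap i l j))) := by
    simp only [permSum, ← Finset.sum_sub_distrib, smul_sub, Equiv.Perm.mul_apply]
  rw [h, ← Finset.sum_subset (Finset.subset_univ {i, l}), Finset.sum_pair hil,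
    Equiv.swap_apply_left, Equiv.swap_apply_right]
  · rw [sub_smul, ← neg_sub (q (σ i)) (q (σ l)), smul_neg]; abel
  · intro j _ hj
    simp only [Finset.mem_insert, Finset.mem_singleton, not_or] at hj
    rw [Equiv.swap_apply_of_ne_of_ne hj.1 hj.2, sub_self, smul_zero]

lemma sum_permSum_sub_swap {a : ι → ℝ} {q : ι → E} (ha : ∑ i, a i = 0)
    (σ : Equiv.Perm ι) :
    ∑ i, ∑ l, (permSum a q σ - permSum a q (σ * Equiv.swap i l)) =
      (2 * Fintype.card ι : ℝ) • permSum a q σ := by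
  simp only [permSum_sub_swap, sub_smul, smul_sub, Finset.sum_sub_distrib, Finset.sum_const,
    ← Finset.sum_smul, ← Finset.smul_sum, ha, zero_smul, card_univ]
  simp only [permSum, two_mul, add_smul, Nat.cast_smul_eq_nsmul, smul_zero, sub_zero, zero_sub,
    Finset.smul_sum, Finset.sum_add_distrib]
  abel_nf

lemma sum_norm_permSum_pow_succ_le {a : ι → ℝ} {q : ι → E} {κ : ℝ} (ha : ∑ i, a i = 0)
    (ha' : ∑ i, a i ^ 2 = 1) (hq : ∀ x, ‖q x‖ ^ 2 ≤ κ) (p : ℕ) :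
    ∑ σ, ‖permSum a q σ‖ ^ (2 * (p + 1)) ≤
      8 * κ * (p + 1) * ∑ σ, ‖permSum a q σ‖ ^ (2 * p) := by
  have hι : 0 < Fintype.card ι := by
    rw [Fintype.card_pos_iff]
    by_contra h
    rw [not_nonempty_iff] at h
    simp at ha'
  have hn : (0 : ℝ) < Fintype.card ι := by exact_mod_cast hι
  set S := permSum a q with hS
  set f : E → E := fun x => ‖x‖ ^ (2 * p) • x with hf
  have e1 : ∀ σ, 2 * Fintype.card ι * ‖S σ‖ ^ (2 * (p + 1)) =
      ∑ i, ∑ l, inner ℝ (S σ - S (σ * Equiv.swap i l)) (f (S σ)) := by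
    intro σ
    simp only [← sum_inner]
    rw [hS, sum_permSum_sub_swap ha, hf, inner_smul_left, inner_smul_right,
      real_inner_self_eq_norm_sq, conj_trivial]
    ring
  have e2 : ∀ i l, ∑ σ, inner ℝ (S σ - S (σ * Equiv.swap i l)) (f (S σ)) =
      -∑ σ, inner ℝ (S σ - S (σ * Equiv.swap i l)) (f (S (σ * Equiv.swap i l))) := by
    intro i l
    rw [← Equiv.sum_comp (Equiv.mulRight (Equiv.swap i l)), ← Finset.sum_neg_distrib]
    refine Finset.sum_congr rfl fun σ _ => ?_
    simp only [Equiv.coe_mulRight, mul_assoc, Equiv.swap_mul_self, mul_one]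
    rw [← inner_neg_left, neg_sub]
  have e3 : ∀ i l, 2 * ∑ σ, inner ℝ (S σ - S (σ * Equiv.swap i l)) (f (S σ)) ≤
      2 * ∑ σ, (2 * p + 1) * ‖S σ - S (σ * Equiv.swap i l)‖ ^ 2 * ‖S σ‖ ^ (2 * p) := by
    intro i l
    have h1 : 2 * ∑ σ, inner ℝ (S σ - S (σ * Equiv.swap i l)) (f (S σ)) =
        ∑ σ, inner ℝ (S σ - S (σ * Equiv.swap i l)) (f (S σ) - f (S (σ * Equiv.swap i l))) := by
      simp only [inner_sub_right _ (f _), Finset.sum_sub_distrib]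
      linarith [e2 i l]
    have h2 : ∑ σ, (2 * p + 1) * ‖S σ - S (σ * Equiv.swap i l)‖ ^ 2 *
        ‖S (σ * Equiv.swap i l)‖ ^ (2 * p) =
        ∑ σ, (2 * p + 1) * ‖S σ - S (σ * Equiv.swap i l)‖ ^ 2 * ‖S σ‖ ^ (2 * p) := by
      rw [← Equiv.sum_comp (Equiv.mulRight (Equiv.swap i l))]
      refine Finset.sum_congr rfl fun σ _ => ?_
      simp only [Equiv.coe_mulRight, mul_assoc, Equiv.swap_mul_self, mul_one]
      rw [norm_sub_rev]
    rw [h1, two_mul]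
    nth_rewrite 2 [← h2]
    rw [← Finset.sum_add_distrib]
    refine Finset.sum_le_sum fun σ _ => (real_inner_le_norm _ _).trans ?_
    have := mul_le_mul_of_nonneg_left (norm_pow_smul_sub_le (2 * p) (S σ)
      (S (σ * Equiv.swap i l))) (norm_nonneg (S σ - S (σ * Equiv.swap i l)))
    refine this.trans (le_of_eq ?_)
    push_cast
    ring
  have e4 : ∀ σ, ∑ i, ∑ l, ‖S σ - S (σ * Equiv.swap i l)‖ ^ 2 ≤ 8 * κ * Fintype.card ι := by
    intro σ
    have : 8 * κ * Fintype.card ι = ∑ i, ∑ l, (a i - a l) ^ 2 * (4 * κ) := by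
      simp only [← Finset.sum_mul]
      rw [sum_sq_sub ha ha']; ring
    rw [this]
    refine Finset.sum_le_sum fun i _ => Finset.sum_le_sum fun l _ => ?_
    rw [hS, permSum_sub_swap, norm_smul, mul_pow, Real.norm_eq_abs, sq_abs]
    refine mul_le_mul_of_nonneg_left ?_ (sq_nonneg _)
    have := norm_sub_le (q (σ i)) (q (σ l))
    have h1 := hq (σ i)
    have h2 := hq (σ l)
    have := pow_le_pow_left₀ (norm_nonneg _) this 2
    nlinarith [sq_nonneg (‖q (σ i)‖ - ‖q (σ l)‖)]
  have key : 2 * Fintype.card ι * ∑ σ, ‖S σ‖ ^ (2 * (p + 1)) ≤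
      2 * Fintype.card ι * (8 * κ * (p + 1) * ∑ σ, ‖S σ‖ ^ (2 * p)) := by
    calc _ = ∑ i, ∑ l, ∑ σ, inner ℝ (S σ - S (σ * Equiv.swap i l)) (f (S σ)) := by
          rw [Finset.mul_sum]
          simp only [e1]
          rw [Finset.sum_comm]
          refine Finset.sum_congr rfl fun i _ => Finset.sum_comm
      _ ≤ ∑ i, ∑ l, ∑ σ, (2 * p + 1) * ‖S σ - S (σ * Equiv.swap i l)‖ ^ 2 * ‖S σ‖ ^ (2 * p) :=
          Finset.sum_le_sum fun i _ => Finset.sum_le_sum fun l _ => by linarith [e3 i l]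
      _ = ∑ σ, (2 * p + 1) * (∑ i, ∑ l, ‖S σ - S (σ * Equiv.swap i l)‖ ^ 2) *
            ‖S σ‖ ^ (2 * p) := by
          simp only [Finset.mul_sum, Finset.sum_mul]
          rw [eq_comm, Finset.sum_comm]
          refine Finset.sum_congr rfl fun i _ => Finset.sum_comm
      _ ≤ ∑ σ, (2 * p + 2) * (8 * κ * Fintype.card ι) * ‖S σ‖ ^ (2 * p) := by
          refine Finset.sum_le_sum fun σ _ => ?_
          have h0 : 0 ≤ ∑ i, ∑ l, ‖S σ - S (σ * Equiv.swap i l)‖ ^ 2 :=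
            Finset.sum_nonneg fun _ _ => Finset.sum_nonneg fun _ _ => by positivity
          gcongr
          · norm_num
          · exact e4 σ
      _ = _ := by
          rw [← Finset.mul_sum]; ring
  exact le_of_mul_le_mul_left key (by positivity)

lemma sum_norm_permSum_pow_le {a : ι → ℝ} {q : ι → E} {κ : ℝ} (ha : ∑ i, a i = 0)
    (ha' : ∑ i, a i ^ 2 = 1) (hκ : 0 ≤ κ) (hq : ∀ x, ‖q x‖ ^ 2 ≤ κ) {n p : ℕ} (hp : p ≤ n) :
    ∑ σ, ‖permSum a q σ‖ ^ (2 * p) ≤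
      (8 * κ * n) ^ p * Fintype.card (Equiv.Perm ι) := by
  induction p with
  | zero => simp
  | succ p ih =>
    refine (sum_norm_permSum_pow_succ_le ha ha' hq p).trans ?_
    have h1 : ((p : ℝ) + 1) ≤ n := by exact_mod_cast hp
    calc _ ≤ 8 * κ * n * ((8 * κ * n) ^ p * Fintype.card (Equiv.Perm ι)) := by
          gcongr
          exact ih (by omega)
      _ = _ := by ring

/-- A concentration inequality for linear statistics of random permutations. -/
lemma card_permSum_gt_le {a : ι → ℝ} {q : ι → E} {κ : ℝ} (ha : ∑ i, a i = 0)
    (ha' : ∑ i, a i ^ 2 = 1) (hκ : 0 < κ) (hq : ∀ x, ‖q x‖ ^ 2 ≤ κ) {n : ℕ} (hn : 0 < n) :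
    ((univ.filter fun σ : Equiv.Perm ι => 24 * κ * n < ‖permSum a q σ‖ ^ 2).card : ℝ) ≤
      Real.exp (-n) * Fintype.card (Equiv.Perm ι) := by
  have hn0 : (0 : ℝ) < n := by exact_mod_cast hn
  have h1 : (24 * κ * n) ^ n * ((univ.filter fun σ : Equiv.Perm ι =>
      24 * κ * n < ‖permSum a q σ‖ ^ 2).card : ℝ) ≤ (8 * κ * n) ^ n *
        Fintype.card (Equiv.Perm ι) := by
    refine le_trans ?_ (sum_norm_permSum_pow_le ha ha' hκ.le hq le_rfl)
    rw [mul_comm, ← nsmul_eq_mul]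
    refine (Finset.card_nsmul_le_sum _ (fun σ => ‖permSum a q σ‖ ^ (2 * n)) _ fun σ hσ => ?_).trans
      (Finset.sum_le_sum_of_subset_of_nonneg (Finset.subset_univ _) fun σ _ _ => by positivity)
    rw [pow_mul]
    exact pow_le_pow_left₀ (by positivity) (Finset.mem_filter.1 hσ).2.le n
  have h2 : (24 * κ * n) ^ n = (8 * κ * n) ^ n * 3 ^ n := by rw [← mul_pow]; ring
  rw [h2, mul_assoc] at h1
  have h3 := le_of_mul_le_mul_left h1 (by positivity)
  have h4 : Real.exp n ≤ 3 ^ n := by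
    rw [← mul_one (n : ℝ), Real.exp_nat_mul]
    gcongr
    linarith [Real.exp_one_lt_d9]
  rw [Real.exp_neg, ← div_eq_inv_mul, le_div_iff₀ (Real.exp_pos _), mul_comm]
  exact (mul_le_mul_of_nonneg_right h4 (Nat.cast_nonneg _)).trans h3

end moments

/-- The graph obtained by permuting the vertices. -/
def vertexPerm {N : ℕ} (σ : Equiv.Perm (Fin N)) (A : Fin N → Fin N → Bool) :
    Fin N → Fin N → Bool :=
  fun a b => A (σ a) (σ b)

section vertexPerm
variable {N d : ℕ} {z : ℂ} {A : Fin N → Fin N → Bool} (σ : Equiv.Perm (Fin N))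

lemma IsRegGraph.vertexPerm (hA : IsRegGraph N d A) : IsRegGraph N d (vertexPerm σ A) := by
  refine ⟨fun i j => hA.1 _ _, fun i => hA.2.1 _, fun i => ?_⟩
  rw [← hA.2.2 (σ i)]
  refine Finset.card_bij (fun a _ => σ a) (fun a ha => ?_) (fun a _ b _ h => σ.injective h)
    fun b hb => ⟨σ.symm b, ?_, by simp⟩
  · exact Finset.mem_filter.2 ⟨mem_univ _, (Finset.mem_filter.1 ha).2⟩
  · refine Finset.mem_filter.2 ⟨mem_univ _, ?_⟩
    simpa [_root_.vertexPerm] using (Finset.mem_filter.1 hb).2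

lemma sum_vertexPerm (f : (Fin N → Fin N → Bool) → ℝ) :
    ∑ A ∈ regGraphs N d, f (vertexPerm σ A) = ∑ A ∈ regGraphs N d, f A := by
  refine Finset.sum_nbij' (vertexPerm σ) (vertexPerm σ⁻¹) (fun A hA => ?_) (fun A hA => ?_)
    (fun A _ => ?_) (fun A _ => ?_) fun A _ => rfl
  · exact mem_regGraphs.2 ((mem_regGraphs.1 hA).vertexPerm _)
  · exact mem_regGraphs.2 ((mem_regGraphs.1 hA).vertexPerm _)
  · funext x y; simp [vertexPerm]
  · funext x y; simp [vertexPerm]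

lemma green_vertexPerm : green d z (vertexPerm σ A) = (green d z A).submatrix σ σ := by
  have h1 : (((Real.sqrt d)⁻¹ : ℝ) • adjC (vertexPerm σ A)) - z • 1 =
      ((((Real.sqrt d)⁻¹ : ℝ) • adjC A) - z • 1).submatrix σ σ := by
    ext a b
    have h : adjC (vertexPerm σ A) a b = adjC A (σ a) (σ b) := rfl
    simp [h, Matrix.one_apply]
  have h2 : projPerp N = (projPerp N).submatrix σ σ := by
    ext a b
    simp [projPerp, Matrix.one_apply]
  rw [green, green, resMat, resMat, h1, Matrix.inv_submatrix_equiv]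
  nth_rewrite 1 [h2]
  rw [Matrix.submatrix_mul_equiv]

end vertexPerm

/-- The squared norm of the resolvent applied to a vector. -/
noncomputable def isoNormSq {N : ℕ} (d : ℕ) (z : ℂ) (a : Fin N → ℝ)
    (A : Fin N → Fin N → Bool) : ℝ :=
  ∑ b, ‖∑ i, a i * green d z A i b‖ ^ 2

section isotropic
variable {N d : ℕ} {z : ℂ} {a : Fin N → ℝ}

lemma isoNormSq_vertexPerm (σ : Equiv.Perm (Fin N)) (A : Fin N → Fin N → Bool) :
    isoNormSq d z a (vertexPerm σ A) =
      ‖permSum a (fun x => (WithLp.toLp 2 (green d z A x) : EuclideanSpace ℂ (Fin N))) σ‖ ^ 2 := by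
  rw [EuclideanSpace.norm_sq_eq, isoNormSq, green_vertexPerm]
  rw [← Equiv.sum_comp σ fun b => ‖(permSum a (fun x =>
    (WithLp.toLp 2 (green d z A x) : EuclideanSpace ℂ (Fin N))) σ) b‖ ^ 2]
  refine Finset.sum_congr rfl fun b _ => ?_
  congr 2
  simp [permSum]

open Classical in
/-- The resolvent applied to a delocalized vector is small for most graphs. -/
lemma card_isoNormSq_gt_le (hz : 0 < z.im) (ha : ∑ i, a i ^ 2 = 1) (ha' : ∑ i, a i = 0) {n : ℕ}
    (hn : 0 < n) :
    (((regGraphs N d).filter fun A => GreenBound 40 d z A ∧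
      24 * (40 / z.im) * n < isoNormSq d z a A).card : ℝ) ≤
      Real.exp (-n) * (regGraphs N d).card := by
  set P : (Fin N → Fin N → Bool) → ℝ := fun A =>
    if GreenBound 40 d z A ∧ 24 * (40 / z.im) * n < isoNormSq d z a A then 1 else 0 with hP
  have hc : (((regGraphs N d).filter fun A => GreenBound 40 d z A ∧
      24 * (40 / z.im) * n < isoNormSq d z a A).card : ℝ) = ∑ A ∈ regGraphs N d, P A := by
    rw [Finset.card_filter]; push_cast; rfl
  have h1 : Fintype.card (Equiv.Perm (Fin N)) * ∑ A ∈ regGraphs N d, P A =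
      ∑ A ∈ regGraphs N d, ∑ σ : Equiv.Perm (Fin N), P (vertexPerm σ A) := by
    rw [Finset.sum_comm]
    simp only [sum_vertexPerm]
    simp
  have h2 : ∀ A ∈ regGraphs N d, ∑ σ : Equiv.Perm (Fin N), P (vertexPerm σ A) ≤
      Real.exp (-n) * Fintype.card (Equiv.Perm (Fin N)) := by
    intro A hA
    have hA' := mem_regGraphs.1 hA
    by_cases hG : GreenBound 40 d z A
    · refine le_trans ?_ (card_permSum_gt_le (κ := 40 / z.im)
        (q := fun x => (WithLp.toLp 2 (green d z A x) : EuclideanSpace ℂ (Fin N))) ha' ha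
        (by positivity) (fun x => ?_) hn)
      · rw [Finset.card_filter]
        push_cast
        refine Finset.sum_le_sum fun σ _ => ?_
        simp only [hP]
        rw [isoNormSq_vertexPerm]
        split_ifs with h h'
        · exact le_rfl
        · exact absurd h.2 h'
        · norm_num
        · exact le_rfl
      · rw [EuclideanSpace.norm_sq_eq]
        exact green_sum_sq_le hA' hz (hG.norm_le x x)
    · refine le_trans (le_of_eq ?_) (by positivity : (0 : ℝ) ≤ _)
      refine Finset.sum_eq_zero fun σ _ => if_neg fun h => hG fun x y => ?_
      have := h.1 (σ.symm x) (σ.symm y)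
      rw [green_vertexPerm] at this
      simpa using this
  rw [hc]
  have h3 := Finset.sum_le_sum h2
  rw [← h1, Finset.sum_const, nsmul_eq_mul] at h3
  refine le_of_mul_le_mul_left ?_
    (by exact_mod_cast Fintype.card_pos : (0 : ℝ) < Fintype.card (Equiv.Perm (Fin N)))
  linarith

end isotropic

section eigenvector
variable {N d : ℕ} {z : ℂ} {A : Fin N → Fin N → Bool} {a v : Fin N → ℝ} {lam : ℝ}

/-- Eigenvectors are controlled by the resolvent near the eigenvalue. -/
lemma abs_sum_mul_le_of_mulVec (hA : IsRegGraph N d A) (hz : 0 < z.im) (ha : ∑ i, a i = 0)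
    (hv : ∑ i, v i ^ 2 = 1) (hlam : (adjOf A).mulVec v = lam • v) :
    |∑ i, a i * v i| ≤ ‖((lam / Real.sqrt d : ℝ) : ℂ) - z‖ * Real.sqrt (isoNormSq d z a A) := by
  set w : Fin N → ℂ := fun i => v i with hw
  set α : Fin N → ℂ := fun i => a i with hα
  set μ : ℂ := ((lam / Real.sqrt d : ℝ) : ℂ) - z with hμ
  have h1 : adjC A *ᵥ w = (lam : ℂ) • w := by
    ext i
    have := congrFun hlam i
    simp only [mulVec, dotProduct, adjOf, Matrix.of_apply, Pi.smul_apply, smul_eq_mul] at this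
    simp only [mulVec, dotProduct, adjC, Matrix.of_apply, Pi.smul_apply, smul_eq_mul, hw]
    rw [← Complex.ofReal_mul, ← this]
    push_cast
    refine Finset.sum_congr rfl fun j _ => ?_
    split_ifs <;> simp
  have h2 : ((((Real.sqrt d)⁻¹ : ℝ) • adjC A) - z • 1) *ᵥ w = μ • w := by
    rw [sub_mulVec, smul_mulVec, smul_mulVec, one_mulVec, h1, hμ, sub_smul]
    congr 1
    ext i
    simp only [Pi.smul_apply, smul_eq_mul, Complex.real_smul]
    push_cast; ring
  have h3 : projPerp N *ᵥ w = μ • (green d z A *ᵥ w) := by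
    rw [← (green_isRes hA hz).right, ← mulVec_mulVec, h2, mulVec_smul]
  have hα0 : ∑ i, α i = 0 := by
    simp only [hα]; exact_mod_cast congrArg (fun x : ℝ => (x : ℂ)) ha
  have h4 : α ⬝ᵥ (projPerp N *ᵥ w) = ((∑ i, a i * v i : ℝ) : ℂ) := by
    rw [projPerp, sub_mulVec, one_mulVec, dotProduct_sub]
    have : α ⬝ᵥ ((Matrix.of fun _ _ => (N : ℂ)⁻¹ : Matrix (Fin N) (Fin N) ℂ) *ᵥ w) = 0 := by
      simp only [dotProduct, mulVec, Matrix.of_apply]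
      rw [← Finset.sum_mul, hα0, zero_mul]
    rw [this, sub_zero]
    simp [dotProduct, hα, hw]
  have h5 : ‖α ⬝ᵥ (green d z A *ᵥ w)‖ ≤ Real.sqrt (isoNormSq d z a A) := by
    have e : α ⬝ᵥ (green d z A *ᵥ w) = ∑ b, (∑ i, a i * green d z A i b) * v b := by
      simp only [dotProduct, mulVec, Finset.mul_sum, Finset.sum_mul]
      rw [Finset.sum_comm]
      simp only [hα, hw, mul_assoc]
    rw [e]
    refine (norm_sum_le _ _).trans (Real.le_sqrt_of_sq_le ?_)
    simp only [norm_mul, Complex.norm_real]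
    refine (Finset.sum_mul_sq_le_sq_mul_sq _ _ _).trans (le_of_eq ?_)
    simp only [Real.norm_eq_abs, sq_abs, hv, mul_one, isoNormSq]
  rw [← Real.norm_eq_abs, ← Complex.norm_real, ← h4, h3, dotProduct_smul, smul_eq_mul, norm_mul]
  exact mul_le_mul_of_nonneg_left h5 (norm_nonneg _)

lemma abs_eigenvalue_le (hv : ∑ i, v i ^ 2 = 1) (hlam : (adjOf A).mulVec v = lam • v) :
    |lam| ≤ N := by
  have h1 : ∀ i, (lam * v i) ^ 2 ≤ N := by
    intro i
    have := congrFun hlam i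
    simp only [mulVec, dotProduct, adjOf, Matrix.of_apply, Pi.smul_apply, smul_eq_mul] at this
    rw [← this]
    refine (Finset.sum_mul_sq_le_sq_mul_sq _ _ _).trans ?_
    rw [hv, mul_one]
    refine (Finset.sum_le_sum (g := fun _ => (1 : ℝ)) fun j _ => ?_).trans (by simp)
    split_ifs <;> norm_num
  have h2 : lam ^ 2 ≤ N ^ 2 := by
    have := Finset.sum_le_sum (s := univ) fun i (_ : i ∈ univ) => h1 i
    simp only [mul_pow, ← Finset.mul_sum, hv, Finset.sum_const, card_univ, Fintype.card_fin,
      nsmul_eq_mul] at this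
    nlinarith
  exact abs_le_of_sq_le_sq h2 (by positivity)

/-- Delocalization of all eigenvectors in the direction `a`, given resolvent bounds on a grid. -/
lemma abs_sum_mul_le_of_isoNormSq {η K : ℝ} (hA : IsRegGraph N d A) (hd : 0 < d)
    (ha : ∑ i, a i = 0) (hη : 0 < η) (hηN : 1 ≤ N * η) (hN : 4 ≤ N) (hd4 : 4 ≤ d)
    (hK : ∀ m : ℤ, |m| ≤ N ^ 2 → isoNormSq d (gridPoint η m 0) a A ≤ K)
    (hv : ∑ i, v i ^ 2 = 1) (hlam : (adjOf A).mulVec v = lam • v) :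
    |∑ i, a i * v i| ≤ 2 * η * Real.sqrt K := by
  have hN' : (4 : ℝ) ≤ N := by exact_mod_cast hN
  set x := lam / Real.sqrt d with hx
  set m := round (x / η) with hm
  have hr := abs_sub_round (x / η)
  rw [← hm] at hr
  have hsd : 2 ≤ Real.sqrt d := by
    apply Real.le_sqrt_of_sq_le
    norm_num; exact_mod_cast hd4
  have hx1 : |x / η| ≤ N ^ 2 / 2 := by
    rw [hx, abs_div, abs_div, abs_of_pos hη, abs_of_nonneg (Real.sqrt_nonneg _), div_div,
      div_le_div_iff₀ (by positivity) two_pos]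
    have h1 := abs_eigenvalue_le hv hlam
    have h2 : (N : ℝ) ≤ N ^ 2 * η := by nlinarith
    have h3 : N ^ 2 * η * 2 ≤ N ^ 2 * η * Real.sqrt d := by gcongr
    linarith
  have hmN : |m| ≤ N ^ 2 := by
    have : (|(m : ℝ)|) ≤ N ^ 2 := by
      have := abs_sub_abs_le_abs_sub (m : ℝ) (x / η)
      rw [abs_sub_comm] at this
      nlinarith
    exact_mod_cast this
  have him : (gridPoint η m 0).im = η := by simp [gridPoint]
  have h1 := abs_sum_mul_le_of_mulVec (z := gridPoint η m 0) hA (by rw [him]; exact hη) ha hv hlam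
  refine h1.trans ?_
  refine mul_le_mul ?_ (Real.sqrt_le_sqrt (hK m hmN)) (Real.sqrt_nonneg _) (by positivity)
  refine (Complex.norm_le_abs_re_add_abs_im _).trans ?_
  have h2 : ((x : ℂ) - gridPoint η m 0).re = (x / η - m) * η := by
    simp [gridPoint]; field_simp
  have h3 : ((x : ℂ) - gridPoint η m 0).im = -η := by simp [gridPoint]
  rw [h2, h3, abs_mul, abs_neg, abs_of_pos hη]
  nlinarith

end eigenvector

/-- A regular graph of every admissible degree exists, as a circulant graph. -/
lemma exists_isRegGraph {N d : ℕ} (hdN : d < N) (he : Even (N * d)) :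
    ∃ A : Fin N → Fin N → Bool, IsRegGraph N d A := by
  classical
  have : NeZero N := ⟨by omega⟩
  set k := d / 2 with hk
  have hpar : d % 2 = 1 → N % 2 = 0 := fun h => by
    rcases Nat.even_mul.1 he with h' | h'
    · exact Nat.even_iff.1 h'
    · have := Nat.even_iff.1 h'; omega
  set T : Finset ℕ := (Finset.Icc 1 k ∪ Finset.Icc (N - k) (N - 1)) ∪
    (if d % 2 = 1 then {N / 2} else ∅) with hT
  have hTc : T.card = d := by
    rw [hT, Finset.card_union_of_disjoint, Finset.card_union_of_disjoint]
    · split_ifs with h <;> simp <;> omega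
    · rw [Finset.disjoint_left]; intro x hx hx'
      rw [Finset.mem_Icc] at hx hx'; omega
    · rw [Finset.disjoint_left]; intro x hx hx'
      split_ifs at hx' with h
      · have := hpar h
        simp only [Finset.mem_union, Finset.mem_Icc, Finset.mem_singleton] at hx hx'
        omega
      · simp at hx'
  have hTr : ∀ t ∈ T, 0 < t ∧ t < N ∧ N - t ∈ T := by
    intro t ht
    rw [hT] at ht ⊢
    split_ifs at ht ⊢ with h
    · have := hpar h
      simp only [Finset.mem_union, Finset.mem_Icc, Finset.mem_singleton] at ht ⊢
      omega
    · simp only [Finset.mem_union, Finset.mem_Icc, Finset.notMem_empty, or_false] at ht ⊢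
      omega
  have hsymm : ∀ i j : Fin N, (i - j).val ∈ T → (j - i).val ∈ T := by
    intro i j h
    obtain ⟨h1, h2, h3⟩ := hTr _ h
    have : (j - i).val = N - (i - j).val := by
      rw [← neg_sub, Fin.val_neg]
      rw [if_neg]
      intro h0
      rw [h0] at h1
      simp at h1
    rwa [this]
  refine ⟨fun i j => decide ((j - i).val ∈ T), fun i j => ?_, fun i => ?_, fun i => ?_⟩
  · exact decide_eq_decide.2 ⟨hsymm _ _, hsymm _ _⟩
  · simp only [sub_self, decide_eq_false_iff_not]
    intro h
    have := (hTr _ h).1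
    simp at this
  · rw [← hTc]
    refine Finset.card_bij (fun j _ => (j - i).val) (fun j hj => ?_) (fun j _ j' _ h => ?_)
      fun t ht => ⟨i + ⟨t, (hTr t ht).2.1⟩, ?_, ?_⟩
    · simpa using hj
    · simpa using Fin.val_injective h
    · simpa using ht
    · simp

lemma cardOf_eq_card_filter {N d : ℕ} (P : Matrix (Fin N) (Fin N) ℝ → Prop)
    [DecidablePred fun A : Fin N → Fin N → Bool => P (adjOf A)] :
    cardOf (fun G : Fin N → Fin N → Bool => IsRegGraph N d G ∧ P (adjOf G)) =
      ((regGraphs N d).filter fun A => P (adjOf A)).card := by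
  unfold cardOf
  congr 1
  ext A
  simp [mem_regGraphs]

section assembly
variable {N d n : ℕ} {ξ : ℝ} {a : Fin N → ℝ}

/-- Isotropic delocalization at the scale `ξ ^ 2 / N`. -/
lemma one_sub_le_unifProb (hN : 0 < N) (hξ : 10 ^ 30 ≤ ξ) (hNξ : Real.log N ≤ ξ)
    (hd : 10 ^ 15 * ξ ≤ Real.sqrt d) (hNd : 10 ^ 15 * ξ * Real.sqrt d ^ 3 ≤ N)
    (he : Even (N * d)) (ha : ∑ i, a i ^ 2 = 1) (ha' : ∑ i, a i = 0) (hn : 0 < n) :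
    1 - Real.exp (-(2 * ξ * Real.log ξ)) - 3 * N ^ 2 * Real.exp (-n) ≤
      unifProb N d fun A => ∀ (v : Fin N → ℝ) (lam : ℝ), (∑ i, v i ^ 2) = 1 →
        A.mulVec v = lam • v → |∑ i, a i * v i| ≤ 62 * ξ * Real.sqrt n / Real.sqrt N := by
  classical
  have hN0 : (0 : ℝ) < N := by exact_mod_cast hN
  have hs0 : 1 ≤ Real.sqrt d := by linarith
  have hd4 : 4 ≤ d := by
    have h1 : (4 : ℝ) ≤ Real.sqrt d ^ 2 := by nlinarith
    rw [Real.sq_sqrt (by positivity)] at h1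
    exact_mod_cast h1
  have hdN : d < N := by
    have h1 : (d : ℝ) < N := by
      have h2 : Real.sqrt d ^ 2 = d := Real.sq_sqrt (by positivity)
      have h3 : Real.sqrt d ^ 2 ≤ Real.sqrt d ^ 3 := pow_le_pow_right₀ hs0 (by norm_num)
      have h4 : 0 < Real.sqrt d ^ 3 := by positivity
      nlinarith
    exact_mod_cast h1
  set η := ξ ^ 2 / N with hη
  have hη0 : 0 < η := by positivity
  have hNη : N * η = ξ ^ 2 := by rw [hη]; field_simp
  set R : ℝ := ((regGraphs N d).card : ℝ) with hR
  have hR0 : 0 < R := by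
    obtain ⟨A, hA⟩ := exists_isRegGraph hdN he
    rw [hR]
    exact_mod_cast Finset.card_pos.2 ⟨A, mem_regGraphs.2 hA⟩
  set Q : Matrix (Fin N) (Fin N) ℝ → Prop := fun A => ∀ (v : Fin N → ℝ) (lam : ℝ),
    (∑ i, v i ^ 2) = 1 → A.mulVec v = lam • v →
      |∑ i, a i * v i| ≤ 62 * ξ * Real.sqrt n / Real.sqrt N with hQ
  set bad : ℤ → Finset (Fin N → Fin N → Bool) := fun m => (regGraphs N d).filter fun A =>
    GreenBound 40 d (gridPoint η m 0) A ∧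
      24 * (40 / (gridPoint η m 0).im) * n < isoNormSq d (gridPoint η m 0) a A with hbad
  set bad' := (regGraphs N d).filter fun A => ¬ ∀ m : ℤ, |m| ≤ N ^ 2 →
      GreenBound 40 d (gridPoint η m 0) A with hbad'
  set I : Finset ℤ := Finset.Icc (-(N ^ 2 : ℤ)) (N ^ 2) with hI
  have him : ∀ m, (gridPoint η m 0).im = η := fun m => by simp [gridPoint]
  have hsub : regGraphs N d ⊆ ((regGraphs N d).filter fun A => Q (adjOf A)) ∪
      (bad' ∪ I.biUnion bad) := by
    intro A hA
    by_contra hcon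
    simp only [Finset.mem_union, not_or] at hcon
    obtain ⟨h1, h2, h3⟩ := hcon
    refine h1 (Finset.mem_filter.2 ⟨hA, fun v lam hv hlam => ?_⟩)
    have h4 : ∀ m : ℤ, |m| ≤ N ^ 2 → GreenBound 40 d (gridPoint η m 0) A := by
      by_contra h
      exact h2 (Finset.mem_filter.2 ⟨hA, h⟩)
    have h5 : ∀ m : ℤ, |m| ≤ N ^ 2 → isoNormSq d (gridPoint η m 0) a A ≤ 24 * (40 / η) * n := by
      intro m hm
      by_contra! h
      refine h3 (Finset.mem_biUnion.2 ⟨m, Finset.mem_Icc.2 (abs_le.1 hm),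
        Finset.mem_filter.2 ⟨hA, h4 m hm, ?_⟩⟩)
      rwa [him]
    refine (abs_sum_mul_le_of_isoNormSq (mem_regGraphs.1 hA) (by omega) ha' hη0
      (by rw [hNη]; exact one_le_pow₀ (by linarith)) (by omega) hd4 h5 hv hlam).trans ?_
    rw [le_div_iff₀ (by positivity)]
    have e : 2 * η * Real.sqrt (24 * (40 / η) * n) * Real.sqrt N =
        Real.sqrt (4 * 960) * ξ * Real.sqrt n := by
      rw [show 2 * η * Real.sqrt (24 * (40 / η) * n) * Real.sqrt N =
        Real.sqrt ((2 * η) ^ 2) * Real.sqrt (24 * (40 / η) * n) * Real.sqrt N by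
          rw [Real.sqrt_sq (by positivity)],
        show Real.sqrt (4 * 960) * ξ * Real.sqrt n =
          Real.sqrt (4 * 960) * Real.sqrt (ξ ^ 2) * Real.sqrt n by
          rw [Real.sqrt_sq (by linarith)],
        ← Real.sqrt_mul (by positivity), ← Real.sqrt_mul (by positivity),
        ← Real.sqrt_mul (by positivity), ← Real.sqrt_mul (by positivity), ← hNη]
      congr 1
      field_simp
      ring
    rw [e]
    have h6 : Real.sqrt (4 * 960) ≤ 62 := Real.sqrt_le_iff.2 (by norm_num)
    have h7 : 0 ≤ ξ := by linarith
    gcongr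
  have hcard : R ≤ ((regGraphs N d).filter fun A => Q (adjOf A)).card +
      (Real.exp (-(2 * ξ * Real.log ξ)) * R + 3 * N ^ 2 * Real.exp (-n) * R) := by
    have h1 : (regGraphs N d).card ≤ ((regGraphs N d).filter fun A => Q (adjOf A)).card +
        (bad'.card + ∑ m ∈ I, (bad m).card) :=
      (Finset.card_le_card hsub).trans ((Finset.card_union_le _ _).trans
        (add_le_add le_rfl ((Finset.card_union_le _ _).trans
          (add_le_add le_rfl Finset.card_biUnion_le))))
    have h2 : R ≤ ((regGraphs N d).filter fun A => Q (adjOf A)).card +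
        (bad'.card + ∑ m ∈ I, ((bad m).card : ℝ)) := by rw [hR]; exact_mod_cast h1
    refine h2.trans (add_le_add le_rfl (add_le_add ?_ ?_))
    · convert card_not_greenBound_le hN hξ hNξ hd hNd
    · have h3 : ∀ m ∈ I, ((bad m).card : ℝ) ≤ Real.exp (-n) * R := by
        intro m _
        convert card_isoNormSq_gt_le (d := d) (z := gridPoint η m 0) (by rw [him]; exact hη0)
          ha ha' hn
      refine (Finset.sum_le_sum h3).trans ?_
      rw [Finset.sum_const, nsmul_eq_mul]
      have h4 : (I.card : ℝ) ≤ 3 * N ^ 2 := by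
        have h5 : I.card = 2 * N ^ 2 + 1 := by
          rw [hI, Int.card_Icc]
          have : (N ^ 2 : ℤ) + 1 - -(N ^ 2 : ℤ) = ((2 * N ^ 2 + 1 : ℕ) : ℤ) := by push_cast; ring
          rw [this, Int.toNat_natCast]
        rw [h5]
        have : 1 ≤ (N : ℝ) ^ 2 := one_le_pow₀ (by exact_mod_cast hN)
        push_cast
        linarith
      rw [mul_assoc (3 * (N : ℝ) ^ 2)]
      gcongr
  have hden : cardOf (fun G : Fin N → Fin N → Bool => IsRegGraph N d G) =
      (regGraphs N d).card := rfl
  change _ ≤ unifProb N d Q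
  rw [unifProb, cardOf_eq_card_filter, hden, ← hR, le_div_iff₀ hR0]
  linarith

end assembly

/-- The elementary consequences of the assumptions on the parameters. -/
lemma parameter_bounds {N d : ℕ} {ξ : ℝ} (hN : 0 < N) (hd : 3 ≤ d) (hξ : 0 < ξ)
    (hlog : 10 ^ 100 * Real.log N ^ 2 ≤ ξ * Real.log ξ) (hD : 10 ^ 100 * ξ ^ 2 ≤ Dunif N d) :
    10 ^ 15 * ξ ≤ Real.sqrt d ∧ 10 ^ 15 * ξ * Real.sqrt d ^ 3 ≤ N ∧ 2 ≤ Real.log N ∧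
      10 ^ 70 * Real.log N * Real.sqrt (Real.log N) ≤ ξ := by
  have hN0 : (0 : ℝ) < N := by exact_mod_cast hN
  have hd0 : (1 : ℝ) ≤ d := by exact_mod_cast (by omega : 1 ≤ d)
  have hs0 : 1 ≤ Real.sqrt d := Real.one_le_sqrt.2 hd0
  have hsd : Real.sqrt d ^ 2 = d := Real.sq_sqrt (by positivity)
  have hξ1 : 1 ≤ ξ := by
    by_contra! h
    have h1 := Real.log_neg hξ h
    have h2 : 0 ≤ ξ * Real.log ξ := le_trans (by positivity) hlog
    nlinarith
  have h1 : 10 ^ 100 * ξ ^ 2 ≤ d := hD.trans (min_le_left _ _)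
  have h2 : 10 ^ 100 * ξ ^ 2 * d ^ 3 ≤ N ^ 2 := by
    have := hD.trans (min_le_right _ _)
    rwa [le_div_iff₀ (by positivity)] at this
  have h3 : 10 ^ 50 * ξ ≤ Real.sqrt d := by
    apply Real.le_sqrt_of_sq_le
    refine le_trans (le_of_eq ?_) h1
    ring
  have h4 : 10 ^ 50 * ξ * Real.sqrt d ^ 3 ≤ N := by
    refine (sq_le_sq₀ (by positivity) hN0.le).1 (le_trans (le_of_eq ?_) h2)
    rw [mul_pow, mul_pow, pow_right_comm (Real.sqrt d), hsd]
    ring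
  have hs3 : 1 ≤ Real.sqrt d ^ 3 := one_le_pow₀ hs0
  have h5 : (10 : ℝ) ^ 50 ≤ N := by
    refine le_trans ?_ h4
    nlinarith
  have hL : 2 ≤ Real.log N := by
    rw [Real.le_log_iff_exp_le hN0]
    have : Real.exp 2 = Real.exp 1 ^ 2 := by rw [← Real.exp_nat_mul]; norm_num
    have h6 := Real.exp_one_lt_d9
    have h7 := Real.exp_pos 1
    rw [this]
    nlinarith
  refine ⟨by linarith, by nlinarith, hL, ?_⟩
  set L := Real.log N with hLdef
  obtain ⟨y, hy0, hy⟩ : ∃ y : ℝ, 0 < y ∧ y ^ 3 = ξ :=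
    ⟨ξ ^ (1 / 3 : ℝ), by positivity, by
      rw [← Real.rpow_natCast, ← Real.rpow_mul hξ.le]; norm_num⟩
  have h6 : Real.log ξ ≤ 3 * y := by
    rw [← hy, Real.log_pow]
    have := Real.log_le_self hy0.le
    push_cast
    linarith
  have h7 : 10 ^ 98 * L ^ 2 ≤ (y ^ 2) ^ 2 := by
    have : ξ * Real.log ξ ≤ ξ * (3 * y) := by gcongr
    have e : ξ * (3 * y) = 3 * (y ^ 2) ^ 2 := by rw [← hy]; ring
    nlinarith [sq_nonneg L]
  have h8 : 10 ^ 49 * L ≤ y ^ 2 := by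
    refine (sq_le_sq₀ (by positivity) (by positivity)).1 (le_trans (le_of_eq ?_) h7)
    ring
  have h9 : (10 ^ 49 * L) ^ 3 ≤ ξ ^ 2 := by
    calc (10 ^ 49 * L) ^ 3 ≤ (y ^ 2) ^ 3 := by gcongr
      _ = ξ ^ 2 := by rw [← hy]; ring
  refine (sq_le_sq₀ (by positivity) hξ.le).1 (le_trans ?_ h9)
  have e : (10 ^ 70 * L * Real.sqrt L) ^ 2 = 10 ^ 140 * L ^ 3 := by
    rw [mul_pow, Real.sq_sqrt (by positivity)]; ring
  rw [e, mul_pow]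
  gcongr
  norm_num

lemma mul_sqrt_log_le {ζ : ℝ} (hζ : 1 ≤ ζ) : ζ * Real.sqrt (Real.log ζ) ≤ ζ ^ 4 := by
  have h1 : Real.sqrt (Real.log ζ) ≤ ζ := by
    refine Real.sqrt_le_iff.2 ⟨by linarith, ?_⟩
    have := Real.log_le_self (by linarith : 0 ≤ ζ)
    nlinarith
  calc ζ * Real.sqrt (Real.log ζ) ≤ ζ * ζ := by gcongr
    _ = ζ ^ 2 := by ring
    _ ≤ ζ ^ 4 := pow_le_pow_right₀ hζ (by norm_num)

lemma unifProb_mono {N d : ℕ} {P Q : Matrix (Fin N) (Fin N) ℝ → Prop} (h : ∀ A, P A → Q A) :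
    unifProb N d P ≤ unifProb N d Q := by
  classical
  unfold unifProb
  rw [cardOf_eq_card_filter, cardOf_eq_card_filter]
  gcongr
  exact h _

end

/-- **Isotropic eigenvector delocalization** for the uniform model of random
`d`-regular graphs: for a deterministic unit vector `a ⊥ e`, with high probability
every ℓ²-normalized eigenvector `v` of the adjacency matrix satisfies
`|⟨a, v⟩| ≤ C ξ ζ² / √N`. -/
theorem isotropic_eigenvector_delocalization_uniform :
    ∃ c0 C : ℝ, 0 < c0 ∧ 0 < C ∧
      ∀ N d : ℕ, 0 < N → 3 ≤ d → Even (N * d) →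
        ∀ ξ : ℝ, 0 < ξ → c0 * Real.log N ^ 2 ≤ ξ * Real.log ξ →
          c0 * ξ ^ 2 ≤ Dunif N d →
          ∀ a : Fin N → ℝ, (∑ i, a i ^ 2) = 1 → (∑ i, a i) = 0 →
            ∀ ζ : ℝ, c0 ≤ ζ →
              1 - Real.exp (-(ξ * Real.log ξ)) -
                  Real.exp (-ζ * Real.sqrt (Real.log ζ)) ≤
                unifProb N d fun A =>
                  ∀ (v : Fin N → ℝ) (lam : ℝ), (∑ i, v i ^ 2) = 1 →
                    A.mulVec v = lam • v →
                    |∑ i, a i * v i| ≤ C * ξ * ζ ^ 2 / Real.sqrt N := by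
  refine ⟨10 ^ 100, 200, by positivity, by positivity, ?_⟩
  intro N d hN hd he ξ hξ hlog hD a ha ha' ζ hζ
  obtain ⟨hξd, hξN, hL, hξL⟩ := parameter_bounds hN hd hξ hlog hD
  have hN0 : (0 : ℝ) < N := by exact_mod_cast hN
  have hζ1 : 1 ≤ ζ := le_trans (by norm_num) hζ
  have hζ4 : 1 ≤ ζ ^ 4 := one_le_pow₀ hζ1
  have hζlog := mul_sqrt_log_le hζ1
  set L := Real.log N with hLdef
  set s := Real.sqrt L with hs
  have hsL : s ^ 2 = L := Real.sq_sqrt (by linarith)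
  have hs1 : 1 ≤ s := Real.one_le_sqrt.2 (by linarith)
  have hNL : (N : ℝ) ^ 2 = Real.exp (2 * L) := by
    rw [two_mul, Real.exp_add, hLdef, Real.exp_log hN0, sq]
  have h3 : (3 : ℝ) ≤ Real.exp 2 := by
    have := Real.add_one_le_exp (2 : ℝ)
    linarith
  have hgrid : ∀ n : ℕ, 3 * N ^ 2 * Real.exp (-n) ≤ Real.exp (2 + 2 * L - n) := by
    intro n
    rw [hNL, show 2 + 2 * L - (n : ℝ) = 2 + 2 * L + -n by ring, Real.exp_add, Real.exp_add]
    gcongr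
  have hξ' : 10 ^ 70 * L ≤ ξ / s := by
    rw [le_div_iff₀ (by linarith)]; exact hξL
  have hξξ : ξ / s ≤ ξ := div_le_self hξ.le hs1
  rw [neg_mul]
  by_cases hcase : L ≤ ζ ^ 4
  · set n := ⌈5 * ζ ^ 4⌉₊ with hn
    have hn1 : 5 * ζ ^ 4 ≤ n := Nat.le_ceil _
    have hn2 : (n : ℝ) ≤ 6 * ζ ^ 4 := by
      have := Nat.ceil_lt_add_one (by positivity : 0 ≤ 5 * ζ ^ 4)
      linarith
    have hn0 : 0 < n := Nat.ceil_pos.2 (by positivity)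
    have hlogξ : 0 ≤ Real.log ξ := Real.log_nonneg (by linarith)
    have key := one_sub_le_unifProb (ξ := ξ) hN (by linarith) (by linarith) hξd hξN he ha ha' hn0
    refine le_trans ?_ (key.trans (unifProb_mono fun A hA v lam hv hlam =>
      (hA v lam hv hlam).trans ?_))
    · have h4 : Real.exp (-(2 * ξ * Real.log ξ)) ≤ Real.exp (-(ξ * Real.log ξ)) := by
        rw [Real.exp_le_exp]
        nlinarith [mul_nonneg hξ.le hlogξ]
      have h5 : Real.exp (2 + 2 * L - n) ≤ Real.exp (-(ζ * Real.sqrt (Real.log ζ))) := by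
        rw [Real.exp_le_exp]
        linarith
      linarith [hgrid n]
    · have h6 : Real.sqrt n ≤ 3 * ζ ^ 2 := by
        refine Real.sqrt_le_iff.2 ⟨by positivity, hn2.trans ?_⟩
        nlinarith
      refine div_le_div_of_nonneg_right ?_ (Real.sqrt_nonneg _)
      calc 62 * ξ * Real.sqrt n ≤ 62 * ξ * (3 * ζ ^ 2) := by gcongr
        _ ≤ 200 * ξ * ζ ^ 2 := by nlinarith [mul_nonneg hξ.le (sq_nonneg ζ)]
  · push Not at hcase
    set n := ⌈5 * L⌉₊ with hn
    have hn1 : 5 * L ≤ n := Nat.le_ceil _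
    have hn2 : (n : ℝ) ≤ 6 * L := by
      have := Nat.ceil_lt_add_one (by positivity : 0 ≤ 5 * L)
      linarith
    have hn0 : 0 < n := Nat.ceil_pos.2 (by positivity)
    set ξ' := ξ / s with hξ'def
    have hξ0 : 0 < ξ' := by positivity
    have hlogξ : 1 ≤ Real.log ξ' := by
      rw [Real.le_log_iff_exp_le hξ0]
      linarith [Real.exp_one_lt_d9]
    have key := one_sub_le_unifProb (ξ := ξ') hN (by linarith) (by linarith) (by linarith)
      (le_trans (by gcongr) hξN) he ha ha' hn0
    refine le_trans ?_ (key.trans (unifProb_mono fun A hA v lam hv hlam =>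
      (hA v lam hv hlam).trans ?_))
    · have h4 : Real.exp (-(2 * ξ' * Real.log ξ')) ≤ Real.exp (-L - 1) := by
        rw [Real.exp_le_exp]
        nlinarith [mul_le_mul_of_nonneg_left hlogξ hξ0.le]
      have h5 : Real.exp (2 + 2 * L - n) ≤ Real.exp (-L - 1) := by
        rw [Real.exp_le_exp]
        linarith
      have h6 : Real.exp (-L - 1) ≤ Real.exp (-L) / 2 := by
        rw [sub_eq_add_neg, Real.exp_add, div_eq_mul_inv, Real.exp_neg 1]
        have : 2 ≤ Real.exp 1 := by linarith [Real.add_one_le_exp (1 : ℝ)]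
        gcongr
      have h7 : Real.exp (-L) ≤ Real.exp (-(ζ * Real.sqrt (Real.log ζ))) := by
        rw [Real.exp_le_exp]
        linarith
      linarith [hgrid n, Real.exp_pos (-(ξ * Real.log ξ))]
    · have h6 : Real.sqrt n ≤ 3 * s := by
        refine Real.sqrt_le_iff.2 ⟨by positivity, hn2.trans ?_⟩
        nlinarith
      refine div_le_div_of_nonneg_right ?_ (Real.sqrt_nonneg _)
      calc 62 * ξ' * Real.sqrt n ≤ 62 * ξ' * (3 * s) := by gcongr
        _ = 186 * ξ := by rw [hξ'def]; field_simp; ring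
        _ ≤ 200 * ξ * ζ ^ 2 := by
          have : 1 ≤ ζ ^ 2 := one_le_pow₀ hζ1
          have h := mul_le_mul_of_nonneg_left this hξ.le
          linarith

end
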